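/- Let A₁, …, Aₙ be finite-dimensional simple ℚ-algebras and let S be an order in the product A = A₁ × ⋯ × Aₙ. Then the group of units S* is virtually a direct product of finitely many free groups if and only if for each i, the algebra Aᵢ is either commutative (a number field), a totally definite quaternion algebra, or isomorphic to the 2×2 matrix algebra M₂(ℚ). -/

import Mathlib

open Quaternion

/-- An order in a finite-dimensional `ℚ`-algebra `A`: a subring that is finitely
generated as a `ℤ`-module and whose `ℚ`-span is all of `A`. -/
def IsOrderIn {A : Type} [Ring A] [Algebra ℚ A] (S : Subring A) : Prop :=
  S.toAddSubgroup.FG ∧ Submodule.span ℚ (S : Set A) = ⊤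

/-- A totally definite quaternion algebra: a quaternion algebra `(a,b/K)` over a
totally real number field `K` with `σ a < 0` and `σ b < 0` for every real
embedding `σ : K → ℝ`. -/
def IsTotallyDefiniteQuaternionAlgebra (B : Type) [Ring B] : Prop :=
  ∃ (K : Type) (_ : Field K) (_ : Algebra ℚ K), FiniteDimensional ℚ K ∧
    (∀ σ : K →+* ℂ, ∀ x : K, (σ x).im = 0) ∧
    ∃ a b : K, a ≠ 0 ∧ b ≠ 0 ∧ (∀ σ : K →+* ℝ, σ a < 0 ∧ σ b < 0) ∧
      Nonempty (B ≃+* ℍ[K, a, b])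

/-- A group is virtually a direct product of finitely many free groups if it has a
finite-index subgroup isomorphic to a finite direct product of free groups. -/
def IsVirtuallyDirectProductOfFreeGroups (Γ : Type) [Group Γ] : Prop :=
  ∃ H : Subgroup Γ, H.FiniteIndex ∧
    ∃ (m : ℕ) (X : Fin m → Type), Nonempty (↥H ≃* ∀ j, FreeGroup (X j))

/-! ### Free groups -/

section FreeGroupFacts

open FreeGroup (of reduce)

/-- the last letter of a reduced word -/
noncomputable def lastLetter {X : Type} (g : FreeGroup X) : Option (X × Bool) := by
  classical exact g.toWord.getLast?

lemma lastLetter_letter_mul {X : Type} (l : X × Bool) (g : FreeGroup X)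
    (h : lastLetter (FreeGroup.mk [l] * g) ≠ lastLetter g) : 
    g = 1 ∨ g = FreeGroup.mk [(l.1, !l.2)] := by
  classical
  unfold lastLetter at h
  have h1 : (FreeGroup.mk [l] * g).toWord = reduce (l :: g.toWord) := by
    conv_lhs => rw [← FreeGroup.mk_toWord (x := g)]
    rw [FreeGroup.mul_mk, FreeGroup.toWord_mk]; rfl
  rw [h1, FreeGroup.reduce.cons, FreeGroup.reduce_toWord] at h
  rcases hw : g.toWord with _ | ⟨hd, tl⟩
  · left; exact FreeGroup.toWord_eq_nil_iff.mp hw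
  · rw [hw] at h
    simp only at h
    split_ifs at h with hc
    · rcases tl with _ | ⟨t, tl⟩
      · right
        have : g = FreeGroup.mk [hd] := by rw [← hw, FreeGroup.mk_toWord]
        rw [this]
        obtain ⟨c1, c2⟩ := hc
        congr 2
        ext
        · exact c1.symm
        · simp [c2]
      · simp at h
    · simp at h

lemma finite_lastLetter_boundary {X : Type} (x : X × Bool) (τ : FreeGroup X) :
    {e : FreeGroup X | lastLetter e = some x ∧ lastLetter (τ * e) ≠ some x}.Finite := by
  have key : ∀ L : List (X × Bool), 
      {e : FreeGroup X | lastLetter e = some x ∧ 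
        lastLetter (FreeGroup.mk L * e) ≠ some x}.Finite := by
    intro L
    induction L with
    | nil =>
      convert Set.finite_empty
      ext e
      have : (FreeGroup.mk [] : FreeGroup X) = 1 := rfl
      simp [this]
    | cons l L ih =>
      have hm : (FreeGroup.mk (l :: L) : FreeGroup X) = FreeGroup.mk [l] * FreeGroup.mk L := by
        rw [FreeGroup.mul_mk]; rfl
      have hfin : ((fun e => FreeGroup.mk L * e) ⁻¹' 
          ({1, FreeGroup.mk [(l.1, !l.2)]} : Set (FreeGroup X))).Finite :=
        Set.Finite.preimage ((mul_right_injective _).injOn) (by simp)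
      refine (ih.union hfin).subset ?_
      rintro e ⟨h1, h2⟩
      by_cases h3 : lastLetter (FreeGroup.mk L * e) = some x
      · right
        rw [hm, mul_assoc] at h2
        have := lastLetter_letter_mul l (FreeGroup.mk L * e) (by rw [h3]; exact h2)
        simpa using this
      · left; exact ⟨h1, h3⟩
  obtain ⟨L, rfl⟩ := Quot.exists_rep τ
  exact key L

lemma lastLetter_of_pow {X : Type} (x : X) (n : ℕ) (hn : 0 < n) :
    lastLetter (of x ^ n) = some (x, true) := by
  classical
  unfold lastLetter
  rw [FreeGroup.toWord_of_pow]
  cases n with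
  | zero => omega
  | succ n => simp [List.getLast?_replicate]

lemma lastLetter_pow_mul {X : Type} (x y : X) (n m : ℕ) (hm : 0 < m) :
    lastLetter (of x ^ n * of y ^ m) = some (y, true) := by
  induction n with
  | zero => simpa using lastLetter_of_pow y m hm
  | succ n ih =>
    rw [pow_succ', mul_assoc]
    by_contra h
    have hne : lastLetter (FreeGroup.mk [(x, true)] * (of x ^ n * of y ^ m)) ≠
      lastLetter (of x ^ n * of y ^ m) := by rw [ih]; exact h
    rcases lastLetter_letter_mul _ _ hne with h1 | h1
    · rw [h1] at ih
      simp [lastLetter] at ih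
    · rw [h1] at ih
      simp [lastLetter] at ih

lemma freeGroup_center_trivial {X : Type} {x y : X} (hxy : x ≠ y) (z : FreeGroup X)
    (hz : ∀ g, z * g = g * z) : z = 1 := by
  classical
  by_contra hne
  have hw : z.toWord ≠ [] := fun h => hne (FreeGroup.toWord_eq_nil_iff.mp h)
  obtain ⟨c, hc⟩ : ∃ c, lastLetter z = some c := by
    unfold lastLetter
    exact ⟨_, List.getLast?_eq_getLast_of_ne_nil hw⟩
  obtain ⟨a, ha⟩ : ∃ a : X, a ≠ c.1 := by
    by_cases h : x = c.1
    · exact ⟨y, fun h' => hxy (h.trans h'.symm)⟩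
    · exact ⟨x, h⟩
  -- look at `z * a = a * z`, with `z * a` ending in `a`
  have h1 : lastLetter (z * of a) = some (a, true) := by
    have : ∀ L : List (X × Bool), FreeGroup.IsReduced L → (∀ c, L.getLast? = some c → c.1 ≠ a) →
        (reduce (L ++ [(a, true)])) = L ++ [(a, true)] := by
      intro L hL hc
      apply FreeGroup.IsReduced.reduce_eq
      unfold FreeGroup.IsReduced at *
      rw [List.isChain_append]
      refine ⟨hL, by simp, ?_⟩
      intro p hp q hq
      simp at hq
      subst hq
      intro h
      exact absurd h (hc p hp)
    unfold lastLetter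
    rw [FreeGroup.toWord_mul, FreeGroup.toWord_of, this _ FreeGroup.isReduced_toWord]
    · simp
    · intro c' hc'
      have : c' = c := by
        unfold lastLetter at hc
        rw [hc] at hc'; exact (Option.some.inj hc').symm
      rw [this]; exact ha.symm
  rw [hz] at h1
  have h2 := lastLetter_letter_mul (a, true) z (by
    change lastLetter (of a * z) ≠ _
    rw [h1, hc]
    intro h
    exact ha (congrArg Prod.fst (Option.some.inj h)))
  rcases h2 with h2 | h2
  · exact hne h2
  · rw [h2] at hc
    simp [lastLetter] at hc
    exact ha (by rw [← hc])

/-- Commutation is transitive on non-trivial elements of a free group. -/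
lemma freeGroup_comm_trans {G : Type} [Group G] [IsFreeGroup G] {u a b : G} (hu : u ≠ 1)
    (ha : Commute u a) (hb : Commute u b) : Commute a b := by
  let C := Subgroup.centralizer ({u} : Set G)
  have haC : a ∈ C := by
    rw [Subgroup.mem_centralizer_singleton_iff]; exact ha.eq.symm
  have hbC : b ∈ C := by
    rw [Subgroup.mem_centralizer_singleton_iff]; exact hb.eq.symm
  have huC : u ∈ C := by
    rw [Subgroup.mem_centralizer_singleton_iff]
  let e := IsFreeGroup.toFreeGroup C
  by_cases hs : Subsingleton (IsFreeGroup.Generators C)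
  · have hcomm : ∀ p q : FreeGroup (IsFreeGroup.Generators C), p * q = q * p := by
      intro p q
      have hcen : ∀ q : FreeGroup (IsFreeGroup.Generators C), ∀ p : FreeGroup (IsFreeGroup.Generators C), 
          (∀ i, Commute (of i) p) → Commute q p := by
        intro q p h
        induction q using FreeGroup.induction_on with
        | C1 => exact Commute.one_left _
        | of x => exact h x
        | inv_of x hx => exact (h x).inv_left
        | mul x y hx hy => exact hx.mul_left hy
      refine hcen p q fun i => (hcen q (of i) fun j => ?_).symm
      rw [Subsingleton.elim i j]
    have := hcomm (e ⟨a, haC⟩) (e ⟨b, hbC⟩)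
    rw [← map_mul, ← map_mul] at this
    have := congrArg Subtype.val (e.injective this)
    exact this
  · rw [not_subsingleton_iff_nontrivial] at hs
    obtain ⟨x, y, hxy⟩ := hs
    exfalso
    have h1 : e ⟨u, huC⟩ = 1 := by
      refine freeGroup_center_trivial hxy _ fun g => ?_
      obtain ⟨⟨c, hc⟩, rfl⟩ := e.surjective g
      rw [← map_mul, ← map_mul]
      congr 1
      apply Subtype.ext
      exact ((Subgroup.mem_centralizer_singleton_iff).mp hc).symm
    rw [map_eq_one_iff e e.injective] at h1
    exact hu (congrArg Subtype.val h1)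

lemma isFreeGroup_pow_eq_one {G : Type} [Group G] [IsFreeGroup G] {a : G} {n : ℕ} (hn : n ≠ 0) 
    (h : a ^ n = 1) : a = 1 := by
  let e := IsFreeGroup.toFreeGroup G
  have h2 : (e a) ^ n = 1 := by rw [← map_pow, h, map_one]
  have := (pow_eq_one_iff_left hn).mp h2
  exact (map_eq_one_iff e e.injective).mp this

/-- powers commute implies commute -/
lemma freeGroup_commute_of_pow {G : Type} [Group G] [IsFreeGroup G] {a b : G} {n m : ℕ} (hn : n ≠ 0)
    (hm : m ≠ 0) (h : Commute (a ^ n) (b ^ m)) : Commute a b := by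
  by_cases ha : a = 1
  · subst ha; exact Commute.one_left _
  by_cases hb : b = 1
  · subst hb; exact Commute.one_right _
  have ha' : a ^ n ≠ 1 := fun h => ha (isFreeGroup_pow_eq_one hn h)
  have hb' : b ^ m ≠ 1 := fun h => hb (isFreeGroup_pow_eq_one hm h)
  have h1 : Commute a (b ^ m) := freeGroup_comm_trans ha' (Commute.pow_self a n) h
  exact freeGroup_comm_trans hb' h1.symm (Commute.pow_self b m)

/-- commutative subgroups of free groups are cyclic -/
lemma freeGroup_cyclic_of_comm {G : Type} [Group G] [IsFreeGroup G] (C : Subgroup G)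
    (hcomm : ∀ p ∈ C, ∀ q ∈ C, p * q = q * p) : ∃ c ∈ C, ∀ p ∈ C, ∃ k : ℤ, p = c ^ k := by
  let e := IsFreeGroup.toFreeGroup C
  have hs : Subsingleton (IsFreeGroup.Generators C) := by
    by_contra hs
    rw [not_subsingleton_iff_nontrivial] at hs
    obtain ⟨x, y, hxy⟩ := hs
    have := freeGroup_center_trivial hxy (of x) (by
      intro g
      obtain ⟨p, hp⟩ := e.surjective (of x)
      obtain ⟨q, hq⟩ := e.surjective g
      rw [← hp, ← hq, ← map_mul, ← map_mul]
      congr 1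
      exact Subtype.ext (hcomm _ p.2 _ q.2))
    exact FreeGroup.of_ne_one x this
  rcases isEmpty_or_nonempty (IsFreeGroup.Generators C) with hE | ⟨⟨x⟩⟩
  · refine ⟨1, C.one_mem, fun p hp => ⟨0, ?_⟩⟩
    have : e ⟨p, hp⟩ = e 1 := Subsingleton.elim _ _
    simpa using congrArg Subtype.val (e.injective this)
  · have hcyc : ∀ g : FreeGroup (IsFreeGroup.Generators C), ∃ k : ℤ, g = of x ^ k := by
      intro g
      induction g using FreeGroup.induction_on with
      | C1 => exact ⟨0, by simp⟩
      | of y => exact ⟨1, by rw [Subsingleton.elim y x]; simp⟩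
      | inv_of y _ => exact ⟨-1, by rw [Subsingleton.elim y x]; simp⟩
      | mul p q hp hq => 
        obtain ⟨k, rfl⟩ := hp
        obtain ⟨l, rfl⟩ := hq
        exact ⟨k + l, (zpow_add _ _ _).symm⟩
    refine ⟨e.symm (of x), (e.symm (of x)).2, fun p hp => ?_⟩
    obtain ⟨k, hk⟩ := hcyc (e ⟨p, hp⟩)
    refine ⟨k, ?_⟩
    have : (⟨p, hp⟩ : C) = e.symm (of x) ^ k := by
      rw [← map_zpow, ← hk, MulEquiv.symm_apply_apply]
    simpa using congrArg Subtype.val this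

/-- commuting elements have a common power -/
lemma freeGroup_common_pow {G : Type} [Group G] [IsFreeGroup G] {a b : G} (h : Commute a b) :
    ∃ n m : ℤ, (n ≠ 0 ∨ m ≠ 0) ∧ a ^ n = b ^ m := by
  let C := Subgroup.closure ({a, b} : Set G)
  have hcomm : ∀ p ∈ C, ∀ q ∈ C, p * q = q * p := by
    intro p hp q hq
    refine Subgroup.closure_induction₂ (p := fun x y _ _ => x * y = y * x) ?_ ?_ ?_ ?_ ?_ ?_ ?_ hp hq
    · rintro x y (rfl | rfl) (rfl | rfl)
      · rfl
      · exact h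
      · exact h.symm
      · rfl
    · simp
    · simp
    · intro x y z _ _ _ hx hy
      exact (Commute.mul_left (show Commute x z from hx) hy)
    · intro x y z _ _ _ hx hy
      exact (Commute.mul_right (show Commute _ _ from hx) hy)
    · intro x y _ _ hx
      exact Commute.inv_left (show Commute _ _ from hx)
    · intro x y _ _ hx
      exact Commute.inv_right (show Commute _ _ from hx)
  have ha : a ∈ C := Subgroup.subset_closure (by simp)
  have hb : b ∈ C := Subgroup.subset_closure (by simp)
  obtain ⟨c, hc, hcyc⟩ := freeGroup_cyclic_of_comm C hcomm
  obtain ⟨k, hk⟩ := hcyc a ha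
  obtain ⟨l, hl⟩ := hcyc b hb
  have key : ∀ n m : ℤ, k * n = l * m → a ^ n = b ^ m := by
    intro n m hnm
    rw [hk, hl, ← zpow_mul, ← zpow_mul, hnm]
  by_cases h0 : l = 0 ∧ k = 0
  · exact ⟨1, 1, by simp, key 1 1 (by rw [h0.1, h0.2])⟩
  · refine ⟨l, k, by tauto, key _ _ (mul_comm _ _)⟩

/-- If `g u g⁻¹` commutes with `u`, then `g` commutes with `u`. -/
lemma freeGroup_commute_of_conj {G : Type} [Group G] [IsFreeGroup G] {g u : G} 
    (h : Commute (g * u * g⁻¹) u) : Commute g u := by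
  by_cases hu : u = 1
  · subst hu; exact Commute.one_right _
  by_cases hg : g = 1
  · subst hg; exact Commute.one_left _
  have hv : g * u * g⁻¹ ≠ 1 := by
    simpa [conj_eq_one_iff] using hu
  obtain ⟨c, hc, hcyc⟩ := freeGroup_cyclic_of_comm (Subgroup.centralizer ({u} : Set G)) (by
    intro p hp q hq
    rw [Subgroup.mem_centralizer_singleton_iff] at hp hq
    exact freeGroup_comm_trans hu (show Commute u p from hp.symm) (show Commute u q from hq.symm))
  rw [Subgroup.mem_centralizer_singleton_iff] at hc
  have hcu : Commute u c := hc.symm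
  have hc1 : c ≠ 1 := by
    rintro rfl
    obtain ⟨k, hk⟩ := hcyc u (by rw [Subgroup.mem_centralizer_singleton_iff])
    simp at hk; exact hu hk
  -- `g c g⁻¹` and `g⁻¹ c g` commute with `u`
  have h1 : Commute u (g * c * g⁻¹) := by
    refine freeGroup_comm_trans hv h ?_
    have := hcu.map (MulAut.conj g).toMonoidHom
    simpa using this
  have h2 : Commute u (g⁻¹ * c * g) := by
    have h' : Commute (g⁻¹ * u * g) u := by
      have := h.map (MulAut.conj g⁻¹).toMonoidHom
      simp [mul_assoc] at this
      simpa [mul_assoc] using this.symm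
    have hv' : g⁻¹ * u * g ≠ 1 := by
      intro h; apply hu
      have : u = g * (g⁻¹ * u * g) * g⁻¹ := by group
      rw [this, h]; group
    refine freeGroup_comm_trans hv' h' ?_
    have := hcu.map (MulAut.conj g⁻¹).toMonoidHom
    simpa using this
  obtain ⟨k, hk⟩ := hcyc (g * c * g⁻¹) (by
    rw [Subgroup.mem_centralizer_singleton_iff]; exact h1.symm)
  obtain ⟨l, hl⟩ := hcyc (g⁻¹ * c * g) (by
    rw [Subgroup.mem_centralizer_singleton_iff]; exact h2.symm)
  have hkl : c ^ (l * k - 1) = 1 := by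
    have : c = g * (g⁻¹ * c * g) * g⁻¹ := by group
    rw [hl, ← conj_zpow, hk, ← zpow_mul] at this
    rw [zpow_sub, zpow_one, mul_comm l k, ← this, mul_inv_cancel]
  have hz : ∀ j : ℤ, c ^ j = 1 → j = 0 := by
    intro j hj
    by_contra hj0
    have : c ^ j.natAbs = 1 := by
      rcases Int.natAbs_eq j with h | h
      · rw [h] at hj; simpa using hj
      · rw [h] at hj; simpa using hj
    exact hc1 (isFreeGroup_pow_eq_one (by simpa using hj0) this)
  have hkl' := hz _ hkl
  have hk2 : k * k = 1 := by
    rcases Int.isUnit_iff.mp (IsUnit.of_mul_eq_one l (by linarith : k * l = 1)) with h | h <;> simp [h]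
  -- `g²` commutes with `c`
  have hg2 : Commute (g ^ 2) c := by
    have : g ^ 2 * c * (g ^ 2)⁻¹ = c := by
      calc g ^ 2 * c * (g ^ 2)⁻¹ = g * (g * c * g⁻¹) * g⁻¹ := by simp [pow_two, mul_assoc]
        _ = c := by rw [hk, ← conj_zpow, hk, ← zpow_mul, hk2, zpow_one]
    exact mul_inv_eq_iff_eq_mul.mp this
  have hgc : Commute g c := freeGroup_commute_of_pow (n := 2) (m := 1) (by simp) (by simp) (by simpa using hg2)
  exact freeGroup_comm_trans hc1 hgc.symm hcu.symm

end FreeGroupFacts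

/-! ### Orders and commensurability -/

section Orders

/-- The group of units of a subring, as a subgroup of the units of the ambient ring. -/
abbrev unitGroup {A : Type} [Ring A] (S : Subring A) : Subgroup Aˣ := S.toSubmonoid.units

lemma mem_unitGroup {A : Type} [Ring A] (S : Subring A) (u : Aˣ) :
    u ∈ unitGroup S ↔ (u : A) ∈ S ∧ ((u⁻¹ : Aˣ) : A) ∈ S := by
  rw [Submonoid.mem_units_iff]; rfl

lemma order_clear_one {A : Type} [Ring A] [Algebra ℚ A] {S : Subring A} (hS : IsOrderIn S) (x : A) :
    ∃ N : ℕ, N ≠ 0 ∧ N • x ∈ S := by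
  have hx : x ∈ Submodule.span ℚ (S : Set A) := by rw [hS.2]; trivial
  induction hx using Submodule.span_induction with
  | mem x h => exact ⟨1, one_ne_zero, by simpa using h⟩
  | zero => exact ⟨1, one_ne_zero, by simp⟩
  | add x y _ _ hx hy =>
    obtain ⟨N, hN, h1⟩ := hx
    obtain ⟨M, hM, h2⟩ := hy
    refine ⟨N * M, mul_ne_zero hN hM, ?_⟩
    rw [smul_add]
    refine S.add_mem ?_ ?_
    · rw [mul_comm, mul_smul]; exact S.nsmul_mem h1 M
    · rw [mul_smul]; exact S.nsmul_mem h2 N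
  | smul q x _ hx =>
    obtain ⟨N, hN, h1⟩ := hx
    refine ⟨q.den * N, mul_ne_zero q.den_nz hN, ?_⟩
    have : (q.den * N) • q • x = q.num • (N • x) := by
      rw [← Nat.cast_smul_eq_nsmul ℚ, ← Nat.cast_smul_eq_nsmul ℚ N, ← Int.cast_smul_eq_zsmul ℚ,
        smul_smul, smul_smul]
      congr 1
      push_cast
      have := Rat.mul_den_eq_num q
      linear_combination (N : ℚ) * this
    rw [this]
    exact S.zsmul_mem h1 _

lemma order_clear {A : Type} [Ring A] [Algebra ℚ A] {S : Subring A} (hS : IsOrderIn S) 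
    {R : AddSubgroup A} (hR : R.FG) : ∃ N : ℕ, N ≠ 0 ∧ ∀ r ∈ R, N • r ∈ S := by
  classical
  obtain ⟨T, rfl⟩ := hR
  choose f hf0 hf using fun x => order_clear_one hS x
  refine ⟨∏ t ∈ T, f t, Finset.prod_ne_zero_iff.mpr fun t _ => hf0 t, ?_⟩
  intro r hr
  induction hr using AddSubgroup.closure_induction with
  | mem x h => 
    rw [← Finset.prod_erase_mul T f h, mul_smul]
    exact S.nsmul_mem (hf x) _
  | zero => simp
  | add x y _ _ hx hy => rw [smul_add]; exact S.add_mem hx hy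
  | neg x _ hx => rw [smul_neg]; exact S.neg_mem hx

lemma finiteIndex_of_map {G T : Type} [Group G] [Finite T] (K : Subgroup G) (f : G → T)
    (h : ∀ u v, f u = f v → u⁻¹ * v ∈ K) : K.FiniteIndex := by
  have : Finite (G ⧸ K) := by
    refine Finite.of_injective (fun q : G ⧸ K => f q.out) ?_
    intro p q hpq
    have := h _ _ hpq
    rw [← QuotientGroup.eq] at this
    simpa using this
  exact Subgroup.finiteIndex_of_finite_quotient

lemma finite_mod {A : Type} [Ring A] {R : AddSubgroup A} (hR : R.FG) (N : ℕ) (hN : N ≠ 0) :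
    ∃ (T : Type) (_ : Finite T) (f : R → T), ∀ x y, f x = f y → ∃ r ∈ R, (y : A) - x = N • r := by
  let M : Submodule ℤ R := LinearMap.range (LinearMap.lsmul ℤ R (N : ℤ))
  have hfin : Module.Finite ℤ R := by
    rw [Module.Finite.iff_addGroup_fg]
    exact (AddGroup.fg_iff_addSubgroup_fg R).mpr hR
  have htor : Module.IsTorsion ℤ (R ⧸ M) := by
    intro x
    obtain ⟨y, rfl⟩ := Submodule.Quotient.mk_surjective _ x
    refine ⟨⟨(N : ℤ), by simpa using hN⟩, ?_⟩
    change (N : ℤ) • Submodule.Quotient.mk (p := M) y = 0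
    rw [← Submodule.Quotient.mk_smul, Submodule.Quotient.mk_eq_zero]
    exact ⟨y, rfl⟩
  refine ⟨R ⧸ M, Module.finite_of_fg_torsion _ htor, Submodule.Quotient.mk, ?_⟩
  intro x y hxy
  have := (Submodule.Quotient.eq M).mp hxy.symm
  obtain ⟨r, hr⟩ := this
  refine ⟨r, r.2, ?_⟩
  have := congrArg Subtype.val hr
  simp at this
  simp [← this]

lemma addSubgroup_fg_map {A B : Type} [AddCommGroup A] [AddCommGroup B] {R : AddSubgroup A}
    (hR : R.FG) (f : A →+ B) : (R.map f).FG := by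
  classical
  obtain ⟨T, rfl⟩ := hR
  exact ⟨T.image f, by rw [AddMonoidHom.map_closure]; simp⟩

/-- Commensurability of unit groups. -/
lemma relIndex_unitGroup {A B : Type} [Ring A] [Ring B] [Algebra ℚ A] {S : Subring A}
    (hS : IsOrderIn S) {R : Subring B} (hR : R.toAddSubgroup.FG) (ι : Bˣ →* Aˣ) (f : B →+ A)
    (hf : ∀ u, (ι u : A) = 1 + f (u - 1)) :
    ((unitGroup S).comap ι).relIndex (unitGroup R) ≠ 0 := by
  have hfR : (R.toAddSubgroup.map f).FG := addSubgroup_fg_map hR f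
  obtain ⟨N, hN, hNS⟩ := order_clear hS hfR
  obtain ⟨T, hT, g, hg⟩ := finite_mod hR N hN
  have : (((unitGroup S).comap ι).subgroupOf (unitGroup R)).FiniteIndex := by
    refine finiteIndex_of_map _ (fun u => g ⟨(u.1 : B), ((mem_unitGroup R _).mp u.2).1⟩) ?_
    have key : ∀ u v : unitGroup R, (∃ r ∈ R.toAddSubgroup, ((v : Bˣ) : B) - (u : Bˣ) = N • r) → 
        (ι ((u : Bˣ)⁻¹ * (v : Bˣ)) : A) ∈ S := by
      rintro u v ⟨r, hr, h⟩
      rw [hf]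
      refine S.add_mem S.one_mem ?_
      have h1 : (((u : Bˣ)⁻¹ * (v : Bˣ) : Bˣ) : B) - 1 = N • (((u : Bˣ)⁻¹ : Bˣ) * r) := by
        rw [← mul_smul_comm (N : ℕ), ← h, mul_sub]
        simp
      rw [h1, map_nsmul]
      exact hNS _ ⟨_, R.mul_mem ((mem_unitGroup R _).mp u.2).2 hr, rfl⟩
    intro u v huv
    rw [Subgroup.mem_subgroupOf, Subgroup.mem_comap, mem_unitGroup]
    obtain ⟨r, hr, h⟩ := hg _ _ huv
    refine ⟨key u v ⟨r, hr, h⟩, ?_⟩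
    have := key v u ⟨-r, R.toAddSubgroup.neg_mem hr, by rw [smul_neg, ← h]; simp⟩
    rw [← map_inv]
    convert this using 3
    simp
  exact this.index_ne_zero

lemma pow_mem_of_relIndex {G : Type} [Group G] {K L : Subgroup G} (h : K.relIndex L ≠ 0) {x : G} (hx : x ∈ L) :
    ∃ n : ℕ, n ≠ 0 ∧ x ^ n ∈ K := by
  obtain ⟨n, hn, -, h2⟩ := Subgroup.exists_pow_mem_of_relIndex_ne_zero h hx
  exact ⟨n, by omega, h2.1⟩

end Orders

section Structure

/-- A subgroup `V` is virtually abelian, or a finite index subgroup of it maps onto a nonabelian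
free group, with lifts commuting with the kernel. -/
def Dich {Q : Type} [Group Q] (V : Subgroup Q) : Prop :=
  ∃ (Γ : Type) (_ : Group Γ) (j : Γ →* Q), Function.Injective j ∧ j.range ≤ V ∧
    j.range.relIndex V ≠ 0 ∧ ((∀ a b : Γ, a * b = b * a) ∨
      ∃ (X : Type) (x y : X) (π : Γ →* FreeGroup X), x ≠ y ∧
        ∀ f, ∃ g, π g = f ∧ ∀ k, π k = 1 → k * g = g * k)

lemma freeGroup_comm_of_subsingleton {X : Type} (h : ∀ x y : X, x = y) (a b : FreeGroup X) :
    a * b = b * a := by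
  have : ∀ c : FreeGroup X, ∀ x : X, Commute c (FreeGroup.of x) := by
    intro c x
    induction c using FreeGroup.induction_on with
    | C1 => exact Commute.one_left _
    | of y => rw [h y x]
    | inv_of y hy => rw [h y x]; exact (Commute.refl _).inv_left
    | mul u v hu hv => exact hu.mul_left hv
  induction b using FreeGroup.induction_on with
  | C1 => simp
  | of y => exact this a y
  | inv_of y _ => exact (this a y).inv_right
  | mul u v hu hv => exact Commute.mul_right hu hv

lemma finiteIndex_comap {G G' : Type} [Group G] [Group G'] (f : G →* G') {K : Subgroup G'}
    (hK : K.FiniteIndex) : (K.comap f).FiniteIndex := by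
  refine ⟨?_⟩
  rw [Subgroup.index_comap]
  intro h0
  exact hK.index_ne_zero (by
    rw [← Subgroup.relIndex_top_right]; exact Subgroup.relIndex_eq_zero_of_le_right le_top h0)

lemma structure_lemma {n : ℕ} {Q : Fin n → Type} [∀ l, Group (Q l)] (U : ∀ l, Subgroup (Q l))
    (H : Subgroup (∀ l, Q l)) (hHU : ∀ h ∈ H, ∀ l, h l ∈ U l)
    (hfin : ∀ l, (H.comap (MonoidHom.mulSingle Q l)).relIndex (U l) ≠ 0)
    {m : ℕ} {X : Fin m → Type} (e : H ≃* ∀ j, FreeGroup (X j)) (i : Fin n) : Dich (U i) := by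
  classical
  let Γ : ∀ l, Subgroup (Q l) := fun l => H.comap (MonoidHom.mulSingle Q l) ⊓ U l
  have hΓ : ∀ l, (Γ l).relIndex (U l) ≠ 0 := fun l => by
    simpa [Γ, Subgroup.inf_relIndex_right] using hfin l
  let s : Γ i →* H := 
    { toFun := fun g => ⟨Pi.mulSingle i g.1, g.2.1⟩
      map_one' := by ext1; simp
      map_mul' := fun a b => by ext1; simp [Pi.mulSingle_mul] }
  have hs : ∀ g, (s g : ∀ l, Q l) = Pi.mulSingle i g.1 := fun g => rfl
  have hsinj : Function.Injective s := fun a b hab => by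
    have := congrFun (congrArg Subtype.val hab) i
    simp only [hs, Pi.mulSingle_eq_same] at this
    exact Subtype.ext this
  by_cases hab : ∀ a b : Γ i, a * b = b * a
  · exact ⟨Γ i, inferInstance, (Γ i).subtype, Subtype.val_injective, by simp [Γ], by
      simpa using hΓ i, Or.inl hab⟩
  push Not at hab
  obtain ⟨a, b, hab⟩ := hab
  have hj : ∃ j, ¬ Commute (e (s a) j) (e (s b) j) := by
    by_contra! hcon
    apply hab
    apply hsinj
    apply e.injective
    rw [map_mul, map_mul, map_mul, map_mul]
    funext j
    exact hcon j
  obtain ⟨j, hj⟩ := hj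
  let π0 : Γ i →* FreeGroup (X j) := ((Pi.evalMonoidHom _ j).comp e.toMonoidHom).comp s
  have hπ0 : ∀ g, π0 g = e (s g) j := fun g => rfl
  let Δ : Subgroup H := ⨅ l, (Γ l).comap ((Pi.evalMonoidHom _ l).comp H.subtype)
  have hΔ : Δ.FiniteIndex := by
    refine Subgroup.finiteIndex_iInf fun l => ⟨?_⟩
    rw [Subgroup.index_comap]
    intro h0
    refine hΓ l (Subgroup.relIndex_eq_zero_of_le_right ?_ h0)
    rintro _ ⟨h, rfl⟩
    exact hHU h.1 h.2 l
  let F' : Subgroup (FreeGroup (X j)) := Δ.comap (e.symm.toMonoidHom.comp (MonoidHom.mulSingle (fun j => FreeGroup (X j)) j))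
  have hF' : F'.FiniteIndex := finiteIndex_comap _ hΔ
  have hlift : ∀ f ∈ F', ∃ g : Γ i, π0 g = f ∧ ∀ k, π0 k = 1 → k * g = g * k := by
    intro f hf
    set h : H := e.symm (Pi.mulSingle j f) with hh
    have hhΔ : h ∈ Δ := hf
    have hhi : h.1 i ∈ Γ i := (Subgroup.mem_iInf.mp hhΔ) i
    have hcom : ∀ c : Γ i, Commute ((s ⟨_, hhi⟩)⁻¹ * h) (s c) := by
      intro c
      apply Subtype.ext
      funext l
      by_cases hl : l = i
      · subst hl
        simp [hs]
      · simp [hs, hl]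
    have hc2 : ∀ c : Γ i, Commute (e ((s ⟨_, hhi⟩)⁻¹ * h) j) (e (s c) j) := by
      intro c
      exact ((hcom c).map e).map (Pi.evalMonoidHom _ j)
    have hone : e ((s ⟨_, hhi⟩)⁻¹ * h) j = 1 := by
      by_contra hne
      exact hj (freeGroup_comm_trans hne (hc2 a) (hc2 b))
    refine ⟨⟨_, hhi⟩, ?_, ?_⟩
    · rw [map_mul, map_inv, Pi.mul_apply, Pi.inv_apply, inv_mul_eq_one] at hone
      rw [hπ0, hone, hh]
      simp
    · intro k hk
      have hkh : s k * h = h * s k := by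
        apply e.injective
        rw [map_mul, map_mul, hh, MulEquiv.apply_symm_apply]
        funext l
        by_cases hl : l = j
        · subst hl
          rw [hπ0] at hk
          simp [hk]
        · simp [hl]
      have := congrFun (congrArg Subtype.val hkh) i
      apply Subtype.ext
      simpa [hs] using this
  let Γ' : Subgroup (Γ i) := F'.comap π0
  let π1 : Γ' →* F' := (π0.comp Γ'.subtype).codRestrict F' (fun g => g.2)
  have hF'free : IsFreeGroup F' := subgroupIsFreeOfIsFree F'
  let φ : F' ≃* FreeGroup (IsFreeGroup.Generators F') := IsFreeGroup.toFreeGroup F'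
  have hxy : ∃ x y : IsFreeGroup.Generators F', x ≠ y := by
    by_contra! hcon
    obtain ⟨p, hp, -, hpF⟩ := Subgroup.exists_pow_mem_of_index_ne_zero hF'.index_ne_zero (π0 a)
    obtain ⟨q, hq, -, hqF⟩ := Subgroup.exists_pow_mem_of_index_ne_zero hF'.index_ne_zero (π0 b)
    have := freeGroup_comm_of_subsingleton hcon (φ ⟨_, hpF⟩) (φ ⟨_, hqF⟩)
    rw [← map_mul, ← map_mul] at this
    have := congrArg Subtype.val (φ.injective this)
    exact hj (freeGroup_commute_of_pow (by omega) (by omega) this)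
  obtain ⟨x, y, hxy⟩ := hxy
  refine ⟨Γ', inferInstance, (Γ i).subtype.comp Γ'.subtype, ?_, ?_, ?_, Or.inr
    ⟨_, x, y, φ.toMonoidHom.comp π1, hxy, ?_⟩⟩
  · exact Subtype.val_injective.comp Subtype.val_injective
  · rintro _ ⟨g, rfl⟩
    exact g.1.2.2
  · rw [MonoidHom.range_comp, Subgroup.range_subtype]
    refine Subgroup.relIndex_ne_zero_trans (K := Γ i) ?_ (hΓ i)
    have h1 : (Γ'.map (Γ i).subtype).subgroupOf (Γ i) = Γ' := 
      Subgroup.comap_map_eq_self_of_injective Subtype.val_injective _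
    have h2 : Γ'.FiniteIndex := finiteIndex_comap _ hF'
    rw [Subgroup.relIndex, h1]
    exact h2.index_ne_zero
  · intro f
    obtain ⟨g, hg, hg2⟩ := hlift (φ.symm f) (φ.symm f).2
    refine ⟨⟨g, ?_⟩, ?_, ?_⟩
    · change π0 g ∈ F'
      rw [hg]; exact (φ.symm f).2
    · change φ (π1 _) = f
      rw [← MulEquiv.eq_symm_apply]
      exact Subtype.ext hg
    · intro k hk
      apply Subtype.ext
      apply hg2
      have : π1 k = 1 := φ.injective (hk.trans (map_one φ).symm)
      exact congrArg Subtype.val this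

lemma Dich.map {Q Q' : Type} [Group Q] [Group Q'] {V : Subgroup Q} (h : Dich V) (e : Q ≃* Q') :
    Dich (V.map e.toMonoidHom) := by
  obtain ⟨Γ, _, j, h1, h2, h3, h4⟩ := h
  refine ⟨Γ, inferInstance, e.toMonoidHom.comp j, e.injective.comp h1, ?_, ?_, h4⟩
  · rw [MonoidHom.range_comp]; exact Subgroup.map_mono h2
  · rw [MonoidHom.range_comp, Subgroup.relIndex_map_map_of_injective _ _ e.injective]; exact h3

end Structure

section Bridge

lemma isOrderIn_map {A B : Type} [Ring A] [Algebra ℚ A] [Ring B] [Algebra ℚ B] {S : Subring A}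
    (hS : IsOrderIn S) (f : A →+* B) (hf : Function.Surjective f) : IsOrderIn (S.map f) := by
  refine ⟨addSubgroup_fg_map hS.1 f.toAddMonoidHom, ?_⟩
  have h1 : ((S.map f : Subring B) : Set B) = (f.toRatAlgHom.toLinearMap : A →ₗ[ℚ] B) '' (S : Set A) := by
    ext; simp
  rw [h1, Submodule.span_image, hS.2, Submodule.map_top, LinearMap.range_eq_top]
  exact hf

/-- The embedding of the units of `S` into the product of the unit groups. -/
def unitsToPi {n : ℕ} {A : Fin n → Type} [∀ i, Ring (A i)] (S : Subring (∀ i, A i)) :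
    (↥S)ˣ →* ∀ i, (A i)ˣ :=
  (MulEquiv.piUnits (M := A)).toMonoidHom.comp (Units.map (S.subtype : S →* ∀ i, A i))

lemma unitsToPi_apply {n : ℕ} {A : Fin n → Type} [∀ i, Ring (A i)] (S : Subring (∀ i, A i))
    (u : (↥S)ˣ) (i : Fin n) : (unitsToPi S u i : A i) = (u : S).1 i := rfl

lemma unitsToPi_injective {n : ℕ} {A : Fin n → Type} [∀ i, Ring (A i)] (S : Subring (∀ i, A i)) :
    Function.Injective (unitsToPi S) := by
  intro u v h
  apply Units.ext
  apply Subtype.ext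
  funext i
  rw [← unitsToPi_apply, ← unitsToPi_apply, h]

lemma mem_range_unitsToPi {n : ℕ} {A : Fin n → Type} [∀ i, Ring (A i)] (S : Subring (∀ i, A i))
    (v : ∀ i, (A i)ˣ) : v ∈ (unitsToPi S).range ↔ (fun i => (v i : A i)) ∈ S ∧
      (fun i => ((v i)⁻¹ : (A i)ˣ) : ∀ i, A i) ∈ S := by
  constructor
  · rintro ⟨u, rfl⟩
    refine ⟨u.1.2, ?_⟩
    rw [show (fun i => ((unitsToPi S u i)⁻¹ : (A i)ˣ) : ∀ i, A i) = ((u⁻¹ : Sˣ) : S).1 from ?_]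
    · exact (u⁻¹ : Sˣ).1.2
    · rfl
  · rintro ⟨h1, h2⟩
    refine ⟨⟨⟨_, h1⟩, ⟨_, h2⟩, ?_, ?_⟩, ?_⟩
    · apply Subtype.ext; funext i; simp
    · apply Subtype.ext; funext i; simp
    · funext i; apply Units.ext; rfl

lemma relIndex_single {n : ℕ} {A : Fin n → Type} [∀ i, Ring (A i)] [∀ i, Algebra ℚ (A i)]
    {S : Subring (∀ i, A i)} (hS : IsOrderIn S) (i : Fin n) {R : Subring (A i)}
    (hR : R.toAddSubgroup.FG) :
    ((unitsToPi S).range.comap (MonoidHom.mulSingle (fun i => (A i)ˣ) i)).relIndex (unitGroup R) ≠ 0 := by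
  classical
  have := relIndex_unitGroup hS hR
    ((MulEquiv.piUnits (M := A)).symm.toMonoidHom.comp (MonoidHom.mulSingle (fun i => (A i)ˣ) i))
    (AddMonoidHom.single A i) (by
      intro u
      funext l
      by_cases hl : l = i
      · subst hl; simp
      · simp [hl])
  convert this using 2
  ext u
  rw [Subgroup.mem_comap, Subgroup.mem_comap, mem_range_unitsToPi, mem_unitGroup]
  rfl

lemma dich_of_vp {n : ℕ} {A : Fin n → Type} [∀ i, Ring (A i)] [∀ i, Algebra ℚ (A i)]
    {S : Subring (∀ i, A i)} (hS : IsOrderIn S)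
    (hV : IsVirtuallyDirectProductOfFreeGroups (↥S)ˣ) (i : Fin n) :
    ∃ O : Subring (A i), IsOrderIn O ∧ Dich (unitGroup O) := by
  have hO : ∀ i, IsOrderIn (S.map (Pi.evalRingHom A i)) := fun i =>
    isOrderIn_map hS _ (Function.surjective_eval i)
  refine ⟨_, hO i, ?_⟩
  obtain ⟨H, hH, m, X, ⟨e⟩⟩ := hV
  refine structure_lemma (fun i => unitGroup (S.map (Pi.evalRingHom A i))) (H.map (unitsToPi S)) 
    ?_ ?_ ((H.equivMapOfInjective _ (unitsToPi_injective S)).symm.trans e) i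
  · rintro _ ⟨u, -, rfl⟩ l
    rw [mem_unitGroup]
    exact ⟨⟨_, u.1.2, rfl⟩, ⟨_, (u⁻¹ : Sˣ).1.2, rfl⟩⟩
  · intro l
    refine Subgroup.relIndex_ne_zero_trans ?_ (relIndex_single hS l (hO l).1)
    rw [Subgroup.relIndex_comap]
    intro h0
    have h1 := Subgroup.relIndex_eq_zero_of_le_right
      (Subgroup.map_comap_le (MonoidHom.mulSingle (fun i => (A i)ˣ) l) (unitsToPi S).range) h0
    rw [MonoidHom.range_eq_map, Subgroup.relIndex_map_map_of_injective _ _ (unitsToPi_injective S),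
      Subgroup.relIndex_top_right] at h1
    exact hH.index_ne_zero h1

lemma isOrderIn_equiv {A B : Type} [Ring A] [Algebra ℚ A] [Ring B] [Algebra ℚ B] (e : A ≃+* B)
    (h : ∃ O : Subring A, IsOrderIn O ∧ Dich (unitGroup O)) :
    ∃ O : Subring B, IsOrderIn O ∧ Dich (unitGroup O) := by
  obtain ⟨O, h1, h2⟩ := h
  refine ⟨O.map e.toRingHom, isOrderIn_map h1 _ e.surjective, ?_⟩
  convert h2.map (Units.mapEquiv e.toMulEquiv) using 1
  ext u
  rw [mem_unitGroup, Subgroup.mem_map]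
  constructor
  · rintro ⟨⟨a, ha, hau⟩, ⟨b, hb, hbu⟩⟩
    refine ⟨⟨a, b, ?_, ?_⟩, ?_, ?_⟩
    · apply e.injective
      change e a = _ at hau
      change e b = _ at hbu
      rw [map_mul, hau, hbu]; simp
    · apply e.injective
      change e a = _ at hau
      change e b = _ at hbu
      rw [map_mul, hau, hbu]; simp
    · rw [mem_unitGroup]; exact ⟨ha, hb⟩
    · exact Units.ext hau
  · rintro ⟨v, hv, rfl⟩
    rw [mem_unitGroup] at hv
    exact ⟨⟨_, hv.1, rfl⟩, ⟨_, hv.2, rfl⟩⟩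

end Bridge

section MatrixCase

lemma freeGroup_of_not_commute {X : Type} {x y : X} (hxy : x ≠ y) :
    ¬ Commute (FreeGroup.of x) (FreeGroup.of y) := by
  intro h
  have h1 := lastLetter_pow_mul x y 1 1 one_pos
  have h2 := lastLetter_pow_mul y x 1 1 one_pos
  rw [pow_one, pow_one] at h1 h2
  rw [h.eq, h2] at h1
  simp at h1
  exact hxy h1

variable {D : Type} [DivisionRing D] {r : ℕ}

/-- Elementary matrices as a homomorphism. -/
def elem (a b : Fin r) (h : a ≠ b) : Multiplicative D →* (Matrix (Fin r) (Fin r) D)ˣ where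
  toFun x := ⟨1 + Matrix.single a b x.toAdd, 1 - Matrix.single a b x.toAdd,
    by simp [mul_sub, add_mul, h.symm], by simp [sub_mul, mul_add, h.symm]⟩
  map_one' := by ext1; simp
  map_mul' x y := by
    ext1
    simp [mul_add, add_mul, h.symm, Matrix.single_add, add_assoc]

lemma elem_val (a b : Fin r) (h : a ≠ b) (x : D) :
    (elem a b h (Multiplicative.ofAdd x) : Matrix (Fin r) (Fin r) D) = 1 + Matrix.single a b x := rfl

lemma elem_comm (a b c : Fin r) (hac : a ≠ c) (hcb : c ≠ b) (hab : a ≠ b) (x y : D) :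
    elem a c hac (.ofAdd x) * elem c b hcb (.ofAdd y) =
      elem a b hab (.ofAdd (x * y)) * (elem c b hcb (.ofAdd y) * elem a c hac (.ofAdd x)) := by
  ext1
  have h1 : Matrix.single c b y * Matrix.single a c x = 0 :=
    Matrix.single_mul_single_of_ne _ _ _ _ hab.symm _
  have h2 : Matrix.single a b (x * y) * Matrix.single c b y = 0 :=
    Matrix.single_mul_single_of_ne _ _ _ _ hcb.symm _
  have h3 : Matrix.single a b (x * y) * Matrix.single a c x = 0 :=
    Matrix.single_mul_single_of_ne _ _ _ _ hab.symm _
  simp only [Units.val_mul, elem_val, mul_add, add_mul, mul_one, one_mul,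
    Matrix.single_mul_single_same, h1, h2, h3, add_zero, mul_zero]
  abel

lemma elem_comm_left (a b c : Fin r) (hac : a ≠ c) (hab : a ≠ b) (x y : D) :
    Commute (elem a c hac (.ofAdd x)) (elem a b hab (.ofAdd y)) := by
  ext1
  simp only [Units.val_mul, elem_val, mul_add, add_mul, mul_one, one_mul]
  rw [Matrix.single_mul_single_of_ne _ _ _ _ hac.symm,
    Matrix.single_mul_single_of_ne _ _ _ _ hab.symm]
  abel

lemma commute_single [CharZero D] {a b : Fin r} {h : a ≠ b} {N : ℕ} (hN : N ≠ 0) {x : D}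
    {g : (Matrix (Fin r) (Fin r) D)ˣ} (hg : Commute g (elem a b h (.ofAdd (N • x)))) :
    (g : Matrix (Fin r) (Fin r) D) * Matrix.single a b x = Matrix.single a b x * g := by
  have h1 := congrArg Units.val hg.eq
  simp only [Units.val_mul, elem_val, mul_add, add_mul, mul_one, one_mul, add_right_inj] at h1
  have h2 : Matrix.single a b (N • x) = N • Matrix.single a b x := by
    rw [Matrix.smul_single]
  rw [h2, mul_smul_comm, smul_mul_assoc] at h1
  ext p q
  have h3 := congrFun (congrFun h1 p) q
  rw [Matrix.smul_apply, Matrix.smul_apply, nsmul_eq_mul, nsmul_eq_mul] at h3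
  exact mul_left_cancel₀ (by exact_mod_cast hN) h3

lemma single_comm_entry {g : Matrix (Fin r) (Fin r) D} {a b : Fin r} {x : D}
    (h : g * Matrix.single a b x = Matrix.single a b x * g) :
    (∀ p, p ≠ a → x ≠ 0 → g p a = 0) ∧ g a a * x = x * g b b := by
  constructor
  · intro p hp hx
    have := congrFun (congrFun h p) b
    rw [Matrix.mul_single_apply_same, Matrix.single_mul_apply_of_ne _ _ _ _ _ hp] at this
    exact (mul_eq_zero.mp this).resolve_right hx
  · have := congrFun (congrFun h a) b
    rw [Matrix.mul_single_apply_same, Matrix.single_mul_apply_same] at this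
    exact this

lemma exists_elem_mem [Algebra ℚ D] {O : Subring (Matrix (Fin r) (Fin r) D)} (hO : IsOrderIn O)
    {Γ : Subgroup (Matrix (Fin r) (Fin r) D)ˣ} (hΓ : Γ.relIndex (unitGroup O) ≠ 0)
    (a b : Fin r) (h : a ≠ b) (x : D) :
    ∃ N : ℕ, N ≠ 0 ∧ elem a b h (.ofAdd (N • x)) ∈ Γ := by
  obtain ⟨N, hN, hNO⟩ := order_clear_one hO (Matrix.single a b x)
  have h1 : elem a b h (.ofAdd (N • x)) ∈ unitGroup O := by
    rw [mem_unitGroup]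
    rw [Matrix.smul_single] at hNO
    exact ⟨O.add_mem O.one_mem hNO, O.sub_mem O.one_mem hNO⟩
  obtain ⟨M, hM, hMΓ⟩ := pow_mem_of_relIndex hΓ h1
  refine ⟨M * N, mul_ne_zero hM hN, ?_⟩
  rw [← map_pow, ← ofAdd_nsmul, smul_smul] at hMΓ
  exact hMΓ

lemma free_heis {X : Type} {u v : FreeGroup X} (h : Commute (u * v * u⁻¹ * v⁻¹) u) :
    u * v * u⁻¹ * v⁻¹ = 1 := by
  have h1 : Commute (v * u⁻¹ * v⁻¹) u := by
    have : v * u⁻¹ * v⁻¹ = u⁻¹ * (u * v * u⁻¹ * v⁻¹) := by group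
    rw [this]
    exact (Commute.refl u).inv_left.mul_left h
  have h2 : Commute (v * u * v⁻¹) u := by
    have : v * u * v⁻¹ = (v * u⁻¹ * v⁻¹)⁻¹ := by group
    rw [this]; exact h1.inv_left
  have h3 := freeGroup_commute_of_conj h2
  rw [← h3.eq]; group

lemma matrix_case [Algebra ℚ D] (hr : 2 ≤ r) {O : Subring (Matrix (Fin r) (Fin r) D)}
    (hO : IsOrderIn O) (hd : Dich (unitGroup O)) : 
    r = 2 ∧ ∀ y : D, ∃ q : ℚ, y = algebraMap ℚ D q := by
  have : CharZero D := algebraRat.charZero D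
  obtain ⟨Γ, _, j, hj, -, hfin, hd⟩ := hd
  have hex : ∀ (a b : Fin r) (h : a ≠ b) (x : D), ∃ N : ℕ, N ≠ 0 ∧ ∃ γ, j γ = 
      elem a b h (.ofAdd (N • x)) := fun a b h x => exists_elem_mem hO hfin a b h x
  rcases hd with hab | ⟨X, x, y, π, hxy, hπ⟩
  · exfalso
    have h01 : (⟨0, by omega⟩ : Fin r) ≠ ⟨1, by omega⟩ := by simp
    obtain ⟨N, hN, γ, hγ⟩ := hex _ _ h01 1
    obtain ⟨M, hM, δ, hδ⟩ := hex _ _ h01.symm 1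
    have h1 := congrArg j (hab γ δ)
    rw [map_mul, map_mul, hγ, hδ] at h1
    have h2 : Commute (elem _ _ h01 (.ofAdd (N • (1 : D)))) (elem _ _ h01.symm (.ofAdd (M • (1 : D)))) := h1
    have h3 := (single_comm_entry (commute_single hM h2)).1 _ h01 one_ne_zero
    rw [elem_val] at h3
    simp [h01] at h3
    exact hN h3
  choose lift hlift hliftc using hπ
  have hlc : ∀ f k, π k = 1 → Commute (j (lift f)) (j k) := fun f k hk => by
    have := congrArg j (hliftc f k hk)
    rw [map_mul, map_mul] at this
    exact this.symm
  -- the lifts do not commute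
  have hfinal : ¬ ((j (lift (FreeGroup.of x)) : Matrix (Fin r) (Fin r) D) * j (lift (FreeGroup.of y)) =
      j (lift (FreeGroup.of y)) * j (lift (FreeGroup.of x))) := by
    intro h
    have h1 : j (lift (FreeGroup.of x) * lift (FreeGroup.of y)) = 
        j (lift (FreeGroup.of y) * lift (FreeGroup.of x)) := by
      rw [map_mul, map_mul]; exact Units.ext h
    have h2 := congrArg π (hj h1)
    rw [map_mul, map_mul, hlift, hlift] at h2
    exact freeGroup_of_not_commute hxy h2
  by_cases hr2 : r = 2
  swap
  · exfalso
    have hker : ∀ (a b : Fin r) (h : a ≠ b) (z : D), ∃ N : ℕ, N ≠ 0 ∧ ∃ γ, j γ = 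
        elem a b h (.ofAdd (N • z)) ∧ π γ = 1 := by
      intro a b h z
      obtain ⟨c, hca, hcb⟩ : ∃ c : Fin r, a ≠ c ∧ c ≠ b := by
        have : ∃ c ∈ (Finset.univ : Finset (Fin r)), c ∉ ({a, b} : Finset (Fin r)) := by
          apply Finset.exists_mem_notMem_of_card_lt_card
          have := Finset.card_le_two (a := a) (b := b)
          simp; omega
        obtain ⟨c, -, hc⟩ := this
        simp at hc
        exact ⟨c, fun h => hc.1 h.symm, hc.2⟩
      obtain ⟨N, hN, γ, hγ⟩ := hex a c hca z
      obtain ⟨M, hM, δ, hδ⟩ := hex c b hcb 1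
      have h1 := elem_comm a b c hca hcb h (N • z) (M • 1)
      have h2 : j (γ * δ * γ⁻¹ * δ⁻¹) = elem a b h (.ofAdd ((N * M) • z)) := by
        rw [map_mul, map_mul, map_mul, map_inv, map_inv, hγ, hδ, h1]
        have : (N • z) * (M • (1 : D)) = (N * M) • z := by
          simp [mul_assoc, (Nat.cast_commute M z).eq]
        rw [this]; group
      refine ⟨N * M, mul_ne_zero hN hM, _, h2, ?_⟩
      have h3 : Commute (γ * δ * γ⁻¹ * δ⁻¹) γ := by
        apply hj
        rw [map_mul, map_mul j γ, h2, hγ]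
        exact (elem_comm_left a b c hca h _ _).symm
      have h4 := h3.map π
      simp only [map_mul, map_inv] at h4 ⊢
      exact free_heis h4
    have hs : ∀ f (a b : Fin r) (h : a ≠ b) (z : D),
        (j (lift f) : Matrix (Fin r) (Fin r) D) * Matrix.single a b z = Matrix.single a b z * j (lift f) := by
      intro f a b h z
      obtain ⟨N, hN, γ, hγ, hγ1⟩ := hker a b h z
      have := hlc f γ hγ1
      rw [hγ] at this
      exact commute_single hN this
    have hne : ∀ a : Fin r, ∃ b, a ≠ b := fun a => by
      have : Nontrivial (Fin r) := Fin.nontrivial_iff_two_le.mpr hr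
      obtain ⟨b, hb⟩ := exists_ne a
      exact ⟨b, hb.symm⟩
    have hdiag : ∀ f (p a : Fin r), p ≠ a → (j (lift f) : Matrix (Fin r) (Fin r) D) p a = 0 := by
      intro f p a hp
      obtain ⟨b, hb⟩ := hne a
      exact (single_comm_entry (hs f a b hb 1)).1 p hp one_ne_zero
    have heq : ∀ f (a b : Fin r), (j (lift f) : Matrix (Fin r) (Fin r) D) a a =
        (j (lift f) : Matrix (Fin r) (Fin r) D) b b := by
      intro f a b
      by_cases h : a = b
      · rw [h]
      · simpa using (single_comm_entry (hs f a b h 1)).2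
    have hcent : ∀ f (a : Fin r) (z : D), (j (lift f) : Matrix (Fin r) (Fin r) D) a a * z =
        z * (j (lift f) : Matrix (Fin r) (Fin r) D) a a := by
      intro f a z
      obtain ⟨b, hb⟩ := hne a
      have := (single_comm_entry (hs f a b hb z)).2
      rw [this, heq f a b]
    apply hfinal
    ext p q
    rw [Matrix.mul_apply, Matrix.mul_apply, Finset.sum_eq_single p, Finset.sum_eq_single p]
    · by_cases hpq : p = q
      · subst hpq; exact hcent _ _ _
      · rw [hdiag _ _ _ hpq, hdiag _ _ _ hpq]; simp
    · intro b _ hb; rw [hdiag _ _ _ hb.symm]; simp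
    · simp
    · intro b _ hb; rw [hdiag _ _ _ hb.symm]; simp
    · simp
  subst hr2
  refine ⟨rfl, ?_⟩
  by_contra! hD
  obtain ⟨w, hw⟩ := hD
  have h01 : (0 : Fin 2) ≠ 1 := by simp
  -- a nontrivial unipotent in the kernel
  have hk : ∃ (κ : Γ) (x0 : D), x0 ≠ 0 ∧ π κ = 1 ∧ j κ = elem 0 1 h01 (.ofAdd x0) := by
    obtain ⟨N, hN, γ, hγ⟩ := hex _ _ h01 1
    obtain ⟨M, hM, δ, hδ⟩ := hex _ _ h01 w
    have hc : Commute γ δ := by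
      apply hj
      rw [map_mul, map_mul, hγ, hδ]
      exact elem_comm_left _ _ _ _ _ _ _
    obtain ⟨n, m, hnm, he⟩ := freeGroup_common_pow (hc.map π)
    refine ⟨γ ^ n * (δ ^ m)⁻¹, n • N • (1 : D) - m • M • w, ?_, ?_, ?_⟩
    · intro h0
      rcases eq_or_ne m 0 with hm | hm
      · subst hm
        simp at h0
        rcases h0 with h0 | h0
        · subst h0; simp at hnm
        · exact hN h0
      · apply hw (((n : ℚ) * N) / ((m : ℚ) * M))
        have hmM : ((m : D) * M) ≠ 0 := mul_ne_zero (by exact_mod_cast hm) (by exact_mod_cast hM)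
        simp only [zsmul_eq_mul, nsmul_eq_mul, mul_one] at h0
        have h5 : ((m : D) * M) * w = (n : D) * N := by
          rw [mul_assoc]; exact (sub_eq_zero.mp h0).symm
        have h6 : w = ((m : D) * M)⁻¹ * ((n : D) * N) := by
          rw [← h5, inv_mul_cancel_left₀ hmM]
        rw [h6, div_eq_inv_mul]
        simp
    · simp [he]
    · rw [map_mul, map_inv, map_zpow, map_zpow, hγ, hδ, sub_eq_add_neg, ofAdd_add, ofAdd_neg,
        ofAdd_zsmul, ofAdd_zsmul, map_mul, map_inv, map_zpow, map_zpow]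
  obtain ⟨κ, x0, hx0, hκ, hjκ⟩ := hk
  have hup : ∀ g : Γ, (∀ k, π k = 1 → k * g = g * k) → (j g : Matrix (Fin 2) (Fin 2) D) 1 0 = 0 := by
    intro g hg
    have h1 := congrArg j (hg κ hκ)
    rw [map_mul, map_mul, hjκ] at h1
    have h2 : Commute (j g) (elem 0 1 h01 (.ofAdd (1 • x0))) := by rw [one_smul]; exact h1.symm
    exact (single_comm_entry (commute_single one_ne_zero h2)).1 1 h01.symm hx0
  have hup1 : ∀ f, (j (lift f) : Matrix (Fin 2) (Fin 2) D) 1 0 = 0 := fun f => hup _ (hliftc f)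
  have hup2 : ∀ f, (((j (lift f))⁻¹ : (Matrix (Fin 2) (Fin 2) D)ˣ) : Matrix (Fin 2) (Fin 2) D) 1 0 = 0 := by
    intro f
    rw [← map_inv]
    apply hup
    intro k hk
    have : Commute k (lift f) := hliftc f k hk
    exact this.inv_right
  have hall : ∀ γ z, j γ = elem 0 1 h01 (.ofAdd z) → π γ = 1 := by
    intro γ z hγ
    apply freeGroup_center_trivial hxy
    intro f
    rw [← hlift f]
    refine (freeGroup_commute_of_conj ?_).symm
    have : Commute (lift f * γ * (lift f)⁻¹) γ := by
      apply hj
      rw [map_mul, map_mul j γ, map_mul, map_mul, map_inv, hγ]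
      have h5 : j (lift f) * elem 0 1 h01 (.ofAdd z) * (j (lift f))⁻¹ = 
        elem 0 1 h01 (.ofAdd ((j (lift f) : Matrix (Fin 2) (Fin 2) D) 0 0 * z * 
          (((j (lift f))⁻¹ : (Matrix (Fin 2) (Fin 2) D)ˣ) : Matrix (Fin 2) (Fin 2) D) 1 1)) := by
        ext1
        rw [Units.val_mul, Units.val_mul, elem_val, elem_val, mul_add, add_mul, mul_one, Units.mul_inv]
        congr 1
        ext p q
        fin_cases p <;> fin_cases q <;> 
          simp [Matrix.mul_apply, Fin.sum_univ_two, hup1, hup2, Matrix.single_apply]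
      rw [h5]
      exact elem_comm_left _ _ _ _ _ _ _
    have := this.map π
    simpa only [map_mul, map_inv] using this
  have hs : ∀ f (z : D),
      (j (lift f) : Matrix (Fin 2) (Fin 2) D) * Matrix.single 0 1 z =
        Matrix.single 0 1 z * (j (lift f) : Matrix (Fin 2) (Fin 2) D) := by
    intro f z
    obtain ⟨N, hN, γ, hγ⟩ := hex _ _ h01 z
    have := hlc f γ (hall _ _ hγ)
    rw [hγ] at this
    exact commute_single hN this
  have heq : ∀ f, (j (lift f) : Matrix (Fin 2) (Fin 2) D) 0 0 = (j (lift f) : Matrix (Fin 2) (Fin 2) D) 1 1 :=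
    fun f => by simpa using (single_comm_entry (hs f 1)).2
  have hcent : ∀ f (z : D), (j (lift f) : Matrix (Fin 2) (Fin 2) D) 1 1 * z = 
      z * (j (lift f) : Matrix (Fin 2) (Fin 2) D) 1 1 :=
    fun f z => by rw [← heq, (single_comm_entry (hs f z)).2, heq]
  apply hfinal
  ext p q
  fin_cases p <;> fin_cases q <;> simp [Matrix.mul_apply, Fin.sum_univ_two, hup1, heq]
  · exact hcent _ _
  · rw [hcent, ← hcent (FreeGroup.of y), add_comm]
  · exact hcent _ _

end MatrixCase

section Fujisaki

open Matrix Module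

variable {R : Type} [Ring R] {n : ℕ} (b : Basis (Fin n) ℤ R)

/-- The regular representation over the reals. -/
noncomputable def rho : R →+* Matrix (Fin n) (Fin n) ℝ :=
  ((Int.castRingHom ℝ).mapMatrix).comp (Algebra.leftMulMatrix b).toRingHom

lemma rho_apply (x : R) : rho b x = (Algebra.leftMulMatrix b x).map (Int.castRingHom ℝ) := rfl

lemma rho_injective : Function.Injective (rho b) := by
  intro x y h
  apply Algebra.leftMulMatrix_injective b
  exact Matrix.map_injective (f := (Int.castRingHom ℝ)) Int.cast_injective h

/-- coordinates -/
noncomputable def vec' (x : R) : Fin n → ℝ := fun i => (b.repr x i : ℝ)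

lemma rho_mulVec (x y : R) : rho b x *ᵥ vec' b y = vec' b (x * y) := by
  have h := Algebra.leftMulMatrix_mulVec_repr b x y
  funext i
  have h2 := congrArg (Int.castRingHom ℝ) (congrFun h i)
  rw [RingHom.map_mulVec] at h2
  exact h2

/-- The linear map from coordinates to matrices. -/
noncomputable def LL (v : Fin n → ℝ) : Matrix (Fin n) (Fin n) ℝ := ∑ i, v i • rho b (b i)

lemma LL_add (v w : Fin n → ℝ) : LL b (v + w) = LL b v + LL b w := by
  simp [LL, add_smul, Finset.sum_add_distrib]

lemma LL_smul (c : ℝ) (v : Fin n → ℝ) : LL b (c • v) = c • LL b v := by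
  simp [LL, mul_smul, Finset.smul_sum]

lemma LL_vec (x : R) : LL b (vec' b x) = rho b x := by
  conv_rhs => rw [← b.sum_repr x]
  rw [map_sum, LL]
  refine Finset.sum_congr rfl fun i _ => ?_
  rw [map_zsmul, vec', ← Int.cast_smul_eq_zsmul ℝ]

lemma LL_continuous : Continuous (LL b) := by
  unfold LL
  fun_prop

/-- Matrices compatible with the algebra structure. -/
def InV (g : Matrix (Fin n) (Fin n) ℝ) : Prop := ∀ v, g * LL b v = LL b (g *ᵥ v)

lemma InV_add {g h : Matrix (Fin n) (Fin n) ℝ} (hg : InV b g) (hh : InV b h) : InV b (g + h) := by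
  intro v
  rw [add_mul, hg, hh, Matrix.add_mulVec, LL_add]

lemma InV_smul {g : Matrix (Fin n) (Fin n) ℝ} (c : ℝ) (hg : InV b g) : InV b (c • g) := by
  intro v
  rw [Matrix.smul_mul, hg, Matrix.smul_mulVec, LL_smul]

lemma InV_mul {g h : Matrix (Fin n) (Fin n) ℝ} (hg : InV b g) (hh : InV b h) : InV b (g * h) := by
  intro v
  rw [mul_assoc, hh, hg, Matrix.mulVec_mulVec]

lemma InV_one : InV b 1 := fun v => by simp

lemma InV_rho (r : R) : InV b (rho b r) := by
  intro v
  have hv : v = ∑ i, v i • vec' b (b i) := by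
    funext j
    simp [vec', Finset.sum_apply, Finsupp.single_apply]
  have hL : ∀ (w : Fin n → Fin n → ℝ), LL b (∑ i, v i • w i) = ∑ i, v i • LL b (w i) := by
    intro w
    let f : (Fin n → ℝ) →ₗ[ℝ] Matrix (Fin n) (Fin n) ℝ := ⟨⟨LL b, LL_add b⟩, LL_smul b⟩
    change f _ = ∑ i, v i • f (w i)
    simp
  rw [hv, hL, Matrix.mulVec_sum, Finset.mul_sum]
  simp only [Matrix.mulVec_smul]
  rw [hL]
  refine Finset.sum_congr rfl fun i _ => ?_
  rw [Matrix.mul_smul, rho_mulVec, LL_vec, LL_vec, map_mul]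

/-- Integral matrices in a compact set. -/
lemma finite_of_compact {K : Set (Matrix (Fin n) (Fin n) ℝ)} (hK : IsCompact K) :
    {r : R | rho b r ∈ K}.Finite := by
  have hfin : {m : Matrix (Fin n) (Fin n) ℤ | m.map (Int.castRingHom ℝ) ∈ K}.Finite := by
    have hB : ∀ i j, ∃ B : ℝ, ∀ k ∈ K, ‖k i j‖ ≤ B := fun i j =>
      hK.exists_bound_of_continuousOn (f := fun k => k i j) (by fun_prop)
    choose B hB using hB
    have : (Set.pi Set.univ fun i => Set.pi Set.univ fun j => Set.Icc (-⌈B i j⌉) ⌈B i j⌉ :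
        Set (Fin n → Fin n → ℤ)).Finite :=
      Set.Finite.pi fun i => Set.Finite.pi fun j => Set.finite_Icc _ _
    refine Set.Finite.subset this ?_
    intro m hm i _ j _
    have := hB i j _ hm
    change ‖((m i j : ℤ) : ℝ)‖ ≤ _ at this
    rw [Real.norm_eq_abs, abs_le] at this
    constructor
    · have h1 : -(m i j : ℝ) ≤ B i j := by linarith
      have : -(m i j) ≤ ⌈B i j⌉ := by
        have := Int.le_ceil (B i j)
        exact_mod_cast h1.trans this
      omega
    · have := Int.le_ceil (B i j)
      exact_mod_cast (by linarith : (m i j : ℝ) ≤ ⌈B i j⌉)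
  change ((Algebra.leftMulMatrix b) ⁻¹' {m : Matrix (Fin n) (Fin n) ℤ | m.map (Int.castRingHom ℝ) ∈ K}).Finite
  exact Set.Finite.preimage (Algebra.leftMulMatrix_injective b).injOn hfin

/-- Minkowski. -/
lemma minkowski_box {g : Matrix (Fin n) (Fin n) ℝ} (hg : |g.det| = 1) (hn : 0 < n) :
    ∃ x : R, x ≠ 0 ∧ ∀ i, |(g *ᵥ vec' b x) i| ≤ 2 := by
  classical
  let f : (Fin n → ℝ) →ₗ[ℝ] (Fin n → ℝ) := Matrix.toLin' g
  let B : Set (Fin n → ℝ) := Metric.closedBall 0 2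
  let s : Set (Fin n → ℝ) := f ⁻¹' B
  let e := Pi.basisFun ℝ (Fin n)
  have hdet : LinearMap.det f ≠ 0 := by
    rw [LinearMap.det_toLin']
    intro h; rw [h] at hg; simp at hg
  have hvol : MeasureTheory.volume s = ENNReal.ofReal (4 ^ n) := by
    rw [MeasureTheory.Measure.addHaar_preimage_linearMap _ hdet, LinearMap.det_toLin', abs_inv, hg]
    rw [Real.volume_pi_closedBall _ (by norm_num)]
    norm_num
  have hcount : Countable (Submodule.span ℤ (Set.range e)).toAddSubgroup :=
    inferInstanceAs (Countable (Submodule.span ℤ (Set.range e)))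
  have hfund := ZSpan.isAddFundamentalDomain' e MeasureTheory.volume
  have hvolF : MeasureTheory.volume (ZSpan.fundamentalDomain e) = 1 := by
    rw [ZSpan.volume_fundamentalDomain]
    have : Matrix.of e = 1 := by
      ext i j
      simp [e, Matrix.one_apply, Pi.single_apply, eq_comm]
    rw [this]; simp
  obtain ⟨x, hx0, hxs⟩ := MeasureTheory.exists_ne_zero_mem_lattice_of_measure_mul_two_pow_lt_measure
    (L := (Submodule.span ℤ (Set.range e)).toAddSubgroup) (s := s) hfund (by
      intro x hx
      simp only [s, B, Set.mem_preimage, Metric.mem_closedBall, dist_zero_right, map_neg, norm_neg] at hx ⊢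
      exact hx) ((convex_closedBall _ _).linear_preimage f) (by
      rw [hvol, hvolF, one_mul, Module.finrank_fin_fun, ENNReal.ofReal_pow (by norm_num)]
      have : (2 : ENNReal) ^ n < 4 ^ n := by
        exact_mod_cast Nat.pow_lt_pow_left (by norm_num : 2 < 4) hn.ne'
      simpa using this)
  have hxm : (x : Fin n → ℝ) ∈ Submodule.span ℤ (Set.range e) := x.2
  rw [e.mem_span_iff_repr_mem ℤ] at hxm
  choose w hw using hxm
  refine ⟨b.equivFun.symm w, ?_, ?_⟩
  · intro h0
    apply hx0
    have : w = 0 := (b.equivFun.symm.map_eq_zero_iff).mp h0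
    apply Subtype.ext
    funext i
    have := hw i
    simp_all [e]
  · have hxv : vec' b (b.equivFun.symm w) = (x : Fin n → ℝ) := by
      funext i
      have := hw i
      simp [e] at this
      rw [← this, vec', ← Basis.equivFun_apply, LinearEquiv.apply_symm_apply]
    rw [hxv]
    intro i
    have h1 : ‖f x‖ ≤ 2 := by simpa [s, B] using hxs
    have := norm_le_pi_norm (f x) i
    rw [← Real.norm_eq_abs]
    exact this.trans h1

end Fujisaki

section Fujisaki2

open Matrix Module
open scoped Nat

variable {R : Type} [Ring R] {n : ℕ} (b : Basis (Fin n) ℤ R)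

lemma det_rho (x : R) : (rho b x).det = ((Algebra.leftMulMatrix b x).det : ℝ) := by
  rw [rho_apply, ← RingHom.mapMatrix_apply, ← RingHom.map_det]; rfl

lemma abs_det_rho_unit (u : Rˣ) : |(rho b (u : R)).det| = 1 := by
  rw [det_rho]
  have h : IsUnit (Algebra.leftMulMatrix b (u : R)).det := by
    rw [← Matrix.isUnit_iff_isUnit_det]
    exact u.isUnit.map (Algebra.leftMulMatrix b)
  rw [Int.isUnit_iff] at h
  rcases h with h | h <;> rw [h] <;> simp

lemma det_ne_zero [IsDomain R] {x : R} (hx : x ≠ 0) : (Algebra.leftMulMatrix b x).det ≠ 0 := by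
  intro h
  rw [← Matrix.exists_mulVec_eq_zero_iff] at h
  obtain ⟨v, hv, h⟩ := h
  have h1 := Algebra.leftMulMatrix_mulVec_repr b x (b.equivFun.symm v)
  have h2 : (b.repr (b.equivFun.symm v) : Fin n → ℤ) = v := by
    rw [← Basis.equivFun_apply, LinearEquiv.apply_symm_apply]
  rw [h2, h] at h1
  have h3 : x * b.equivFun.symm v = 0 := by
    apply b.equivFun.injective
    rw [map_zero]
    exact h1.symm
  rcases mul_eq_zero.mp h3 with h4 | h4
  · exact hx h4
  · exact hv ((b.equivFun.symm.map_eq_zero_iff).mp h4)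

lemma exists_cofactor [IsDomain R] {x : R} (hx : x ≠ 0) :
    ∃ y, y * x = ((Algebra.leftMulMatrix b x).det : R) := by
  set N := (Algebra.leftMulMatrix b x).det with hN
  let y : R := b.equivFun.symm ((Algebra.leftMulMatrix b x).adjugate *ᵥ (b.repr 1))
  have hN0 : (N : R) ≠ 0 := by
    intro h0
    have h1 : N • (1 : R) = 0 := by rw [zsmul_one]; exact h0
    have : Module.Free ℤ R := Module.Free.of_basis b
    rcases smul_eq_zero.mp h1 with h | h
    · exact det_ne_zero b hx h
    · exact one_ne_zero h
  have h1 := Algebra.leftMulMatrix_mulVec_repr b x y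
  have h2 : (b.repr y : Fin n → ℤ) = (Algebra.leftMulMatrix b x).adjugate *ᵥ (b.repr 1) := by
    rw [← Basis.equivFun_apply, LinearEquiv.apply_symm_apply]
  rw [h2, Matrix.mulVec_mulVec, Matrix.mul_adjugate, ← hN, Matrix.smul_mulVec, Matrix.one_mulVec] at h1
  have hxy : x * y = N := by
    apply b.equivFun.injective
    rw [Basis.equivFun_apply, ← h1, ← zsmul_one, Basis.equivFun_apply, map_zsmul]
    rfl
  refine ⟨y, ?_⟩
  have hy : y ≠ 0 := fun h => hN0 (by rw [← hxy, h, mul_zero])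
  apply mul_right_cancel₀ hy
  rw [mul_assoc, hxy, (Int.cast_commute N y).eq]

lemma unit_of_cong [IsDomain R] {x x' : R} (hx : x ≠ 0) (hx' : x' ≠ 0) {M : ℤ}
    (hM : (Algebra.leftMulMatrix b x).det ∣ M) (hM' : (Algebra.leftMulMatrix b x').det ∣ M) {r : R}
    (h : x' = x + M * r) : ∃ u : Rˣ, x' = u * x := by
  obtain ⟨y, hy⟩ := exists_cofactor b hx
  obtain ⟨y', hy'⟩ := exists_cofactor b hx'
  obtain ⟨k, hk⟩ := hM
  obtain ⟨k', hk'⟩ := hM'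
  have key : ∀ (r z y : R) (N k : ℤ), y * z = N → M = N * k → (M : R) * r = (r * k * y) * z := by
    intro r z y N k h1 h2
    rw [mul_assoc, h1, h2, (Int.cast_commute (N * k) r).eq]
    push_cast
    rw [mul_assoc, (Int.cast_commute N (k : R)).eq]
  have e1 : x' = (1 + r * k * y) * x := by
    rw [add_mul, one_mul, ← key r x y _ k hy hk, h]
  have e2 : x = (1 + (-r) * k' * y') * x' := by
    rw [add_mul, one_mul, ← key (-r) x' y' _ k' hy' hk']
    rw [mul_neg, h]; simp
  have h12 : (1 + (-r) * k' * y') * (1 + r * k * y) = 1 := by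
    apply mul_right_cancel₀ hx
    rw [mul_assoc, ← e1, ← e2, one_mul]
  have h21 : (1 + r * k * y) * (1 + (-r) * k' * y') = 1 := by
    apply mul_right_cancel₀ hx'
    rw [mul_assoc, ← e2, ← e1, one_mul]
  exact ⟨⟨_, _, h21, h12⟩, e1⟩

lemma fujisaki [IsDomain R] (hn : 0 < n) : ∃ C : Set (Matrix (Fin n) (Fin n) ℝ), IsCompact C ∧
    (∀ c ∈ C, |c.det| = 1) ∧ ∀ g, InV b g → |g.det| = 1 → ∃ c ∈ C, ∃ u : Rˣ, g = c * rho b u := by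
  classical
  let Bx : Set (Fin n → ℝ) := Metric.closedBall 0 2
  let LB : Set (Matrix (Fin n) (Fin n) ℝ) := LL b '' Bx
  have hLB : IsCompact LB := (isCompact_closedBall _ _).image (LL_continuous b)
  obtain ⟨c, hc⟩ := hLB.exists_bound_of_continuousOn (f := fun m => m.det)
    (Continuous.continuousOn (continuous_id.matrix_det))
  let M : ℕ := (⌊c⌋₊)!
  have hM0 : M ≠ 0 := Nat.factorial_ne_zero _
  have : NeZero M := ⟨hM0⟩
  let good : R → Prop := fun x => x ≠ 0 ∧ ((Algebra.leftMulMatrix b x).det) ∣ (M : ℤ)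
  let cl : R → (Fin n → ZMod M) := fun x i => (b.repr x i : ZMod M)
  have hcl : ∀ x x', cl x = cl x' → ∃ r, x' = x + ((M : ℤ) : R) * r := by
    intro x x' h
    have h1 : ∀ i, ∃ k : ℤ, b.repr x' i - b.repr x i = M * k := by
      intro i
      have := congrFun h i
      simp only [cl] at this
      rw [ZMod.intCast_eq_intCast_iff_dvd_sub] at this
      exact this
    choose k hk using h1
    refine ⟨b.equivFun.symm k, ?_⟩
    apply b.equivFun.injective
    funext i
    have h3 : ((M : ℤ) : R) * b.equivFun.symm k = (M : ℤ) • b.equivFun.symm k := by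
      rw [zsmul_eq_mul]
    rw [h3, map_add, map_smul, LinearEquiv.apply_symm_apply]
    simp only [Basis.equivFun_apply, Pi.add_apply, Pi.smul_apply, smul_eq_mul]
    linarith [hk i]
  let rep : (Fin n → ZMod M) → R := fun q => if h : ∃ x, good x ∧ cl x = q then h.choose else 1
  have hrep : ∀ x, good x → good (rep (cl x)) ∧ cl (rep (cl x)) = cl x := by
    intro x hx
    have h : ∃ x', good x' ∧ cl x' = cl x := ⟨x, hx, rfl⟩
    have : rep (cl x) = h.choose := dif_pos h
    rw [this]
    exact h.choose_spec
  let C : Set (Matrix (Fin n) (Fin n) ℝ) := {m | |m.det| = 1} ∩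
    ⋃ q : Fin n → ZMod M, (fun m => m * (rho b (rep q))⁻¹) '' LB
  refine ⟨C, ?_, fun c hc => hc.1, ?_⟩
  · apply IsCompact.inter_left
    · exact isCompact_iUnion fun q => hLB.image (by fun_prop)
    · exact isClosed_eq (continuous_abs.comp continuous_id.matrix_det) continuous_const
  · intro g hgV hg
    obtain ⟨x, hx0, hx⟩ := minkowski_box b hg hn
    have hmem : LL b (g *ᵥ vec' b x) ∈ LB := by
      refine ⟨_, ?_, rfl⟩
      simp only [Bx, Metric.mem_closedBall, dist_zero_right]
      rw [pi_norm_le_iff_of_nonneg (by norm_num)]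
      exact hx
    rw [← hgV, LL_vec] at hmem
    have hdet := hc _ hmem
    have hgood : good x := by
      refine ⟨hx0, ?_⟩
      rw [Matrix.det_mul, norm_mul, Real.norm_eq_abs, hg, one_mul, det_rho] at hdet
      rw [← Int.natAbs_dvd]
      norm_cast
      apply Nat.dvd_factorial
      · exact Int.natAbs_pos.mpr (det_ne_zero b hx0)
      · apply Nat.le_floor
        rw [Real.norm_eq_abs] at hdet
        rw [Nat.cast_natAbs]
        exact_mod_cast hdet
    obtain ⟨hr1, hr2⟩ := hrep x hgood
    obtain ⟨r, hr⟩ := hcl _ _ hr2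
    obtain ⟨u, hu⟩ := unit_of_cong b hr1.1 hx0 hr1.2 hgood.2 hr
    have hdetr : IsUnit (rho b (rep (cl x))).det := by
      rw [det_rho]
      exact isUnit_iff_ne_zero.mpr (by exact_mod_cast det_ne_zero b hr1.1)
    have hE : g * rho b u = g * rho b x * (rho b (rep (cl x)))⁻¹ := by
      have hu1 : rho b x = rho b u * rho b (rep (cl x)) := by rw [← map_mul, ← hu]
      rw [hu1, ← mul_assoc, Matrix.mul_nonsing_inv_cancel_right _ _ hdetr]
    refine ⟨g * rho b u, ⟨?_, ?_⟩, u⁻¹, ?_⟩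
    · rw [Set.mem_setOf_eq, Matrix.det_mul, abs_mul, hg, abs_det_rho_unit, one_mul]
    · rw [Set.mem_iUnion]
      exact ⟨cl x, _, hmem, hE.symm⟩
    · rw [mul_assoc, ← map_mul, Units.mul_inv, map_one, mul_one]

end Fujisaki2

section Path

open Matrix Module

variable {n : ℕ}

lemma exists_pow_no_neg (hn : 0 < n) (B : Matrix (Fin n) (Fin n) ℝ) :
    ∃ M : ℕ, 0 < M ∧ ∀ s : ℝ, 0 < s → (s • (1 : Matrix (Fin n) (Fin n) ℝ) + B ^ M).det ≠ 0 := by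
  classical
  have : Nonempty (Fin n) := ⟨⟨0, hn⟩⟩
  let φ := (Complex.ofRealHom).mapMatrix (m := Fin n)
  let Bc : Matrix (Fin n) (Fin n) ℂ := φ B
  have hfin : (spectrum ℂ Bc).Finite := Matrix.finite_spectrum Bc
  let bad : ℂ → ℕ → Prop := fun l k => 0 < k ∧ ∃ s : ℝ, 0 < s ∧ l ^ k = -(s : ℂ)
  let m : ℂ → ℕ := fun l => if h : ∃ k, bad l k then 2 * h.choose else 1
  have hm : ∀ l, 0 < m l := by
    intro l
    by_cases h : ∃ k, bad l k
    · simp only [m, dif_pos h]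
      have := h.choose_spec.1
      omega
    · simp only [m, dif_neg h]; norm_num
  have hMpos : 0 < ∏ l ∈ hfin.toFinset, m l := Finset.prod_pos fun l _ => hm l
  refine ⟨∏ l ∈ hfin.toFinset, m l, hMpos, ?_⟩
  intro s hs hdet
  set M := ∏ l ∈ hfin.toFinset, m l with hM
  have h1 : (-(s : ℂ)) ∈ spectrum ℂ (Bc ^ M) := by
    rw [spectrum.mem_iff, Matrix.isUnit_iff_isUnit_det]
    have h2 : algebraMap ℂ (Matrix (Fin n) (Fin n) ℂ) (-(s : ℂ)) - Bc ^ M = 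
        - φ (s • (1 : Matrix (Fin n) (Fin n) ℝ) + B ^ M) := by
      rw [map_add, map_pow, neg_add, map_neg, sub_eq_add_neg]
      congr 2
      ext i k
      by_cases hik : i = k
      · subst hik
        simp [φ, Matrix.algebraMap_matrix_apply, Matrix.one_apply]
      · simp [φ, Matrix.algebraMap_matrix_apply, Matrix.one_apply, hik]
    rw [h2, Matrix.det_neg, ← RingHom.map_det, hdet]
    simp
  rw [spectrum.map_pow_of_pos _ hMpos] at h1
  obtain ⟨l, hl, hle⟩ := h1
  have hb : ∃ k, bad l k := ⟨M, hMpos, s, hs, hle⟩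
  obtain ⟨s0, hs0, hk⟩ := hb.choose_spec.2
  have hdvd : m l ∣ M := Finset.dvd_prod_of_mem m (by simpa using hl)
  obtain ⟨q, hq⟩ := hdvd
  have hml : m l = 2 * hb.choose := dif_pos hb
  have h3 : l ^ M = (((s0 ^ 2) ^ q : ℝ) : ℂ) := by
    rw [hq, hml, pow_mul, mul_comm 2, pow_mul, hk]
    push_cast
    ring
  simp only at hle
  rw [h3] at hle
  have h4 : (s0 ^ 2) ^ q = -s := by exact_mod_cast hle
  have : 0 < (s0 ^ 2) ^ q := by positivity
  linarith

variable {R : Type} [Ring R] (b : Basis (Fin n) ℤ R)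

lemma exists_path (hn : 0 < n) (A : Matrix (Fin n) (Fin n) ℝ) (hA : InV b A) (hdet : |A.det| = 1)
    (hneg : ∀ s : ℝ, 0 < s → (s • (1 : Matrix (Fin n) (Fin n) ℝ) + A).det ≠ 0) :
    ∃ Y : Set (Matrix (Fin n) (Fin n) ℝ), IsCompact Y ∧ IsPreconnected Y ∧ 1 ∈ Y ∧ A ∈ Y ∧
      (∀ y ∈ Y, InV b y) ∧ (∀ y ∈ Y, |y.det| = 1) ∧ ∀ y ∈ Y, ∀ m, A * m = m * A → y * m = m * y := by
  let Bt : ℝ → Matrix (Fin n) (Fin n) ℝ := fun t => (1 - t) • 1 + t • A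
  have hBt : ∀ t ∈ Set.Icc (0 : ℝ) 1, (Bt t).det ≠ 0 := by
    rintro t ⟨h0, h1⟩ hd
    rcases h0.eq_or_lt with h0 | h0
    · simp [Bt, ← h0] at hd
    rcases h1.eq_or_lt with h1 | h1
    · simp only [Bt, h1, sub_self, zero_smul, zero_add, one_smul] at hd
      rw [hd] at hdet; simp at hdet
    · have : Bt t = t • (((1 - t) / t) • 1 + A) := by
        simp only [Bt, smul_add, smul_smul]
        congr 2
        field_simp
      rw [this, Matrix.det_smul] at hd
      rcases mul_eq_zero.mp hd with h | h
      · exact (pow_ne_zero _ h0.ne') h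
      · exact hneg _ (div_pos (by linarith) h0) h
  have hcB : Continuous Bt := by fun_prop
  let p : ℝ → Matrix (Fin n) (Fin n) ℝ := fun t => (|(Bt t).det| ^ (-(1 / (n : ℝ)))) • Bt t
  have hp : ContinuousOn p (Set.Icc 0 1) := by
    refine ContinuousOn.smul (f := fun t => |(Bt t).det| ^ (-(1 / (n : ℝ)))) ?_ hcB.continuousOn
    apply ContinuousOn.rpow_const
    · exact (continuous_abs.comp hcB.matrix_det).continuousOn
    · intro t ht
      exact Or.inl (abs_ne_zero.mpr (hBt t ht))
  refine ⟨p '' Set.Icc 0 1, isCompact_Icc.image_of_continuousOn hp, isPreconnected_Icc.image _ hp, 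
    ⟨0, by simp, ?_⟩, ⟨1, by simp, ?_⟩, ?_, ?_, ?_⟩
  · simp [p, Bt]
  · simp [p, Bt, hdet]
  · rintro _ ⟨t, -, rfl⟩
    exact InV_smul b _ (InV_add b (InV_smul b _ (InV_one b)) (InV_smul b _ hA))
  · rintro _ ⟨t, ht, rfl⟩
    have ha : 0 < |(Bt t).det| := abs_pos.mpr (hBt t ht)
    simp only [p]
    rw [Matrix.det_smul, abs_mul, abs_pow, Fintype.card_fin, abs_of_pos (Real.rpow_pos_of_pos ha _),
      ← Real.rpow_natCast, ← Real.rpow_mul ha.le]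
    have : -(1 / (n : ℝ)) * n = -1 := by
      have : (n : ℝ) ≠ 0 := by exact_mod_cast hn.ne'
      field_simp
    rw [this, Real.rpow_neg_one, inv_mul_cancel₀ ha.ne']
  · rintro _ ⟨t, ht, rfl⟩ m hm
    simp only [p, Bt]
    rw [smul_mul_assoc, mul_smul_comm, add_mul, mul_add, smul_mul_assoc, smul_mul_assoc, 
      mul_smul_comm, mul_smul_comm, hm, one_mul, mul_one]

/-- The set of inverses of a compact set of matrices of determinant `± 1`. -/
lemma compact_inv {C : Set (Matrix (Fin n) (Fin n) ℝ)} (hC : IsCompact C) 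
    (hdet : ∀ c ∈ C, |c.det| = 1) : IsCompact ((fun c => c⁻¹) '' C) := by
  have : (fun c : Matrix (Fin n) (Fin n) ℝ => c⁻¹) '' C = (fun c => c.det • c.adjugate) '' C := by
    apply Set.image_congr
    intro c hc
    rw [Matrix.inv_def]
    congr 1
    rcases (abs_eq one_pos.le).mp (hdet c hc) with h | h <;> rw [h] <;> simp
  rw [this]
  exact hC.image (continuous_id.matrix_det.smul continuous_id.matrix_adjugate)

lemma isUnit_det_of_abs {c : Matrix (Fin n) (Fin n) ℝ} (h : |c.det| = 1) : IsUnit c.det := by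
  rw [isUnit_iff_ne_zero]
  intro h0; rw [h0] at h; simp at h

end Path

section Ends

open Matrix Module

variable {n : ℕ} {R : Type} [Ring R]

lemma compact_mul {C E : Set (Matrix (Fin n) (Fin n) ℝ)} (hC : IsCompact C) (hE : IsCompact E) :
    IsCompact (Set.image2 (fun c e => c * e) C E) :=
  by
  rw [← Set.image_prod (fun c e => c * e)]
  exact (hC.prod hE).image (by fun_prop)

lemma ends_contradiction [IsDomain R] (b : Basis (Fin n) ℤ R) (hn : 0 < n) {Γ : Type} [Group Γ] (j : Γ →* Rˣ)
    (hj : Function.Injective j) (hfin : j.range.FiniteIndex) {X : Type} (π : Γ →* FreeGroup X)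
    {x y : X} (hxy : x ≠ y) (hπ : ∀ f, ∃ g, π g = f ∧ ∀ k, π k = 1 → k * g = g * k) : False := by
  classical
  let σ : Γ →* Matrix (Fin n) (Fin n) ℝ := 
    ((rho b : R →* Matrix (Fin n) (Fin n) ℝ).comp (Units.coeHom R)).comp j
  have hσ : ∀ g, σ g = rho b (j g : R) := fun g => rfl
  have hσV : ∀ g, InV b (σ g) := fun g => InV_rho b _
  have hσdet : ∀ g, |(σ g).det| = 1 := fun g => abs_det_rho_unit b _
  have hσfin : ∀ K, IsCompact K → {g | σ g ∈ K}.Finite := by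
    intro K hK
    have h1 := finite_of_compact b hK
    have : {g | σ g ∈ K} = (fun g => (j g : R)) ⁻¹' {r | rho b r ∈ K} := rfl
    rw [this]
    exact h1.preimage (Units.val_injective.comp hj).injOn
  have hσi : ∀ g, σ g * σ g⁻¹ = 1 := fun g => by rw [← map_mul]; simp
  have hσi' : ∀ g, σ g⁻¹ * σ g = 1 := fun g => by rw [← map_mul]; simp
  -- compact fundamental set for Γ
  obtain ⟨C, hC, hCdet, hCg⟩ : ∃ C : Set (Matrix (Fin n) (Fin n) ℝ), IsCompact C ∧
      (∀ c ∈ C, |c.det| = 1) ∧ (1 ∈ C ∧ ∀ g, InV b g → |g.det| = 1 → ∃ c ∈ C, ∃ γ : Γ, g = c * σ γ) := by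
    obtain ⟨C, hC, hCdet, hCg⟩ := fujisaki b hn
    have : Finite (Rˣ ⧸ j.range) := Subgroup.finite_quotient_of_finiteIndex
    refine ⟨{1} ∪ ⋃ q : Rˣ ⧸ j.range, (fun c => c * rho b (q.out : R)) '' C, ?_, ?_, Or.inl rfl, ?_⟩
    · exact isCompact_singleton.union (isCompact_iUnion fun q => hC.image (by fun_prop))
    · rintro c (rfl | hc)
      · simp
      · rw [Set.mem_iUnion] at hc
        obtain ⟨q, c, hc, rfl⟩ := hc
        simp only
        rw [Matrix.det_mul, abs_mul, hCdet c hc, abs_det_rho_unit, one_mul]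
    · intro g hg hgd
      obtain ⟨c, hc, u, hu⟩ := hCg g hg hgd
      obtain ⟨γ, hγ⟩ : ((u : Rˣ ⧸ j.range).out)⁻¹ * u ∈ j.range := by
        rw [← QuotientGroup.eq]; simp
      refine ⟨c * rho b ((u : Rˣ ⧸ j.range).out : R), Or.inr ?_, γ, ?_⟩
      · rw [Set.mem_iUnion]
        exact ⟨_, c, hc, rfl⟩
      · rw [hu, hσ, hγ, mul_assoc, ← map_mul]
        simp
  obtain ⟨hC1, hCg⟩ := hCg
  have hCinv := compact_inv hC hCdet
  obtain ⟨γ0, hγ0, -⟩ := hπ (FreeGroup.of x)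
  obtain ⟨P0, hP0, hP0c⟩ := hπ (FreeGroup.of y)
  obtain ⟨M, hM, hneg⟩ := exists_pow_no_neg hn (σ P0)
  rw [← map_pow] at hneg
  obtain ⟨Y, hY, hYc, hY1, hYA, hYV, hYdet, hYcomm⟩ := exists_path b hn (σ (P0 ^ M)) (hσV _) (hσdet _) hneg
  have hYinv := compact_inv hY hYdet
  -- the finite set of translations
  have hT : {τ | σ τ ∈ Set.image2 (fun c e => c * e) ((fun c => c⁻¹) '' C) C}.Finite :=
    hσfin _ (compact_mul hCinv hC)
  let Φ : Set (FreeGroup X) := ⋃ τ ∈ {τ | σ τ ∈ Set.image2 (fun c e => c * e) ((fun c => c⁻¹) '' C) C},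
    {e | lastLetter e = some (x, true) ∧ lastLetter (π τ * e) ≠ some (x, true)}
  have hΦ : Φ.Finite := hT.biUnion fun τ _ => finite_lastLetter_boundary (x, true) (π τ)
  choose lift hlift hliftc using hπ
  let W : Set (Matrix (Fin n) (Fin n) ℝ) := Set.image2 (fun c e => c * e) 
    (Set.image2 (fun c e => c * e) C ((fun f => σ (lift f)) '' Φ)) ((fun c => c⁻¹) '' Y)
  have hW : IsCompact W := compact_mul (compact_mul hC (hΦ.image _).isCompact) hYinv
  have hWfin := hσfin W hW
  -- main claim
  have main : ∀ N : ℕ, ∃ g, σ g ∈ W ∧ π g = FreeGroup.of x ^ (N + 1) := by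
    intro N
    set h := γ0 ^ (N + 1) with hh
    let F : Set Γ := {γ | σ γ ∈ Set.image2 (fun c e => c * e) ((fun c => c⁻¹) '' C) 
      ((fun y => σ h * y) '' Y)}
    have hF : F.Finite := hσfin _ (compact_mul hCinv (hY.image (by fun_prop)))
    let Tset : Set Γ → Set (Matrix (Fin n) (Fin n) ℝ) := fun E => 
      ⋃ γ ∈ F ∩ E, {y | σ h * y * σ γ⁻¹ ∈ C}
    have hTclosed : ∀ E, IsClosed (Tset E) := by
      intro E
      refine (hF.subset Set.inter_subset_left).isClosed_biUnion fun γ _ => ?_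
      exact hC.isClosed.preimage (f := fun y => σ h * y * σ γ⁻¹) (by fun_prop)
    have hmemT : ∀ (E : Set Γ) y, y ∈ Y → ∀ γ ∈ E, ∀ c ∈ C, σ h * y = c * σ γ → y ∈ Tset E := by
      intro E y hy γ hγ c hc hyc
      simp only [Tset, Set.mem_iUnion]
      refine ⟨γ, ⟨⟨c⁻¹, ⟨c, hc, rfl⟩, _, ⟨y, hy, rfl⟩, ?_⟩, hγ⟩, ?_⟩
      · simp only
        rw [hyc, Matrix.nonsing_inv_mul_cancel_left _ _ (isUnit_det_of_abs (hCdet c hc))]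
      · change σ h * y * σ γ⁻¹ ∈ C
        rw [hyc, mul_assoc, hσi, mul_one]; exact hc
    let E : Set Γ := {γ | lastLetter (π γ) = some (x, true)}
    have hcov : Y ⊆ Tset E ∪ Tset Eᶜ := by
      intro y hy
      obtain ⟨c, hc, γ, hγ⟩ := hCg (σ h * y) (InV_mul b (hσV _) (hYV y hy)) (by
        rw [Matrix.det_mul, abs_mul, hσdet, hYdet y hy, one_mul])
      by_cases hE : γ ∈ E
      · exact Or.inl (hmemT _ y hy γ hE c hc hγ)
      · exact Or.inr (hmemT _ y hy γ hE c hc hγ)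
    have hne1 : (Y ∩ Tset E).Nonempty := by
      refine ⟨1, hY1, hmemT _ 1 hY1 h ?_ 1 hC1 (by simp)⟩
      change lastLetter (π h) = _
      rw [hh, map_pow, hγ0]
      exact lastLetter_of_pow x (N + 1) (Nat.succ_pos N)
    have hne2 : (Y ∩ Tset Eᶜ).Nonempty := by
      refine ⟨_, hYA, hmemT _ _ hYA (h * P0 ^ M) ?_ 1 hC1 (by simp)⟩
      change ¬ (lastLetter (π (h * P0 ^ M)) = _)
      rw [hh, map_mul, map_pow, map_pow, hγ0, hP0, lastLetter_pow_mul x y _ _ hM]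
      simp [hxy.symm]
    obtain ⟨y0, hy0, hyE, hyE'⟩ := (isPreconnected_closed_iff.mp hYc) _ _ (hTclosed E) (hTclosed Eᶜ) 
      hcov hne1 hne2
    simp only [Tset, Set.mem_iUnion] at hyE hyE'
    obtain ⟨γ, ⟨-, hγE⟩, hγC⟩ := hyE
    obtain ⟨γ', ⟨-, hγE'⟩, hγC'⟩ := hyE'
    set c := σ h * y0 * σ γ⁻¹ with hc
    set c' := σ h * y0 * σ γ'⁻¹ with hc'
    change c ∈ C at hγC
    change c' ∈ C at hγC'
    clear_value c c'
    have e1 : σ h * y0 = c * σ γ := by rw [hc, mul_assoc, hσi', mul_one]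
    have e2 : σ h * y0 = c' * σ γ' := by rw [hc', mul_assoc, hσi', mul_one]
    have hτ : σ (γ' * γ⁻¹) = c'⁻¹ * c := by
      have : σ γ' = c'⁻¹ * (c * σ γ) := by
        rw [← e1, e2, Matrix.nonsing_inv_mul_cancel_left _ _ (isUnit_det_of_abs (hCdet c' hγC'))]
      rw [map_mul, this, mul_assoc, mul_assoc, hσi, mul_one]
    have hΦmem : π γ ∈ Φ := by
      simp only [Φ, Set.mem_iUnion]
      refine ⟨γ' * γ⁻¹, ?_, hγE, ?_⟩
      · rw [Set.mem_setOf_eq, hτ]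
        exact ⟨_, ⟨c', hγC', rfl⟩, c, hγC, rfl⟩
      · rw [← map_mul, inv_mul_cancel_right]
        exact hγE'
    set κ := (lift (π γ))⁻¹ * γ with hκ
    have hκ1 : π κ = 1 := by rw [hκ, map_mul, map_inv, hlift, inv_mul_cancel]
    have hκP : σ (P0 ^ M) * σ κ = σ κ * σ (P0 ^ M) := by
      have : Commute κ P0 := hP0c κ hκ1
      rw [← map_mul, ← map_mul, (this.pow_right M).eq]
    have hyκ := hYcomm y0 hy0 _ hκP
    refine ⟨h * κ⁻¹, ?_, ?_⟩
    · refine ⟨c * σ (lift (π γ)), ⟨c, hγC, _, ⟨_, hΦmem, rfl⟩, rfl⟩, y0⁻¹, ⟨y0, hy0, rfl⟩, ?_⟩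
      have hu := isUnit_det_of_abs (hYdet y0 hy0)
      simp only
      have e3 : σ γ = σ (lift (π γ)) * σ κ := by rw [← map_mul, hκ, mul_inv_cancel_left]
      have e4 : c * σ (lift (π γ)) = σ h * y0 * σ κ⁻¹ := by
        rw [e1, e3, mul_assoc, mul_assoc, hσi, mul_one]
      have e5 : y0 * σ κ⁻¹ = σ κ⁻¹ * y0 := by
        calc y0 * σ κ⁻¹ = σ κ⁻¹ * (σ κ * y0) * σ κ⁻¹ := by rw [← mul_assoc, hσi', one_mul]
          _ = σ κ⁻¹ * y0 := by rw [← hyκ, mul_assoc, mul_assoc, hσi, mul_one]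
      rw [e4, mul_assoc, mul_assoc, ← mul_assoc y0, e5, mul_assoc, Matrix.mul_nonsing_inv _ hu, mul_one, map_mul]
    · rw [map_mul, map_inv, hκ1, hh, map_pow, hγ0]; simp
  choose g hgW hgπ using main
  have hinj : Function.Injective g := by
    intro N N' hNN
    have := hgπ N
    rw [hNN, hgπ N'] at this
    by_contra hne
    rcases lt_or_gt_of_ne hne with hlt | hlt
    · have h1 : FreeGroup.of x ^ (N' - N) = 1 := by
        have : FreeGroup.of x ^ (N + 1) * FreeGroup.of x ^ (N' - N) = FreeGroup.of x ^ (N + 1) * 1 := by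
          rw [← pow_add, mul_one, ← this]; congr 1; omega
        exact mul_left_cancel this
      exact FreeGroup.of_ne_one x (isFreeGroup_pow_eq_one (by omega) h1)
    · have h1 : FreeGroup.of x ^ (N - N') = 1 := by
        have : FreeGroup.of x ^ (N' + 1) * FreeGroup.of x ^ (N - N') = FreeGroup.of x ^ (N' + 1) * 1 := by
          rw [← pow_add, mul_one, this]; congr 1; omega
        exact mul_left_cancel this
      exact FreeGroup.of_ne_one x (isFreeGroup_pow_eq_one (by omega) h1)
  exact Set.infinite_of_injective_forall_mem hinj (s := {g | σ g ∈ W}) (fun N => hgW N) hWfin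

end Ends

section Div

open Module

lemma basis_of_order {D : Type} [DivisionRing D] [Algebra ℚ D] {O : Subring D} (hO : IsOrderIn O) :
    ∃ n, 0 < n ∧ Nonempty (Basis (Fin n) ℤ ↥O) := by
  have hfin : Module.Finite ℤ O.toAddSubgroup := by
    rw [Module.Finite.iff_addGroup_fg]
    exact (AddGroup.fg_iff_addSubgroup_fg _).mpr hO.1
  have hfin' : Module.Finite ℤ ↥O := hfin
  have : CharZero D := algebraRat.charZero D
  have : CharZero ↥O := ⟨fun a b h => by
    have := congrArg (fun x : ↥O => (x : D)) h
    simpa using this⟩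
  have hfree : Module.Free ℤ ↥O := Module.free_of_finite_type_torsion_free'
  have := Module.finBasis ℤ ↥O
  exact ⟨_, Module.finrank_pos, ⟨this⟩⟩

lemma division_abelian {D : Type} [DivisionRing D] [Algebra ℚ D] {O : Subring D} (hO : IsOrderIn O)
    (hd : Dich (unitGroup O)) : ∃ V : Subgroup Dˣ, V ≤ unitGroup O ∧ V.relIndex (unitGroup O) ≠ 0 ∧
      ∀ a ∈ V, ∀ b ∈ V, a * b = b * a := by
  obtain ⟨Γ, _, j, hj, hle, hidx, h⟩ := hd
  rcases h with h | ⟨X, x, y, π, hxy, hπ⟩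
  · refine ⟨j.range, hle, hidx, ?_⟩
    rintro _ ⟨a, rfl⟩ _ ⟨b, rfl⟩
    rw [← map_mul, h, map_mul]
  · exfalso
    obtain ⟨n, hn, ⟨b⟩⟩ := basis_of_order hO
    let e : unitGroup O ≃* (↥O)ˣ := Submonoid.unitsEquivUnitsType O.toSubmonoid
    let j' : Γ →* unitGroup O := j.codRestrict _ (fun g => hle ⟨g, rfl⟩)
    have hj' : Function.Injective j' := fun a b hab => hj (congrArg Subtype.val hab)
    have hr : j'.range = j.range.subgroupOf (unitGroup O) := by
      ext u
      rw [Subgroup.mem_subgroupOf]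
      constructor
      · rintro ⟨g, rfl⟩; exact ⟨g, rfl⟩
      · rintro ⟨g, hg⟩; exact ⟨g, Subtype.ext hg⟩
    refine ends_contradiction b hn (e.toMonoidHom.comp j') (e.injective.comp hj') ?_ π hxy hπ
    rw [MonoidHom.range_comp]
    constructor
    have := Subgroup.index_map_of_bijective (f := e.toMonoidHom) e.bijective j'.range
    rw [this, hr]
    exact hidx

end Div

section Central

open Module

variable {D : Type} [DivisionRing D] [Algebra ℚ D] [FiniteDimensional ℚ D]

/-- every unit of every finitely generated subring has a power in `L` -/
def PowIn (L : Subalgebra ℚ D) : Prop :=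
  ∀ R : Subring D, R.toAddSubgroup.FG → ∀ u ∈ unitGroup R, ∃ M : ℕ, M ≠ 0 ∧ ((u : D)) ^ M ∈ L

lemma PowIn.inf {L L' : Subalgebra ℚ D} (h : PowIn L) (h' : PowIn L') : PowIn (L ⊓ L') := by
  intro R hR u hu
  obtain ⟨M, hM, h1⟩ := h R hR u hu
  obtain ⟨M', hM', h2⟩ := h' R hR u hu
  refine ⟨M * M', mul_ne_zero hM hM', ?_, ?_⟩
  · change _ ∈ L
    rw [pow_mul]; exact pow_mem h1 _
  · change _ ∈ L'
    rw [mul_comm, pow_mul]; exact pow_mem h2 _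

/-- conjugation -/
def conjHom (x : D) (hx : x ≠ 0) : D →ₐ[ℚ] D where
  toFun d := x * d * x⁻¹
  map_one' := by simp [hx]
  map_zero' := by simp
  map_mul' a b := by
    have : x * (a * b) * x⁻¹ = x * a * (x⁻¹ * x) * b * x⁻¹ := by rw [inv_mul_cancel₀ hx]; simp [mul_assoc]
    rw [this]; simp only [mul_assoc]
  map_add' a b := by rw [mul_add, add_mul]
  commutes' q := by rw [← Algebra.commutes, mul_assoc, mul_inv_cancel₀ hx, mul_one]

lemma PowIn.conj {L : Subalgebra ℚ D} (h : PowIn L) (x : D) (hx : x ≠ 0) :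
    PowIn (L.comap (conjHom x hx)) := by
  intro R hR u hu
  have hmap : (R.map (conjHom x hx : D →+* D)).toAddSubgroup.FG := 
    addSubgroup_fg_map hR ((conjHom x hx : D →+* D) : D →+ D)
  obtain ⟨M, hM, h1⟩ := h _ hmap (Units.map (conjHom x hx : D →* D) u) (by
    rw [mem_unitGroup] at hu ⊢
    exact ⟨⟨_, hu.1, rfl⟩, ⟨_, hu.2, rfl⟩⟩)
  refine ⟨M, hM, ?_⟩
  rw [Subalgebra.mem_comap, map_pow]
  exact h1

lemma central_of_conj {L : Subalgebra ℚ D} (hcomm : ∀ a ∈ L, ∀ b ∈ L, a * b = b * a)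
    (hconj : ∀ x : D, x ≠ 0 → ∀ l ∈ L, x * l * x⁻¹ ∈ L) : ∀ l ∈ L, ∀ x : D, x * l = l * x := by
  intro l hl x
  by_cases hx : x ∈ L
  · exact hcomm _ hx _ hl
  have hx0 : x ≠ 0 := by rintro rfl; exact hx (zero_mem L)
  have hx1 : x + 1 ≠ 0 := by
    intro h
    rw [eq_neg_of_add_eq_zero_left h] at hx
    exact hx (neg_mem (one_mem L))
  obtain ⟨l', hl', e1⟩ : ∃ l' ∈ L, x * l = l' * x := ⟨_, hconj x hx0 l hl, by
    rw [mul_assoc _ x⁻¹, inv_mul_cancel₀ hx0, mul_one]⟩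
  obtain ⟨l'', hl'', e2⟩ : ∃ l'' ∈ L, (x + 1) * l = l'' * (x + 1) := ⟨_, hconj _ hx1 l hl, by
    rw [mul_assoc _ (x + 1)⁻¹, inv_mul_cancel₀ hx1, mul_one]⟩
  have e3 : (l'' - l') * x = l - l'' := by
    rw [sub_mul, ← e1]
    rw [add_mul, mul_add, one_mul, mul_one] at e2
    rw [sub_eq_sub_iff_add_eq_add, add_comm l, e2]
  by_cases hc : l'' - l' = 0
  · rw [hc, zero_mul] at e3
    rw [e1, sub_eq_zero.mp hc.symm.symm |>.symm, sub_eq_zero.mp e3.symm]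
  · have hcx : x = (l'' - l')⁻¹ * (l - l'') := by rw [← e3, inv_mul_cancel_left₀ hc]
    have c1 : Commute (l'' - l') l := hcomm _ (sub_mem hl'' hl') _ hl
    have c2 : Commute (l - l'') l := hcomm _ (sub_mem hl hl'') _ hl
    rw [hcx]
    exact (c1.inv_left₀.mul_left c2)

lemma units_pow_central {O : Subring D} (hO : IsOrderIn O) {V : Subgroup Dˣ} 
    (hidx : V.relIndex (unitGroup O) ≠ 0) (hV : ∀ a ∈ V, ∀ b ∈ V, a * b = b * a) :
    ∀ R : Subring D, R.toAddSubgroup.FG → ∀ u ∈ unitGroup R, ∃ M : ℕ, M ≠ 0 ∧ 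
      ∀ x : D, x * (u : D) ^ M = (u : D) ^ M * x := by
  classical
  let L1 : Subalgebra ℚ D := Algebra.adjoin ℚ ((fun u : Dˣ => (u : D)) '' V)
  have hL1c : ∀ a ∈ L1, ∀ b ∈ L1, a * b = b * a := by
    intro a ha b hb
    refine Algebra.commute_of_mem_adjoin_of_forall_mem_commute hb ?_ |>.eq
    rintro _ ⟨v, hv, rfl⟩
    refine (Algebra.commute_of_mem_adjoin_of_forall_mem_commute ha ?_).symm
    rintro _ ⟨w, hw, rfl⟩
    exact congrArg Units.val (hV v hv w hw)
  have hL1 : PowIn L1 := by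
    intro R hR u hu
    have h1 := relIndex_unitGroup hO hR (MonoidHom.id Dˣ) (AddMonoidHom.id D) (fun u => by simp)
    obtain ⟨n, hn, h2⟩ := pow_mem_of_relIndex h1 hu
    obtain ⟨m, hm, h3⟩ := pow_mem_of_relIndex hidx h2
    refine ⟨n * m, mul_ne_zero hn hm, ?_⟩
    rw [pow_mul]
    refine Algebra.subset_adjoin ⟨_, h3, ?_⟩
    simp
  obtain ⟨k, ⟨L, hL, hk⟩, hmin⟩ : ∃ k, (∃ L : Subalgebra ℚ D, PowIn L ∧ finrank ℚ L = k) ∧ 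
      ∀ k', (∃ L : Subalgebra ℚ D, PowIn L ∧ finrank ℚ L = k') → k ≤ k' := by
    have hex : ∃ k, ∃ L : Subalgebra ℚ D, PowIn L ∧ finrank ℚ L = k := ⟨_, L1, hL1, rfl⟩
    exact ⟨Nat.find hex, Nat.find_spec hex, fun k' h => Nat.find_min' hex h⟩
  have hle : ∀ L', PowIn L' → L ≤ L' := by
    intro L' hL'
    have h1 := hmin _ ⟨_, hL.inf hL', rfl⟩
    have h2 : Subalgebra.toSubmodule (L ⊓ L') = Subalgebra.toSubmodule L := by
      apply Submodule.eq_of_le_of_finrank_le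
      · exact (inf_le_left : L ⊓ L' ≤ L)
      · rw [← hk] at h1; exact h1
    have h3 : L ⊓ L' = L := Subalgebra.toSubmodule_injective h2
    rw [← h3]; exact inf_le_right
  have hcent : ∀ l ∈ L, ∀ x : D, x * l = l * x := by
    refine central_of_conj (fun a ha b hb => hL1c a (hle _ hL1 ha) b (hle _ hL1 hb)) ?_
    intro x hx l hl
    exact hle _ (hL.conj x hx) hl
  intro R hR u hu
  obtain ⟨M, hM, h⟩ := hL R hR u hu
  exact ⟨M, hM, hcent _ h⟩

end Central

section NT

open Module NumberField Polynomial

lemma places_inj {K M : Type} [Field K] [Field M] [NumberField M] [Algebra K M]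
    (h : ∀ u : (𝓞 M)ˣ, ∃ N : ℕ, N ≠ 0 ∧ ∃ k : K, algebraMap K M k = ((u : 𝓞 M) : M) ^ N)
    (σ τ : M →+* ℂ) (hστ : ∀ k : K, σ (algebraMap K M k) = τ (algebraMap K M k)) :
    σ = τ ∨ ∀ x, τ x = (starRingEnd ℂ) (σ x) := by
  have key : InfinitePlace.mk σ = InfinitePlace.mk τ := by
    by_contra hne
    have heq : ∀ u : (𝓞 M)ˣ, InfinitePlace.mk σ ((u : 𝓞 M) : M) = InfinitePlace.mk τ ((u : 𝓞 M) : M) := by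
      intro u
      obtain ⟨N, hN, k, hk⟩ := h u
      rw [InfinitePlace.apply, InfinitePlace.apply]
      refine (pow_left_inj₀ (norm_nonneg _) (norm_nonneg _) hN).mp ?_
      rw [← norm_pow, ← norm_pow, ← map_pow σ, ← map_pow τ, ← hk, hστ]
    obtain ⟨u, hu⟩ := Units.dirichletUnitTheorem.exists_unit M (InfinitePlace.mk σ)
    have h1 : ∀ w : InfinitePlace M, Real.log (w ((u : 𝓞 M) : M)) < 0 := by
      intro w
      by_cases hw : w = InfinitePlace.mk σ
      · rw [hw, heq]
        exact hu _ (Ne.symm hne)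
      · exact hu _ hw
    have h2 := Units.sum_mult_mul_log u
    have h3 : ∑ w : InfinitePlace M, (w.mult : ℝ) * Real.log (w ((u : 𝓞 M) : M)) < 0 := by
      apply Finset.sum_neg
      · intro w _
        exact mul_neg_of_pos_of_neg (by exact_mod_cast InfinitePlace.mult_pos) (h1 w)
      · exact Finset.univ_nonempty
    linarith
  rw [InfinitePlace.mk_eq_iff] at key
  rcases key with key | key
  · exact Or.inl key
  · right
    intro x
    rw [← key]; rfl

/-- the consequences for a nontrivial extension. -/
lemma cm_of_units {K M : Type} [Field K] [NumberField K] [Field M] [NumberField M] [Algebra K M]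
    (h : ∀ u : (𝓞 M)ˣ, ∃ N : ℕ, N ≠ 0 ∧ ∃ k : K, algebraMap K M k = ((u : 𝓞 M) : M) ^ N)
    (hne : 1 < finrank K M) : finrank K M = 2 ∧ (∀ σ : K →+* ℂ, ∀ x, (σ x).im = 0) ∧ 
      IsEmpty (M →+* ℝ) := by
  have : CharZero K := inferInstance
  have hfd : FiniteDimensional K M := FiniteDimensional.right ℚ K M
  have hcard : ∀ σ : K →+* ℂ, letI := σ.toAlgebra; Fintype.card (M →ₐ[K] ℂ) = finrank K M := by
    intro σ
    letI := σ.toAlgebra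
    exact AlgHom.card K M ℂ
  have hext : ∀ σ : K →+* ℂ, ∃ τ τ' : M →+* ℂ, τ ≠ τ' ∧ (∀ k, τ (algebraMap K M k) = σ k) ∧
      (∀ k, τ' (algebraMap K M k) = σ k) := by
    intro σ
    have h1 := hcard σ
    letI := σ.toAlgebra
    rw [← h1, Fintype.one_lt_card_iff] at hne
    obtain ⟨τ, τ', hττ⟩ := hne
    refine ⟨τ, τ', ?_, fun k => τ.commutes k, fun k => τ'.commutes k⟩
    intro hh
    apply hττ
    ext x
    exact RingHom.congr_fun hh x
  have hpair : ∀ τ τ' : M →+* ℂ, τ ≠ τ' → (∀ k : K, τ (algebraMap K M k) = τ' (algebraMap K M k)) → 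
      ∀ x, τ' x = (starRingEnd ℂ) (τ x) := by
    intro τ τ' hne hk
    exact (places_inj h τ τ' hk).resolve_left hne
  refine ⟨?_, ?_, ⟨?_⟩⟩
  · refine le_antisymm ?_ hne
    by_contra hlt
    push Not at hlt
    obtain ⟨σ⟩ : Nonempty (K →+* ℂ) := inferInstance
    have h1 := hcard σ
    letI := σ.toAlgebra
    rw [← h1, Fintype.two_lt_card_iff] at hlt
    obtain ⟨a, b, c, hab, hac, hbc⟩ := hlt
    apply hbc
    have e : ∀ f g : M →ₐ[K] ℂ, f ≠ g → ∀ x, g x = (starRingEnd ℂ) (f x) := by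
      intro f g hfg
      refine hpair f g ?_ (fun k => (f.commutes k).trans (g.commutes k).symm)
      intro hh; apply hfg; ext x; exact RingHom.congr_fun hh x
    ext x
    rw [e a b hab, e a c hac]
  · intro σ x
    obtain ⟨τ, τ', hne, h1, h2⟩ := hext σ
    have := hpair τ τ' hne (fun k => (h1 k).trans (h2 k).symm) (algebraMap K M x)
    rw [h1, h2] at this
    exact Complex.conj_eq_iff_im.mp this.symm
  · intro ρ
    let τ0 : M →+* ℂ := Complex.ofRealHom.comp ρ
    obtain ⟨τ, τ', hne, h1, h2⟩ := hext (τ0.comp (algebraMap K M))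
    have : ∀ τ : M →+* ℂ, (∀ k, τ (algebraMap K M k) = (τ0.comp (algebraMap K M)) k) → τ = τ0 := by
      intro τ h1
      by_contra hne
      have := hpair τ0 τ (Ne.symm hne) (fun k => (h1 k).symm)
      apply hne
      ext x
      rw [this]
      exact Complex.conj_ofReal _
    exact hne ((this τ h1).trans (this τ' h2).symm)

/-- Main consequences for elements of a division algebra. -/
lemma minpoly_division {K D : Type} [Field K] [NumberField K] [DivisionRing D] [Algebra K D]
    [FiniteDimensional K D]
    (hpow : ∀ R : Subring D, R.toAddSubgroup.FG → ∀ u ∈ unitGroup R, ∃ M : ℕ, M ≠ 0 ∧ 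
      ∃ k : K, algebraMap K D k = (u : D) ^ M) (y : D) (hy : ∀ k : K, y ≠ algebraMap K D k) :
    (minpoly K y).natDegree = 2 ∧ (∀ σ : K →+* ℂ, ∀ x, (σ x).im = 0) ∧
      ∀ (σ : K →+* ℝ) (r : ℝ), (minpoly K y).eval₂ σ r ≠ 0 := by
  have hint : IsIntegral K y := Algebra.IsIntegral.isIntegral y
  have hirr := minpoly.irreducible hint
  haveI : Fact (Irreducible (minpoly K y)) := ⟨hirr⟩
  let M := AdjoinRoot (minpoly K y)
  have hfr : finrank K M = (minpoly K y).natDegree := by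
    rw [(AdjoinRoot.powerBasis hirr.ne_zero).finrank, AdjoinRoot.powerBasis_dim]
  haveI : FiniteDimensional K M := (AdjoinRoot.powerBasis hirr.ne_zero).finite
  haveI : CharZero M := charZero_of_injective_algebraMap (algebraMap K M).injective
  haveI : FiniteDimensional ℚ M := FiniteDimensional.trans ℚ K M
  haveI : NumberField M := ⟨⟩
  let φ : M →+* D := Ideal.Quotient.lift (Ideal.span {minpoly K y}) (aeval y : K[X] →ₐ[K] D).toRingHom (by
    intro g hg
    obtain ⟨q, rfl⟩ := Ideal.mem_span_singleton.mp hg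
    simp)
  have hφ : ∀ k, φ (algebraMap K M k) = algebraMap K D k := by
    intro k
    change aeval y (C k) = _
    simp
  have hunits : ∀ u : (𝓞 M)ˣ, ∃ N : ℕ, N ≠ 0 ∧ ∃ k : K, algebraMap K M k = ((u : 𝓞 M) : M) ^ N := by
    intro u
    let ψ : 𝓞 M →+* D := φ.comp (algebraMap (𝓞 M) M)
    have hfg : ψ.range.toAddSubgroup.FG := by
      have h1 : (⊤ : AddSubgroup (𝓞 M)).FG := by
        have : AddGroup.FG (𝓞 M) := by
          rw [← Module.Finite.iff_addGroup_fg]; infer_instance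
        exact AddGroup.fg_def.mp this
      have h2 := addSubgroup_fg_map h1 (ψ : 𝓞 M →+ D)
      have h3 : ψ.range.toAddSubgroup = (⊤ : AddSubgroup (𝓞 M)).map (ψ : 𝓞 M →+ D) := by
        ext x
        constructor
        · rintro ⟨r, rfl⟩; exact ⟨r, trivial, rfl⟩
        · rintro ⟨r, -, rfl⟩; exact ⟨r, rfl⟩
      rw [h3]; exact h2
    obtain ⟨N, hN, k, hk⟩ := hpow ψ.range hfg (Units.map (ψ : 𝓞 M →* D) u) (by
      rw [mem_unitGroup]
      exact ⟨⟨_, rfl⟩, ⟨_, rfl⟩⟩)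
    refine ⟨N, hN, k, φ.injective ?_⟩
    rw [hφ, hk, map_pow]; rfl
  have hne : 1 < finrank K M := by
    rw [hfr]
    have h0 := minpoly.natDegree_pos hint
    by_contra hle
    have h1 : (minpoly K y).natDegree = 1 := by omega
    have h2 : (minpoly K y).degree = 1 := by
      rw [Polynomial.degree_eq_natDegree hirr.ne_zero, h1]; rfl
    obtain ⟨k, hk⟩ := minpoly.mem_range_of_degree_eq_one K y h2
    exact hy k hk.symm
  obtain ⟨h1, h2, h3⟩ := cm_of_units hunits hne
  refine ⟨hfr ▸ h1, h2, ?_⟩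
  intro σ r hr
  exact h3.false (AdjoinRoot.lift σ r hr)

end NT

section Quat

open Module Polynomial Quaternion

lemma sq_neg_of {K D : Type} [Field K] [NumberField K] [DivisionRing D] [Algebra K D]
    [FiniteDimensional K D] (y : D) (h2 : (minpoly K y).natDegree = 2)
    (h3 : ∀ (σ : K →+* ℝ) (r : ℝ), (minpoly K y).eval₂ σ r ≠ 0) (a : K) (ha : y * y = a • (1 : D))
    (σ : K →+* ℝ) : σ a < 0 := by
  have hm : minpoly K y = X ^ 2 - C a := by
    apply Polynomial.eq_of_dvd_of_natDegree_le_of_leadingCoeff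
    · apply minpoly.dvd
      rw [map_sub, map_pow, Polynomial.aeval_X, Polynomial.aeval_C, pow_two, ha, 
        Algebra.algebraMap_eq_smul_one, sub_self]
    · rw [h2, Polynomial.natDegree_X_pow_sub_C]
    · rw [(minpoly.monic (Algebra.IsIntegral.isIntegral y)).leadingCoeff, 
        (Polynomial.monic_X_pow_sub_C a two_ne_zero).leadingCoeff]
  by_contra hσ
  push Not at hσ
  apply h3 σ (Real.sqrt (σ a))
  rw [hm]
  simp [Real.sq_sqrt hσ]

lemma quad_eq {K D : Type} [Field K] [DivisionRing D] [Algebra K D]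
    [FiniteDimensional K D] (y : D) (h2 : (minpoly K y).natDegree = 2) :
    ∃ s t : K, y * y = s • y + t • (1 : D) := by
  have h := minpoly.aeval K y
  rw [Polynomial.aeval_eq_sum_range, h2, Finset.sum_range_succ, Finset.sum_range_succ, 
    Finset.sum_range_one] at h
  have hl : (minpoly K y).coeff 2 = 1 := by
    have := (minpoly.monic (Algebra.IsIntegral.isIntegral (R := K) y)).coeff_natDegree
    rwa [h2] at this
  rw [hl] at h
  refine ⟨-(minpoly K y).coeff 1, -(minpoly K y).coeff 0, ?_⟩
  simp only [pow_zero, pow_one, pow_two, one_smul] at h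
  rw [eq_neg_of_add_eq_zero_right h]
  module

/-- structure of the centralizer, given that all elements are quadratic. -/
lemma centralizer_quad {K D : Type} [Field K] [CharZero K] [DivisionRing D] [Algebra K D]
    (hq : ∀ d : D, ∃ s t : K, d * d = s • d + t • (1 : D))
    (y : D) (hy : ∀ k : K, y ≠ k • (1 : D)) (a : K) (ha : y * y = a • (1 : D)) (e : D) (he : e * y = y * e) :
    ∃ p q : K, e = p • (1 : D) + q • y := by
  obtain ⟨t, n, hen⟩ := hq e
  obtain ⟨s, m, hsm⟩ := hq (e + y)
  -- (e+y)^2 = e^2 + 2 y e + y^2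
  have h1 : (2 : K) • (y * e) + (t - s) • e = s • y + (m - n - a) • (1 : D) := by
    have : (e + y) * (e + y) = e * e + (2 : K) • (y * e) + y * y := by
      rw [add_mul, mul_add, mul_add, he, two_smul]; abel
    rw [this, hen, ha] at hsm
    have h2 : (2 : K) • (y * e) = s • (e + y) + m • (1 : D) - (t • e + n • (1 : D)) - a • (1 : D) := by
      rw [← hsm]; abel
    rw [h2]; module
  -- multiply by 2 y - (t - s)
  have h2 : (4 * a - (t - s) * (t - s)) • e = (2 * s * a - (t - s) * (m - n - a)) • (1 : D) + 
      (2 * (m - n - a) - (t - s) * s) • y := by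
    have h3 : ((2 : K) • y - (t - s) • (1 : D)) * ((2 : K) • (y * e) + (t - s) • e) = 
        (4 * a - (t - s) * (t - s)) • e := by
      simp only [sub_mul, mul_add, smul_mul_assoc, mul_smul_comm, ← mul_assoc, ha, one_mul]
      module
    rw [← h3, h1]
    simp only [sub_mul, mul_add, smul_mul_assoc, mul_smul_comm, ha, one_mul, mul_one]
    module
  have hne : 4 * a - (t - s) * (t - s) ≠ 0 := by
    intro h0
    have : ((2 : K) • y - (t - s) • (1 : D)) * ((2 : K) • y + (t - s) • (1 : D)) = 0 := by
      have : ((2 : K) • y - (t - s) • (1 : D)) * ((2 : K) • y + (t - s) • (1 : D)) = 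
        (4 * a - (t - s) * (t - s)) • (1 : D) := by
        simp only [sub_mul, mul_add, smul_mul_assoc, mul_smul_comm, ha, one_mul, mul_one]
        module
      rw [this, h0, zero_smul]
    rcases mul_eq_zero.mp this with h | h
    · apply hy ((2 : K)⁻¹ * (t - s))
      have := congrArg (fun d => (2 : K)⁻¹ • d) (sub_eq_zero.mp h)
      simp only [smul_smul] at this
      rwa [inv_mul_cancel₀ two_ne_zero, one_smul] at this
    · apply hy ((2 : K)⁻¹ * (-(t - s)))
      have := congrArg (fun d => (2 : K)⁻¹ • d) (eq_neg_of_add_eq_zero_left h)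
      simp only [smul_smul, ← neg_smul] at this
      rwa [inv_mul_cancel₀ two_ne_zero, one_smul] at this
  set c := 4 * a - (t - s) * (t - s) with hc
  refine ⟨c⁻¹ * (2 * s * a - (t - s) * (m - n - a)), c⁻¹ * (2 * (m - n - a) - (t - s) * s), ?_⟩
  have := congrArg (fun d => c⁻¹ • d) h2
  simp only [smul_smul, smul_add] at this
  rwa [inv_mul_cancel₀ hne, one_smul] at this

lemma quaternion_structure {K D : Type} [Field K] [CharZero K] [DivisionRing D] [Algebra K D]
    (hcent : ∀ d : D, (∀ x, d * x = x * d) → ∃ k : K, d = k • (1 : D))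
    (hq : ∀ d : D, ∃ s t : K, d * d = s • d + t • (1 : D)) (w₀ w₁ : D) (hw : w₀ * w₁ ≠ w₁ * w₀) :
    ∃ (y z : D) (a b : K), (∀ k : K, y ≠ k • (1 : D)) ∧ (∀ k : K, z ≠ k • (1 : D)) ∧ 
      y * y = a • (1 : D) ∧ z * z = b • (1 : D) ∧ Nonempty (D ≃+* ℍ[K, a, b]) := by
  have h20 : (2 : K) ≠ 0 := two_ne_zero
  obtain ⟨s, t, hst⟩ := hq w₀
  -- complete the square
  obtain ⟨y, hydef⟩ : ∃ y, y = w₀ - (s / 2) • (1 : D) := ⟨_, rfl⟩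
  have hyw : y * w₁ ≠ w₁ * y := by
    rw [hydef, sub_mul, mul_sub, smul_mul_assoc, mul_smul_comm, one_mul, mul_one]
    intro h
    exact hw (sub_left_injective h)
  have hy : ∀ k : K, y ≠ k • (1 : D) := by
    rintro k rfl
    apply hyw
    rw [smul_mul_assoc, mul_smul_comm, one_mul, mul_one]
  obtain ⟨a, ha⟩ : ∃ a : K, y * y = a • (1 : D) := by
    refine ⟨t + s ^ 2 / 4, ?_⟩
    rw [hydef]
    simp only [sub_mul, mul_sub, smul_mul_assoc, mul_smul_comm, one_mul, mul_one, hst]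
    match_scalars <;> field_simp <;> ring
  have hy0 : y ≠ 0 := by rintro rfl; exact hy 0 (by simp)
  have ha0 : a ≠ 0 := by
    rintro rfl
    rw [zero_smul] at ha
    exact hy0 (mul_self_eq_zero.mp ha)
  obtain ⟨z, hz⟩ : ∃ z, z = y * w₁ - w₁ * y := ⟨_, rfl⟩
  have hz0 : z ≠ 0 := by rw [hz]; exact sub_ne_zero.mpr hyw
  have hzy : z * y = - (y * z) := by
    rw [hz, sub_mul, mul_sub, mul_assoc w₁, ha, ← mul_assoc y y, ha]
    simp [mul_assoc]
  have hyz0 : y * z ≠ 0 := mul_ne_zero hy0 hz0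
  have htwo : ∀ d : D, d = -d → d = 0 := by
    intro d hd
    have : (2 : K) • d = 0 := by rw [two_smul]; nth_rewrite 1 [hd]; simp
    exact (smul_eq_zero.mp this).resolve_left h20
  have hzK : ∀ k : K, z ≠ k • (1 : D) := by
    intro k hk
    apply hyz0
    apply htwo
    rw [← hzy, hk, smul_mul_assoc, mul_smul_comm, one_mul, mul_one]
  obtain ⟨b, hb⟩ : ∃ b : K, z * z = b • (1 : D) := by
    obtain ⟨s, t, hst⟩ := hq z
    have h1 : z * z * y = y * (z * z) := by
      rw [mul_assoc, hzy, mul_neg, ← mul_assoc, hzy, neg_mul, neg_neg, mul_assoc]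
    rw [hst, add_mul, mul_add, smul_mul_assoc, mul_smul_comm, smul_mul_assoc, mul_smul_comm, one_mul, 
      mul_one, hzy] at h1
    have h2 : s • (y * z) = - (s • (y * z)) := by
      rw [← smul_neg]; exact (add_right_cancel h1).symm
    have h3 := (smul_eq_zero.mp (htwo _ h2)).resolve_right hyz0
    exact ⟨t, by rw [hst, h3, zero_smul, zero_add]⟩
  have hb0 : b ≠ 0 := by
    rintro rfl
    rw [zero_smul] at hb
    exact hz0 (mul_self_eq_zero.mp hb)
  have hcen := centralizer_quad hq y hy a ha
  let B : QuaternionAlgebra.Basis D a 0 b := 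
    { i := y, j := z, k := y * z, i_mul_i := by rw [ha, zero_smul, add_zero], j_mul_j := hb, 
      i_mul_j := rfl, j_mul_i := by rw [hzy, zero_smul, zero_sub] }
  have hlin : ∀ p q : K, p • (1 : D) + q • y = 0 → p = 0 ∧ q = 0 := by
    intro p q h
    have hq0 : q = 0 := by
      by_contra hq0
      apply hy (-(q⁻¹ * p))
      have : q • y = -(p • (1 : D)) := (eq_neg_of_add_eq_zero_right h)
      have := congrArg (fun d => q⁻¹ • d) this
      simp only [smul_smul, smul_neg, inv_mul_cancel₀ hq0, one_smul] at this
      rw [this, neg_smul]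
    subst hq0
    refine ⟨?_, rfl⟩
    rw [zero_smul, add_zero] at h
    exact (smul_eq_zero.mp h).resolve_right one_ne_zero
  refine ⟨y, z, a, b, hy, hzK, ha, hb, ⟨(RingEquiv.ofBijective B.liftHom.toRingHom ⟨?_, ?_⟩).symm⟩⟩
  · rw [injective_iff_map_eq_zero]
    intro x hx
    change B.lift x = 0 at hx
    simp only [QuaternionAlgebra.Basis.lift, B] at hx
    have hx' : (x.re • (1 : D) + x.imI • y) + (x.imJ • (1 : D) + x.imK • y) * z = 0 := by
      rw [← hx, Algebra.algebraMap_eq_smul_one, add_mul, smul_mul_assoc, smul_mul_assoc, one_mul]; abel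
    set P := x.re • (1 : D) + x.imI • y with hP
    set Q := x.imJ • (1 : D) + x.imK • y with hQ
    have hPy : P * y = y * P := by
      rw [hP]; simp only [add_mul, mul_add, smul_mul_assoc, mul_smul_comm, one_mul, mul_one]
    have hQy : Q * y = y * Q := by
      rw [hQ]; simp only [add_mul, mul_add, smul_mul_assoc, mul_smul_comm, one_mul, mul_one]
    have e1 : P * y - y * (Q * z) = 0 := by
      have : (P + Q * z) * y = 0 := by rw [hx', zero_mul]
      rw [add_mul, mul_assoc, hzy, mul_neg, ← mul_assoc, hQy, mul_assoc] at this
      rw [sub_eq_add_neg]; exact this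
    have e2 : P * y + y * (Q * z) = 0 := by
      rw [hPy, ← mul_add, hx', mul_zero]
    have e3 : P * y = 0 := by
      apply htwo
      rw [sub_eq_zero.mp e1] at e2 ⊢
      exact eq_neg_of_add_eq_zero_left e2
    have hP0 : P = 0 := (mul_eq_zero.mp e3).resolve_right hy0
    have hQ0 : Q = 0 := by
      rw [hP0, zero_add] at hx'
      exact (mul_eq_zero.mp hx').resolve_right hz0
    obtain ⟨r1, r2⟩ := hlin _ _ hP0
    obtain ⟨r3, r4⟩ := hlin _ _ hQ0
    ext <;> simp [r1, r2, r3, r4]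
  · intro d
    -- the commuting and anticommuting parts
    have c1 : (a • d + y * d * y) * y = y * (a • d + y * d * y) := by
      simp only [add_mul, mul_add, smul_mul_assoc, mul_smul_comm]
      rw [mul_assoc (y * d), ha, ← mul_assoc y (y * d), ← mul_assoc y y, ha]
      simp only [smul_mul_assoc, mul_smul_comm, one_mul, mul_one]
      rw [add_comm]
    have c2 : (a • d - y * d * y) * y = - (y * (a • d - y * d * y)) := by
      simp only [sub_mul, mul_sub, smul_mul_assoc, mul_smul_comm]
      rw [mul_assoc (y * d), ha, ← mul_assoc y (y * d), ← mul_assoc y y, ha]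
      simp only [smul_mul_assoc, mul_smul_comm, one_mul, mul_one]
      rw [neg_sub]
    have c3 : ((a • d - y * d * y) * z) * y = y * ((a • d - y * d * y) * z) := by
      rw [mul_assoc, hzy, mul_neg, ← mul_assoc, c2, neg_mul, neg_neg, mul_assoc]
    obtain ⟨p, q, h1⟩ := hcen _ c1
    obtain ⟨r, s, h2⟩ := hcen _ c3
    have h3 : b • (a • d - y * d * y) = r • z + s • (y * z) := by
      have := congrArg (fun d => d * z) h2
      simp only [add_mul, smul_mul_assoc, one_mul] at this
      rw [← this, mul_assoc _ z z, hb, mul_smul_comm, mul_one]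
    have h4 : (2 * a * b) • d = (b * p) • (1 : D) + (b * q) • y + (r • z + s • (y * z)) := by
      rw [← h3]
      have : (b * p) • (1 : D) + (b * q) • y = b • (a • d + y * d * y) := by
        rw [h1, smul_add, smul_smul, smul_smul]
      rw [this]; module
    refine ⟨⟨(2 * a * b)⁻¹ * (b * p), (2 * a * b)⁻¹ * (b * q), (2 * a * b)⁻¹ * r, (2 * a * b)⁻¹ * s⟩, ?_⟩
    change B.lift _ = d
    simp only [QuaternionAlgebra.Basis.lift, B, Algebra.algebraMap_eq_smul_one]
    have h5 := congrArg (fun d => (2 * a * b)⁻¹ • d) h4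
    simp only [smul_smul, smul_add] at h5
    rw [inv_mul_cancel₀ (mul_ne_zero (mul_ne_zero h20 ha0) hb0), one_smul] at h5
    rw [h5]; module

lemma division_case {D : Type} [DivisionRing D] [Algebra ℚ D] [FiniteDimensional ℚ D] {O : Subring D} 
    (hO : IsOrderIn O) (hd : Dich (unitGroup O)) : 
    (∀ x y : D, x * y = y * x) ∨ IsTotallyDefiniteQuaternionAlgebra D := by
  by_cases hc : ∀ x y : D, x * y = y * x
  · exact Or.inl hc
  right
  push Not at hc
  obtain ⟨w₀, w₁, hw⟩ := hc
  obtain ⟨V, -, hidx, hV⟩ := division_abelian hO hd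
  have hpow := units_pow_central hO hidx hV
  let K := Subring.center D
  have : CharZero D := algebraRat.charZero D
  have hsm : ∀ (q : ℚ) (d : D), q • d = (q : D) * d := fun q d => by
    rw [Algebra.smul_def, eq_ratCast]
  have hchar : CharZero K := ⟨fun a b h => by
    have := congrArg (fun x : ↥K => (x : D)) h
    simpa using this⟩
  have hfinK : FiniteDimensional ℚ K := by
    let f : K →ₗ[ℚ] D := 
      { toFun := fun k => (k : D), map_add' := fun _ _ => rfl, map_smul' := by
          intro q k
          rw [RingHom.id_apply, hsm, Rat.smul_def, Subring.coe_mul]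
          congr 1
          exact map_ratCast K.subtype q }
    exact FiniteDimensional.of_injective f Subtype.val_injective
  have hNF : NumberField K := ⟨⟩
  have hfin : FiniteDimensional K D := by
    have : IsScalarTower ℚ K D := by
      refine ⟨fun q k d => ?_⟩
      rw [hsm, Rat.smul_def]
      change ((((q : K) * k : K)) : D) * d = (q : D) * ((k : D) * d)
      rw [← mul_assoc, Subring.coe_mul]
      congr 2
      exact map_ratCast K.subtype q
    exact FiniteDimensional.right ℚ K D
  have hcent : ∀ d : D, (∀ x, x * d = d * x) → ∃ k : K, d = k • (1 : D) := by
    intro d hd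
    exact ⟨⟨d, Subring.mem_center_iff.mpr hd⟩, by
      change d = d * 1
      rw [mul_one]⟩
  have hpow' : ∀ R : Subring D, R.toAddSubgroup.FG → ∀ u ∈ unitGroup R, ∃ M : ℕ, M ≠ 0 ∧ 
      ∃ k : K, algebraMap K D k = (u : D) ^ M := by
    intro R hR u hu
    obtain ⟨M, hM, h⟩ := hpow R hR u hu
    obtain ⟨k, hk⟩ := hcent _ h
    exact ⟨M, hM, k, by rw [hk, Algebra.algebraMap_eq_smul_one]⟩
  have hmin := minpoly_division hpow'
  simp only [Algebra.algebraMap_eq_smul_one] at hmin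
  have hq : ∀ d : D, ∃ s t : K, d * d = s • d + t • (1 : D) := by
    intro d
    by_cases hk : ∃ k : K, d = k • (1 : D)
    · obtain ⟨k, rfl⟩ := hk
      exact ⟨k, 0, by rw [smul_mul_assoc, one_mul, zero_smul, add_zero]⟩
    · push Not at hk
      exact quad_eq d (hmin d hk).1
  obtain ⟨y, z, a, b, hy, hz, ha, hb, ⟨e⟩⟩ := quaternion_structure 
    (fun d hd => hcent d fun x => (hd x).symm) hq w₀ w₁ hw
  obtain ⟨y1, y2, y3⟩ := hmin y hy
  obtain ⟨z1, -, z3⟩ := hmin z hz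
  refine ⟨K, inferInstance, inferInstance, hfinK, y2, a, b, ?_, ?_, ?_, ⟨e⟩⟩
  · rintro rfl
    rw [zero_smul] at ha
    exact hy 0 (by rw [zero_smul]; exact mul_self_eq_zero.mp ha)
  · rintro rfl
    rw [zero_smul] at hb
    exact hz 0 (by rw [zero_smul]; exact mul_self_eq_zero.mp hb)
  · exact fun σ => ⟨sq_neg_of y y1 y3 a ha σ, sq_neg_of z z1 z3 b hb σ⟩

end Quat

section Fwd

lemma forward_dir {n : ℕ} {A : Fin n → Type} [∀ i, Ring (A i)] [∀ i, Algebra ℚ (A i)]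
    [∀ i, FiniteDimensional ℚ (A i)] (hsimple : ∀ i, IsSimpleRing (A i))
    {S : Subring (∀ i, A i)} (hS : IsOrderIn S) 
    (hV : IsVirtuallyDirectProductOfFreeGroups (↥S)ˣ) (i : Fin n) :
    (∀ x y : A i, x * y = y * x) ∨ IsTotallyDefiniteQuaternionAlgebra (A i) ∨
        Nonempty (A i ≃+* Matrix (Fin 2) (Fin 2) ℚ) := by
  have h := dich_of_vp hS hV i
  have := hsimple i
  have : IsArtinianRing (A i) := IsArtinianRing.of_finite ℚ (A i)
  obtain ⟨r, hr, D, _, _, hfin, ⟨e⟩⟩ := IsSimpleRing.exists_algEquiv_matrix_divisionRing_finite ℚ (A i)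
  by_cases hr2 : 2 ≤ r
  · right; right
    obtain ⟨O, hO, hd⟩ := isOrderIn_equiv e.toRingEquiv h
    obtain ⟨rfl, hq⟩ := matrix_case hr2 hO hd
    have hbij : Function.Bijective (algebraMap ℚ D) := 
      ⟨(algebraMap ℚ D).injective, fun y => by obtain ⟨q, hq⟩ := hq y; exact ⟨q, hq.symm⟩⟩
    exact ⟨e.toRingEquiv.trans (RingEquiv.ofBijective (algebraMap ℚ D) hbij).symm.mapMatrix⟩
  · have hr1 : r = 1 := by have := hr.out; omega
    subst hr1
    let e' : A i ≃+* D := e.toRingEquiv.trans (Matrix.uniqueRingEquiv (m := Fin 1) (A := D))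
    obtain ⟨O, hO, hd⟩ := isOrderIn_equiv e' h
    rcases division_case hO hd with hc | ⟨K, f1, f2, f3, f4, a, b, ha, hb, hab, ⟨g⟩⟩
    · left
      intro x y
      apply e'.injective
      rw [map_mul, hc, map_mul]
    · exact Or.inr (Or.inl ⟨K, f1, f2, f3, f4, a, b, ha, hb, hab, ⟨e'.trans g⟩⟩)

end Fwd

section VPs

/-- `V` contains a finite index subgroup that is a finite product of free groups. -/
def VPs {Q : Type} [Group Q] (V : Subgroup Q) : Prop :=
  ∃ (ι : Type) (_ : Finite ι) (X : ι → Type) (φ : (∀ j, FreeGroup (X j)) →* Q), Function.Injective φ ∧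
    φ.range ≤ V ∧ φ.range.relIndex V ≠ 0

lemma VPs.comm {Q : Type} [Group Q] {V W : Subgroup Q} (h : VPs V) (h1 : W.relIndex V ≠ 0) 
    (h2 : V.relIndex W ≠ 0) : VPs W := by
  classical
  obtain ⟨ι, _, X, φ, hφ, hle, hidx⟩ := h
  let s : ∀ j, FreeGroup (X j) →* Q := fun j => φ.comp (MonoidHom.mulSingle (fun j => FreeGroup (X j)) j)
  let K : ∀ j, Subgroup (FreeGroup (X j)) := fun j => W.comap (s j)
  have hK : ∀ j, (K j).FiniteIndex := by
    intro j
    constructor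
    rw [Subgroup.index_comap]
    refine fun h0 => h1 (Subgroup.relIndex_eq_zero_of_le_right ?_ h0)
    rintro _ ⟨f, rfl⟩
    exact hle ⟨_, rfl⟩
  let e : ∀ j, K j ≃* FreeGroup (IsFreeGroup.Generators (K j)) := fun j => IsFreeGroup.toFreeGroup (K j)
  let ψ : (∀ j, FreeGroup (IsFreeGroup.Generators (K j))) →* (∀ j, FreeGroup (X j)) := 
    MonoidHom.piMap (fun j => (K j).subtype.comp (e j).symm.toMonoidHom)
  have hψ : ∀ p j, ψ p j = ((e j).symm (p j) : FreeGroup (X j)) := fun p j => rfl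
  have hψi : Function.Injective ψ := by
    intro p q hpq
    ext1 j
    have := congrFun hpq j
    rw [hψ, hψ] at this
    exact (e j).symm.injective (Subtype.val_injective this)
  have hψr : ψ.range = ⨅ j, (K j).comap (Pi.evalMonoidHom _ j) := by
    ext p
    simp only [Subgroup.mem_iInf, Subgroup.mem_comap]
    constructor
    · rintro ⟨q, rfl⟩ j
      exact ((e j).symm (q j)).2
    · intro hp
      refine ⟨fun j => e j ⟨p j, hp j⟩, ?_⟩
      ext1 j
      rw [hψ, MulEquiv.symm_apply_apply]
  have hψf : ψ.range.FiniteIndex := by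
    rw [hψr]
    exact Subgroup.finiteIndex_iInf fun j => by
      have := hK j
      exact finiteIndex_comap _ (hK j)
  refine ⟨ι, inferInstance, _, φ.comp ψ, hφ.comp hψi, ?_, ?_⟩
  · rintro _ ⟨p, rfl⟩
    have : ψ p ∈ W.comap φ := by
      apply Subgroup.pi_mem_of_mulSingle_mem
      intro j
      exact ((e j).symm (p j)).2
    exact this
  · refine Subgroup.relIndex_ne_zero_trans ?_ h2
    refine Subgroup.relIndex_ne_zero_trans ?_ hidx
    have e1 : (φ.comp ψ).range = ψ.range.map φ := MonoidHom.range_comp _ _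
    have e2 : φ.range = (⊤ : Subgroup _).map φ := MonoidHom.range_eq_map φ
    rw [e1, e2, Subgroup.relIndex_map_map_of_injective _ _ hφ, Subgroup.relIndex_top_right]
    exact hψf.index_ne_zero

lemma VPs.map {Q Q' : Type} [Group Q] [Group Q'] {V : Subgroup Q} (h : VPs V) (f : Q →* Q')
    (hf : Function.Injective f) : VPs (V.map f) := by
  obtain ⟨ι, _, X, φ, hφ, hle, hidx⟩ := h
  refine ⟨ι, inferInstance, X, f.comp φ, hf.comp hφ, ?_, ?_⟩
  · rw [MonoidHom.range_comp]; exact Subgroup.map_mono hle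
  · rw [MonoidHom.range_comp, Subgroup.relIndex_map_map_of_injective _ _ hf]; exact hidx

lemma relIndex_pi {ι : Type} [Finite ι] {Q : ι → Type} [∀ i, Group (Q i)] {V W : ∀ i, Subgroup (Q i)}
    (h : ∀ i, (W i).relIndex (V i) ≠ 0) : 
    (Subgroup.pi Set.univ W).relIndex (Subgroup.pi Set.univ V) ≠ 0 := by
  have : Subgroup.pi Set.univ W = ⨅ i, (W i).comap (Pi.evalMonoidHom _ i) := by
    ext p
    simp [Subgroup.mem_pi, Subgroup.mem_iInf]
  rw [this]
  apply Subgroup.relIndex_iInf_ne_zero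
  intro i
  rw [Subgroup.relIndex_comap]
  refine fun h0 => h i (Subgroup.relIndex_eq_zero_of_le_right ?_ h0)
  rintro _ ⟨p, hp, rfl⟩
  exact hp i trivial

lemma VPs.pi {ι : Type} [Finite ι] {Q : ι → Type} [∀ i, Group (Q i)] {V : ∀ i, Subgroup (Q i)}
    (h : ∀ i, VPs (V i)) : VPs (Subgroup.pi Set.univ V) := by
  choose κ hκ X φ hφ hle hidx using h
  let Φ : (∀ k : Σ i, κ i, FreeGroup (X k.1 k.2)) →* ∀ i, Q i := 
    { toFun := fun p i => φ i (fun j => p ⟨i, j⟩)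
      map_one' := by ext i; exact map_one (φ i)
      map_mul' := fun p q => by ext i; exact map_mul (φ i) (fun j => p ⟨i, j⟩) (fun j => q ⟨i, j⟩) }
  refine ⟨Σ i, κ i, inferInstance, _, Φ, ?_, ?_, ?_⟩
  · intro p q hpq
    ext1 k
    obtain ⟨i, j⟩ := k
    exact congrFun (hφ i (congrFun hpq i)) j
  · rintro _ ⟨p, rfl⟩ i -
    exact hle i ⟨_, rfl⟩
  · have : Φ.range = Subgroup.pi Set.univ (fun i => (φ i).range) := by
      ext q
      constructor
      · rintro ⟨p, rfl⟩ i -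
        exact ⟨_, rfl⟩
      · intro hq
        choose p hp using fun i => hq i trivial
        exact ⟨fun k => p k.1 k.2, by ext1 i; exact hp i⟩
    rw [this]
    exact relIndex_pi hidx

lemma vp_of_vps {G Q : Type} [Group G] [Group Q] (f : G →* Q) (hf : Function.Injective f) (h : VPs f.range) :
    IsVirtuallyDirectProductOfFreeGroups G := by
  obtain ⟨ι, _, X, φ, hφ, hle, hidx⟩ := h
  obtain ⟨m, ⟨e⟩⟩ := Finite.exists_equiv_fin ι
  have hmap : (φ.range.comap f).map f = φ.range := Subgroup.map_comap_eq_self hle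
  refine ⟨φ.range.comap f, ⟨?_⟩, m, fun j => X (e.symm j), ⟨?_⟩⟩
  · rw [Subgroup.index_comap]; exact hidx
  · let e1 : φ.range.comap f ≃* φ.range := 
      ((φ.range.comap f).equivMapOfInjective f hf).trans (MulEquiv.subgroupCongr hmap)
    let e2 : (∀ j, FreeGroup (X j)) ≃* φ.range := MonoidHom.ofInjective hφ
    let e3 : (∀ j, FreeGroup (X j)) ≃* (∀ j : Fin m, FreeGroup (X (e.symm j))) := 
      { Equiv.piCongrLeft' (fun j => FreeGroup (X j)) e with map_mul' := fun _ _ => rfl }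
    exact (e1.trans e2.symm).trans e3

lemma vps_of_fg {G Q : Type} [CommGroup G] [Group Q] [Group.FG G] (f : G →* Q) (hf : Function.Injective f) :
    VPs f.range := by
  obtain ⟨ι, j, _, _, p, hp, e, ⟨E⟩⟩ := CommGroup.equiv_free_prod_prod_multiplicative_zmod G
  have : ∀ i, NeZero (p i ^ e i) := fun i => ⟨pow_ne_zero _ (hp i).ne_zero⟩
  have hfin : Finite ((i : ι) → Multiplicative (ZMod (p i ^ e i))) := by
    have : ∀ i, Finite (Multiplicative (ZMod (p i ^ e i))) := fun i => 
      inferInstanceAs (Finite (ZMod (p i ^ e i)))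
    infer_instance
  let φ0 : (j → FreeGroup Unit) →* (j → Multiplicative ℤ) := 
    MonoidHom.piMap (fun _ => (FreeGroup.mulEquivIntOfUnique (α := Unit)).toMonoidHom)
  have hφ0 : Function.Bijective φ0 := by
    constructor
    · intro a b hab
      ext1 k
      exact (FreeGroup.mulEquivIntOfUnique (α := Unit)).injective (congrFun hab k)
    · intro a
      refine ⟨fun k => (FreeGroup.mulEquivIntOfUnique (α := Unit)).symm (a k), ?_⟩
      ext1 k
      exact (FreeGroup.mulEquivIntOfUnique (α := Unit)).apply_symm_apply _
  let T := (i : ι) → Multiplicative (ZMod (p i ^ e i))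
  let φ1 : (j → FreeGroup Unit) →* G := E.symm.toMonoidHom.comp ((MonoidHom.inl _ T).comp φ0)
  have hφ1 : Function.Injective φ1 := by
    intro a b hab
    apply hφ0.injective
    have h := E.symm.injective (show E.symm (φ0 a, (1 : T)) = E.symm (φ0 b, 1) from hab)
    exact congrArg Prod.fst h
  have hfi : φ1.range.FiniteIndex := by
    refine finiteIndex_of_map _ (fun u => (E u).2) ?_
    intro u v huv
    obtain ⟨a, ha⟩ := hφ0.surjective (E (u⁻¹ * v)).1
    refine ⟨a, ?_⟩
    change E.symm (φ0 a, 1) = _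
    rw [MulEquiv.symm_apply_eq, ha]
    refine Prod.ext rfl ?_
    simp only [map_mul, map_inv, Prod.snd_mul, Prod.snd_inv]
    rw [huv, inv_mul_cancel]
  refine ⟨j, inferInstance, fun _ => Unit, f.comp φ1, hf.comp hφ1, ?_, ?_⟩
  · rintro _ ⟨a, rfl⟩; exact ⟨_, rfl⟩
  · have e1 : (f.comp φ1).range = φ1.range.map f := MonoidHom.range_comp _ _
    have e2 : f.range = (⊤ : Subgroup _).map f := MonoidHom.range_eq_map f
    rw [e1, e2, Subgroup.relIndex_map_map_of_injective _ _ hf, Subgroup.relIndex_top_right]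
    exact hfi.index_ne_zero

lemma vps_unitGroup {A B : Type} [Ring A] [Algebra ℚ A] [Ring B] [Algebra ℚ B] (e : B ≃+* A)
    (h : ∃ O : Subring B, IsOrderIn O ∧ VPs (unitGroup O)) {O : Subring A} (hO : IsOrderIn O) :
    VPs (unitGroup O) := by
  obtain ⟨O', h1, h2⟩ := h
  have h3 : IsOrderIn (O'.map e.toRingHom) := isOrderIn_map h1 _ e.surjective
  have h4 : VPs (unitGroup (O'.map e.toRingHom)) := by
    have := h2.map (Units.mapEquiv e.toMulEquiv).toMonoidHom (Units.mapEquiv e.toMulEquiv).injective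
    convert this using 1
    ext u
    rw [mem_unitGroup]
    constructor
    · rintro ⟨⟨x, hx, hxu⟩, ⟨y, hy, hyu⟩⟩
      refine ⟨(Units.mapEquiv e.toMulEquiv).symm u, ?_, (Units.mapEquiv e.toMulEquiv).apply_symm_apply u⟩
      refine (mem_unitGroup O' _).mpr ⟨?_, ?_⟩
      · change e.symm (u : A) ∈ O'
        rw [← hxu]
        change e.symm (e x) ∈ O'
        rwa [e.symm_apply_apply]
      · change e.symm ((u⁻¹ : Aˣ) : A) ∈ O'
        rw [← hyu]
        change e.symm (e y) ∈ O'
        rwa [e.symm_apply_apply]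
    · rintro ⟨v, hv, rfl⟩
      have hv' := (mem_unitGroup O' _).mp hv
      exact ⟨⟨_, hv'.1, rfl⟩, ⟨_, hv'.2, rfl⟩⟩
  refine h4.comm ?_ ?_
  · exact relIndex_unitGroup hO h3.1 (MonoidHom.id Aˣ) (AddMonoidHom.id A) (fun u => by simp)
  · exact relIndex_unitGroup h3 hO.1 (MonoidHom.id Aˣ) (AddMonoidHom.id A) (fun u => by simp)

lemma backward_assembly {n : ℕ} {A : Fin n → Type} [∀ i, Ring (A i)] [∀ i, Algebra ℚ (A i)]
    {S : Subring (∀ i, A i)} (hS : IsOrderIn S) 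
    (h : ∀ (i : Fin n) (O : Subring (A i)), IsOrderIn O → VPs (unitGroup O)) : 
    IsVirtuallyDirectProductOfFreeGroups (↥S)ˣ := by
  classical
  refine vp_of_vps (unitsToPi S) (unitsToPi_injective S) ?_
  have hO : ∀ i, IsOrderIn (S.map (Pi.evalRingHom A i)) := fun i =>
    isOrderIn_map hS _ (Function.surjective_eval i)
  have h1 := VPs.pi (fun i => h i _ (hO i))
  have hle : (unitsToPi S).range ≤ Subgroup.pi Set.univ (fun i => unitGroup (S.map (Pi.evalRingHom A i))) := by
    rintro _ ⟨u, rfl⟩ i -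
    refine (mem_unitGroup _ _).mpr ⟨⟨_, u.1.2, rfl⟩, ?_⟩
    rw [← Pi.inv_apply, ← map_inv]
    exact ⟨_, (u⁻¹).1.2, rfl⟩
  refine h1.comm ?_ ?_
  · have h2 := relIndex_pi (fun i => relIndex_single hS i (hO i).1)
    refine fun h0 => h2 (Subgroup.relIndex_eq_zero_of_le_left ?_ h0)
    intro v hv
    apply Subgroup.pi_mem_of_mulSingle_mem
    intro i
    exact hv i trivial
  · rw [Subgroup.relIndex_eq_one.mpr hle]; exact one_ne_zero

end VPs

open NumberField in
lemma numberField_of (K : Type) [Field K] [Algebra ℚ K] [FiniteDimensional ℚ K] : NumberField K := by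
  have : CharZero K := algebraRat.charZero K
  refine { to_charZero := this, to_finiteDimensional := ?_ }
  convert (inferInstance : FiniteDimensional ℚ K)
  exact Subsingleton.elim _ _

open NumberField in
lemma exists_nat_integral (K : Type) [Field K] [NumberField K] (x : K) :
    ∃ (c : ℕ) (y : 𝓞 K), c ≠ 0 ∧ (c : K) * x = y := by
  have hx : IsAlgebraic ℤ x := by
    have : IsAlgebraic ℚ x := Algebra.IsAlgebraic.isAlgebraic x
    exact (IsFractionRing.isAlgebraic_iff ℤ ℚ K).2 this
  obtain ⟨d, hd, h⟩ := hx.exists_integral_multiple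
  refine ⟨d.natAbs ^ 2, ⟨_, h.smul d⟩, by simpa using hd, ?_⟩
  change _ = d • d • x
  simp only [zsmul_eq_mul, ← mul_assoc, ← sq]
  congr 1
  rw [← Int.cast_pow, ← Int.natAbs_sq, ← Int.cast_natCast (R := K)]
  norm_cast

open NumberField in
/-- The ring of integers as a subring of the field. -/
def intSub (K : Type) [Field K] : Subring K := (algebraMap (𝓞 K) K).range

open NumberField in
lemma mem_intSub {K : Type} [Field K] {x : K} : x ∈ intSub K ↔ IsIntegral ℤ x := by
  constructor
  · rintro ⟨y, rfl⟩; exact y.2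
  · intro h; exact ⟨⟨x, h⟩, rfl⟩

open NumberField in
lemma intSub_fg (K : Type) [Field K] [NumberField K] : (intSub K).toAddSubgroup.FG := by
  have h : (⊤ : AddSubgroup (𝓞 K)).FG := by
    rw [← AddGroup.fg_def, ← Module.Finite.iff_addGroup_fg]; infer_instance
  have := addSubgroup_fg_map h (algebraMap (𝓞 K) K).toAddMonoidHom
  have e : (intSub K).toAddSubgroup = (⊤ : AddSubgroup (𝓞 K)).map (algebraMap (𝓞 K) K).toAddMonoidHom := by
    ext x
    constructor
    · rintro ⟨y, rfl⟩; exact ⟨y, trivial, rfl⟩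
    · rintro ⟨y, -, rfl⟩; exact ⟨y, rfl⟩
  rw [e]
  exact this

open NumberField in
lemma intSub_isOrder (K : Type) [Field K] [Algebra ℚ K] [FiniteDimensional ℚ K] : IsOrderIn (intSub K) := by
  have := numberField_of K
  refine ⟨intSub_fg K, ?_⟩
  rw [eq_top_iff]
  intro x _
  obtain ⟨c, y, hc, hy⟩ := exists_nat_integral K x
  have : x = (c : ℚ)⁻¹ • (y : K) := by
    rw [← hy, Algebra.smul_def]
    simp [hc]
  rw [this]
  exact Submodule.smul_mem _ _ (Submodule.subset_span ⟨y, rfl⟩)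

open NumberField in
/-- The embedding of units. -/
def uMap (K : Type) [Field K] : (𝓞 K)ˣ →* Kˣ := Units.map (algebraMap (𝓞 K) K).toMonoidHom

open NumberField in
lemma uMap_inj (K : Type) [Field K] : Function.Injective (uMap K) := by
  intro a b h
  ext
  exact congrArg Units.val h

open NumberField in
lemma uMap_range (K : Type) [Field K] : (uMap K).range = unitGroup (intSub K) := by
  ext u
  rw [mem_unitGroup]
  constructor
  · rintro ⟨v, rfl⟩
    exact ⟨⟨v, rfl⟩, ⟨(v⁻¹ : (𝓞 K)ˣ), rfl⟩⟩
  · rintro ⟨⟨x, hx⟩, ⟨y, hy⟩⟩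
    refine ⟨⟨x, y, ?_, ?_⟩, Units.ext hx⟩ <;> apply FaithfulSMul.algebraMap_injective (𝓞 K) K
    · rw [map_mul, hx, hy]; simp
    · rw [map_mul, hx, hy]; simp

open NumberField in
lemma units_fg (K : Type) [Field K] [NumberField K] : Group.FG (𝓞 K)ˣ :=
  Group.fg_iff_monoid_fg.2 inferInstance

lemma vps_field (K : Type) [Field K] [Algebra ℚ K] [FiniteDimensional ℚ K] :
    ∃ O : Subring K, IsOrderIn O ∧ VPs (unitGroup O) := by
  have := numberField_of K
  have := units_fg K
  refine ⟨intSub K, intSub_isOrder K, ?_⟩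
  rw [← uMap_range]
  exact vps_of_fg _ (uMap_inj K)

lemma vps_comm_simple {A : Type} [Ring A] [Algebra ℚ A] [FiniteDimensional ℚ A] (hs : IsSimpleRing A)
    (hc : ∀ x y : A, x * y = y * x) {O : Subring A} (hO : IsOrderIn O) : VPs (unitGroup O) := by
  let C : CommRing A := { (inferInstance : Ring A) with mul_comm := hc }
  have hF : IsField A := isSimpleRing_iff_isField A |>.1 hs
  let F : Field A := hF.toField
  have h1 : F.toDivisionRing.toRing = (inferInstance : Ring A) := rfl
  exact vps_unitGroup (RingEquiv.refl A) (vps_field A) hO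

section TDQ
open NumberField
variable {K : Type} [Field K]

/-- Reduced norm. -/
def nrdQ (a b : K) : ℍ[K, a, b] →* K where
  toFun x := x.re ^ 2 - a * x.imI ^ 2 - b * x.imJ ^ 2 + a * b * x.imK ^ 2
  map_one' := by simp
  map_mul' x y := by
    simp only [QuaternionAlgebra.re_mul, QuaternionAlgebra.imI_mul, QuaternionAlgebra.imJ_mul,
      QuaternionAlgebra.imK_mul]
    ring

/-- The quaternion order. -/
def qOrd (a b : K) (c : ℕ) (α β : 𝓞 K) (hα : (c : K) * a = algebraMap (𝓞 K) K α) (hβ : (c : K) * b = algebraMap (𝓞 K) K β) : Subring ℍ[K, a, b] where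
  carrier := {x | ∃ p q r s : 𝓞 K, x = ⟨p, c * q, c * r, c ^ 2 * s⟩}
  mul_mem' := by
    rintro _ _ ⟨p, q, r, s, rfl⟩ ⟨p', q', r', s', rfl⟩
    refine ⟨p * p' + c * α * (q * q') + c * β * (r * r') - α * β * c ^ 2 * (s * s'),
      p * q' + q * p' - β * c * (r * s') + β * c * (s * r'), 
      p * r' + α * c * (q * s') + r * p' - α * c * (s * q'), 
      p * s' + q * r' - r * q' + s * p', ?_⟩
    ext <;> simp [← hα, ← hβ, RingOfIntegers.coe_eq_algebraMap] <;> ring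
  one_mem' := ⟨1, 0, 0, 0, by ext <;> simp⟩
  add_mem' := by
    rintro _ _ ⟨p, q, r, s, rfl⟩ ⟨p', q', r', s', rfl⟩
    refine ⟨p + p', q + q', r + r', s + s', ?_⟩
    ext <;> simp <;> ring
  zero_mem' := ⟨0, 0, 0, 0, by ext <;> simp⟩
  neg_mem' := by
    rintro _ ⟨p, q, r, s, rfl⟩
    refine ⟨-p, -q, -r, -s, ?_⟩
    ext <;> simp

lemma mem_qOrd {a b : K} {c : ℕ} {α β : 𝓞 K} {hα : (c : K) * a = algebraMap (𝓞 K) K α} {hβ : (c : K) * b = algebraMap (𝓞 K) K β} {x : ℍ[K, a, b]} :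
    x ∈ qOrd a b c α β hα hβ ↔ ∃ p q r s : 𝓞 K, x = ⟨p, c * q, c * r, c ^ 2 * s⟩ := Iff.rfl

lemma qOrd_isOrder [Algebra ℚ K] [FiniteDimensional ℚ K] (a b : K) {c : ℕ} (hc : c ≠ 0) (α β : 𝓞 K) (hα : (c : K) * a = algebraMap (𝓞 K) K α) (hβ : (c : K) * b = algebraMap (𝓞 K) K β) :
    IsOrderIn (qOrd a b c α β hα hβ) := by
  have := numberField_of K
  constructor
  · have h : (⊤ : AddSubgroup (Fin 4 → 𝓞 K)).FG := by
      rw [← AddGroup.fg_def, ← Module.Finite.iff_addGroup_fg]; infer_instance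
    let f : (Fin 4 → 𝓞 K) →+ ℍ[K, a, b] := 
      { toFun := fun v => ⟨v 0, c * v 1, c * v 2, c ^ 2 * v 3⟩
        map_zero' := by ext <;> simp
        map_add' := fun v w => by ext <;> simp <;> ring }
    have := addSubgroup_fg_map h f
    have e : (qOrd a b c α β hα hβ).toAddSubgroup = (⊤ : AddSubgroup (Fin 4 → 𝓞 K)).map f := by
      ext x
      constructor
      · rintro ⟨p, q, r, s, rfl⟩; exact ⟨![p, q, r, s], trivial, rfl⟩
      · rintro ⟨y, -, rfl⟩; exact ⟨y 0, y 1, y 2, y 3, rfl⟩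
    rw [e]
    exact this
  · rw [eq_top_iff]
    intro x _
    obtain ⟨d1, y1, hd1, hy1⟩ := exists_nat_integral K x.re
    obtain ⟨d2, y2, hd2, hy2⟩ := exists_nat_integral K x.imI
    obtain ⟨d3, y3, hd3, hy3⟩ := exists_nat_integral K x.imJ
    obtain ⟨d4, y4, hd4, hy4⟩ := exists_nat_integral K x.imK
    let N : ℕ := c ^ 2 * d1 * d2 * d3 * d4
    have hN : N ≠ 0 := by positivity
    have hN' : (N : K) = c ^ 2 * d1 * d2 * d3 * d4 := by simp [N]
    let z : ℍ[K, a, b] := ⟨N * x.re, N * x.imI, N * x.imJ, N * x.imK⟩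
    have hz : z ∈ qOrd a b c α β hα hβ := by
      refine ⟨c ^ 2 * d2 * d3 * d4 * y1, c * d1 * d3 * d4 * y2, c * d1 * d2 * d4 * y3, d1 * d2 * d3 * y4, ?_⟩
      ext <;> simp [z, hN', ← hy1, ← hy2, ← hy3, ← hy4] <;> ring
    have : x = (N : ℚ)⁻¹ • z := by
      have hNK : (N : K) ≠ 0 := by exact_mod_cast hN
      ext <;> simp only [QuaternionAlgebra.re_smul, QuaternionAlgebra.imI_smul, QuaternionAlgebra.imJ_smul, QuaternionAlgebra.imK_smul, z] <;> rw [Algebra.smul_def] <;> simp <;> field_simp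
    rw [this]
    exact Submodule.smul_mem _ _ (Submodule.subset_span hz)

lemma finite_coord [NumberField K] (hreal : ∀ σ : K →+* ℂ, ∀ x : K, (σ x).im = 0) (t e : K) (ht : ∀ σ : K →+* ℝ, 0 < σ t) :
    {y : K | IsIntegral ℤ y ∧ ∀ σ : K →+* ℝ, σ t * (σ y) ^ 2 ≤ σ e}.Finite := by
  let R : (K →+* ℂ) → (K →+* ℝ) := fun σ =>
    { toFun := fun x => (σ x).re
      map_one' := by simp
      map_zero' := by simp
      map_add' := by simp
      map_mul' := fun x y => by simp [hreal] }
  have hR : ∀ σ x, ‖σ x‖ = |R σ x| := by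
    intro σ x
    exact (Complex.abs_re_eq_norm.2 (hreal σ x)).symm
  obtain ⟨B, hB⟩ := (Set.finite_range (fun σ : K →+* ℂ => 1 + R σ e / R σ t)).bddAbove
  refine (Embeddings.finite_of_norm_le K ℂ B).subset ?_
  rintro y ⟨hy, h⟩
  refine ⟨hy, fun σ => le_trans ?_ (hB ⟨σ, rfl⟩)⟩
  rw [hR]
  have h1 := h (R σ)
  have h2 : (R σ y) ^ 2 ≤ R σ e / R σ t := by
    rw [le_div_iff₀ (ht _)]; linarith
  have : (|R σ y|) ^ 2 = (R σ y) ^ 2 := sq_abs _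
  nlinarith [sq_nonneg (|R σ y| - 1), abs_nonneg (R σ y)]

lemma finite_nrd [NumberField K] (hreal : ∀ σ : K →+* ℂ, ∀ x : K, (σ x).im = 0) {a b : K}
    (hab : ∀ σ : K →+* ℝ, σ a < 0 ∧ σ b < 0) (c : ℕ) (α β : 𝓞 K) (hα : (c : K) * a = algebraMap (𝓞 K) K α) (hβ : (c : K) * b = algebraMap (𝓞 K) K β) (e : K) :
    {x : ℍ[K, a, b] | x ∈ qOrd a b c α β hα hβ ∧ nrdQ a b x = e}.Finite := by
  have h1 := finite_coord hreal 1 e (fun σ => by simp)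
  have h2 := finite_coord hreal (-a) e (fun σ => by simpa using (hab σ).1)
  have h3 := finite_coord hreal (-b) e (fun σ => by simpa using (hab σ).2)
  have h4 := finite_coord hreal (a * b) e (fun σ => by simpa using mul_pos_of_neg_of_neg (hab σ).1 (hab σ).2)
  refine (Set.Finite.preimage (f := fun x : ℍ[K, a, b] => (x.re, x.imI, x.imJ, x.imK)) ?_ (h1.prod (h2.prod (h3.prod h4)))).subset ?_
  · intro x _ y _ h
    simp only [Prod.mk.injEq] at h
    exact QuaternionAlgebra.ext h.1 h.2.1 h.2.2.1 h.2.2.2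
  · rintro x ⟨⟨p, q, r, s, rfl⟩, hx⟩
    have key : ∀ σ : K →+* ℝ, (σ p) ^ 2 + (- σ a) * (σ (c * q)) ^ 2 + (- σ b) * (σ (c * r)) ^ 2 + (σ a * σ b) * (σ (c ^ 2 * s)) ^ 2 = σ e := by
      intro σ
      rw [← hx]
      simp [nrdQ]
      ring
    have P1 : ∀ σ : K →+* ℝ, 0 ≤ (σ p) ^ 2 := fun σ => sq_nonneg _
    have P2 : ∀ σ : K →+* ℝ, 0 ≤ (- σ a) * (σ (c * q)) ^ 2 := fun σ => mul_nonneg (by linarith [(hab σ).1]) (sq_nonneg _)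
    have P3 : ∀ σ : K →+* ℝ, 0 ≤ (- σ b) * (σ (c * r)) ^ 2 := fun σ => mul_nonneg (by linarith [(hab σ).2]) (sq_nonneg _)
    have P4 : ∀ σ : K →+* ℝ, 0 ≤ (σ a * σ b) * (σ (c ^ 2 * s)) ^ 2 := fun σ => mul_nonneg (mul_pos_of_neg_of_neg (hab σ).1 (hab σ).2).le (sq_nonneg _)
    refine ⟨⟨p.2, fun σ => ?_⟩, ⟨(c * q : 𝓞 K).2, fun σ => ?_⟩, ⟨(c * r : 𝓞 K).2, fun σ => ?_⟩, ⟨?_, fun σ => ?_⟩⟩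
    · have := key σ; have := P1 σ; have := P2 σ; have := P3 σ; have := P4 σ
      rw [map_one]; dsimp only; linarith
    · have := key σ; have := P1 σ; have := P2 σ; have := P3 σ; have := P4 σ
      rw [map_neg]; dsimp only; linarith
    · have := key σ; have := P1 σ; have := P2 σ; have := P3 σ; have := P4 σ
      rw [map_neg]; dsimp only; linarith
    · have := RingOfIntegers.isIntegral_coe (c ^ 2 * s : 𝓞 K)
      rwa [map_mul, map_pow, map_natCast] at this
    · have := key σ; have := P1 σ; have := P2 σ; have := P3 σ; have := P4 σ
      rw [map_mul]; dsimp only; linarith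

lemma nrd_int {a b : K} {c : ℕ} {α β : 𝓞 K} {hα : (c : K) * a = algebraMap (𝓞 K) K α} {hβ : (c : K) * b = algebraMap (𝓞 K) K β} {x : ℍ[K, a, b]}
    (hx : x ∈ qOrd a b c α β hα hβ) : nrdQ a b x ∈ intSub K := by
  obtain ⟨p, q, r, s, rfl⟩ := hx
  refine ⟨p ^ 2 - c * α * q ^ 2 - c * β * r ^ 2 + α * β * c ^ 2 * s ^ 2, ?_⟩
  simp [nrdQ, ← hα, ← hβ, RingOfIntegers.coe_eq_algebraMap]
  ring

lemma vps_tdq [Algebra ℚ K] [FiniteDimensional ℚ K] (hreal : ∀ σ : K →+* ℂ, ∀ x : K, (σ x).im = 0) {a b : K}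
    (hab : ∀ σ : K →+* ℝ, σ a < 0 ∧ σ b < 0) : ∃ O : Subring ℍ[K, a, b], IsOrderIn O ∧ VPs (unitGroup O) := by
  have := numberField_of K
  have := units_fg K
  obtain ⟨c1, y1, hc1, hy1⟩ := exists_nat_integral K a
  obtain ⟨c2, y2, hc2, hy2⟩ := exists_nat_integral K b
  have hα : ((c1 * c2 : ℕ) : K) * a = algebraMap (𝓞 K) K (c2 * y1 : 𝓞 K) := by push_cast; simp [← hy1]; ring
  have hβ : ((c1 * c2 : ℕ) : K) * b = algebraMap (𝓞 K) K (c1 * y2 : 𝓞 K) := by push_cast; simp [← hy2]; ring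
  set O := qOrd a b (c1 * c2) _ _ hα hβ with hO
  refine ⟨O, qOrd_isOrder a b (by positivity) _ _ hα hβ, ?_⟩
  let G := (𝓞 K)ˣ
  let ι : G →* ℍ[K, a, b]ˣ := Units.map ((algebraMap K ℍ[K, a, b]).comp (algebraMap (𝓞 K) K)).toMonoidHom
  have hιv : ∀ g : G, (ι g : ℍ[K, a, b]) = ⟨(g : 𝓞 K), 0, 0, 0⟩ := fun g => rfl
  have hιO : ∀ g : G, (ι g : ℍ[K, a, b]) ∈ O := fun g => ⟨g, 0, 0, 0, by rw [hιv]; ext <;> simp⟩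
  have hι : Function.Injective ι := by
    intro g h hgh
    have := congrArg (fun u : ℍ[K, a, b]ˣ => (u : ℍ[K, a, b]).re) hgh
    simp only [hιv] at this
    exact Units.ext (RingOfIntegers.ext this)
  have hle : ι.range ≤ unitGroup O := by
    rintro _ ⟨g, rfl⟩
    rw [mem_unitGroup]
    refine ⟨hιO g, ?_⟩
    rw [← map_inv]; exact hιO _
  refine (vps_of_fg ι hι).comm ?_ ?_
  · rw [Subgroup.relIndex_eq_one.2 hle]; exact one_ne_zero
  let sq : Subgroup G := (powMonoidHom 2 : G →* G).range
  have hfin : Finite (G ⧸ sq) := by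
    have := Subgroup.finiteIndex_range_powMonoidHom_of_fg G (n := 2) (by norm_num)
    exact Subgroup.finite_quotient_of_finiteIndex
  let F : Set ℍ[K, a, b] := ⋃ k : G ⧸ sq, {x | x ∈ O ∧ nrdQ a b x = ((k.out : G) : 𝓞 K)}
  have hF : F.Finite := Set.finite_iUnion fun k => finite_nrd hreal hab _ _ _ hα hβ _
  have : Finite F := hF
  have main : ∀ u : unitGroup O, ∃ (w : G), ((u : ℍ[K, a, b]ˣ) : ℍ[K, a, b]) * (ι w : ℍ[K, a, b]) ∈ F := by
    rintro ⟨u, hu⟩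
    rw [mem_unitGroup] at hu
    have : Units.map (nrdQ a b) u ∈ unitGroup (intSub K) := by
      rw [mem_unitGroup]
      refine ⟨nrd_int hu.1, ?_⟩
      rw [← map_inv]
      exact nrd_int hu.2
    rw [← uMap_range] at this
    obtain ⟨g, hg⟩ := this
    have hg' : nrdQ a b u = (g : 𝓞 K) := (congrArg Units.val hg).symm
    have h1 : ((g : G ⧸ sq)).out⁻¹ * g ∈ sq := by
      rw [← QuotientGroup.eq, QuotientGroup.out_eq']
    obtain ⟨w, hw⟩ := h1
    refine ⟨w⁻¹, Set.mem_iUnion.2 ⟨(g : G ⧸ sq), O.mul_mem hu.1 (hιO _), ?_⟩⟩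
    rw [map_mul, hg', hιv]
    have h2 : ((g : G ⧸ sq)).out = g * (w⁻¹) ^ 2 := by
      have : w ^ 2 = ((g : G ⧸ sq)).out⁻¹ * g := hw
      rw [inv_pow, this]; group
    rw [h2]
    have h3 : ((g * w⁻¹ ^ 2 : G) : 𝓞 K) = (g : 𝓞 K) * ((w⁻¹ : G) : 𝓞 K) ^ 2 := rfl
    rw [h3]
    simp only [nrdQ, RingOfIntegers.coe_eq_algebraMap, map_mul, map_pow]
    simp
  choose w hw using main
  refine (finiteIndex_of_map (ι.range.subgroupOf (unitGroup O)) (fun u => (⟨_, hw u⟩ : F)) ?_).index_ne_zero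
  intro u v huv
  have h1 : (u : ℍ[K, a, b]ˣ) * ι (w u) = v * ι (w v) := Units.ext (congrArg Subtype.val huv)
  rw [Subgroup.mem_subgroupOf]
  refine ⟨w u * (w v)⁻¹, ?_⟩
  rw [map_mul, map_inv]
  push_cast
  rw [mul_inv_eq_iff_eq_mul, mul_assoc, ← h1]
  group
end TDQ

lemma arith_A {p q : ℤ} (hne : p ≠ 0 ∨ q ≠ 0) (h : p * q < -q ^ 2 ∨ 0 ≤ p * q) :
    0 ≤ p * (q + 2 * p) ∧ p * (q + 2 * p) < (q + 2 * p) ^ 2 := by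
  rcases h with h | h
  · rcases lt_trichotomy q 0 with hq | hq | hq
    · have h1 : 0 < p + q := by nlinarith
      have h2 : 0 < q + 2 * p := by linarith
      constructor <;> nlinarith [mul_pos h1 h2]
    · subst hq; simp at h
    · have h1 : p + q < 0 := by nlinarith
      have h2 : q + 2 * p < 0 := by linarith
      constructor <;> nlinarith [mul_pos_of_neg_of_neg h1 h2]
  · constructor
    · nlinarith [sq_nonneg p]
    · rcases hne with h1 | h1
      · have := sq_pos_of_ne_zero h1
        nlinarith [sq_nonneg q]
      · have := sq_pos_of_ne_zero h1
        nlinarith [sq_nonneg p]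

lemma arith_B {p q : ℤ} (hne : p ≠ 0 ∨ q ≠ 0) (h : p * q < 0 ∨ q ^ 2 ≤ p * q) :
    -(q - 2 * p) ^ 2 ≤ p * (q - 2 * p) ∧ p * (q - 2 * p) < 0 := by
  rcases h with h | h
  · constructor
    · nlinarith [sq_nonneg p, sq_nonneg q]
    · nlinarith [sq_nonneg p]
  · rcases lt_trichotomy q 0 with hq | hq | hq
    · have h1 : p ≤ q := by nlinarith
      constructor
      · nlinarith [mul_nonneg (sub_nonneg.2 h1) (show 0 ≤ q - 2 * p by linarith)]
      · nlinarith
    · subst hq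
      have h1 := sq_pos_of_ne_zero (hne.resolve_right (by simp))
      constructor <;> nlinarith
    · have h1 : q ≤ p := by nlinarith
      constructor
      · nlinarith [mul_nonneg (sub_nonneg.2 h1) (show 0 ≤ 2 * p - q by linarith)]
      · nlinarith

lemma round_two (m : ℤ) {n : ℤ} (hn : n ≠ 0) : ∃ k : ℤ, |m + 2 * k * n| ≤ |n| := by
  have hn' : 0 < |n| := abs_pos.2 hn
  have h1 := Int.emod_nonneg (m + |n|) (show 2 * |n| ≠ 0 by positivity)
  have h2 := Int.emod_lt_of_pos (m + |n|) (show 0 < 2 * |n| by positivity)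
  have h3 := Int.emod_add_mul_ediv (m + |n|) (2 * |n|)
  refine ⟨-((m + |n|) / (2 * |n|)) * n.sign, ?_⟩
  have h4 : m + 2 * (-((m + |n|) / (2 * |n|)) * n.sign) * n = (m + |n|) % (2 * |n|) - |n| := by
    have : n.sign * n = |n| := Int.sign_mul_self_eq_abs n
    calc _ = m - 2 * ((m + |n|) / (2 * |n|)) * (n.sign * n) := by ring
      _ = _ := by rw [this]; linarith
  rw [h4, abs_le]
  constructor <;> linarith

section M2
open Matrix

/-- Upper transvection by `n`. -/
def upU (n : ℤ) : (Matrix (Fin 2) (Fin 2) ℤ)ˣ where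
  val := !![1, n; 0, 1]
  inv := !![1, -n; 0, 1]
  val_inv := by ext i j; fin_cases i <;> fin_cases j <;> simp [Matrix.mul_apply, Fin.sum_univ_two]
  inv_val := by ext i j; fin_cases i <;> fin_cases j <;> simp [Matrix.mul_apply, Fin.sum_univ_two]

/-- Lower transvection by `n`. -/
def loU (n : ℤ) : (Matrix (Fin 2) (Fin 2) ℤ)ˣ where
  val := !![1, 0; n, 1]
  inv := !![1, 0; -n, 1]
  val_inv := by ext i j; fin_cases i <;> fin_cases j <;> simp [Matrix.mul_apply, Fin.sum_univ_two]
  inv_val := by ext i j; fin_cases i <;> fin_cases j <;> simp [Matrix.mul_apply, Fin.sum_univ_two]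

/-- The two generators. -/
def genU : Bool → (Matrix (Fin 2) (Fin 2) ℤ)ˣ
  | true => upU 2
  | false => loU 2

lemma col_ne (g : (Matrix (Fin 2) (Fin 2) ℤ)ˣ) : g.val 0 0 ≠ 0 ∨ g.val 1 0 ≠ 0 := by
  by_contra! h
  have h1 := congrFun (congrFun g.inv_val 0) 0
  simp only [Matrix.mul_apply, Fin.sum_univ_two] at h1
  simp [h.1, h.2] at h1

lemma free_genU : Function.Injective (FreeGroup.lift genU) := by
  let x : (Matrix (Fin 2) (Fin 2) ℤ)ˣ → ℤ := fun g => g.val 0 0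
  let y : (Matrix (Fin 2) (Fin 2) ℤ)ˣ → ℤ := fun g => g.val 1 0
  let X : Bool → Set (Matrix (Fin 2) (Fin 2) ℤ)ˣ := fun i => if i then {g | y g ^ 2 ≤ x g * y g} else {g | 0 ≤ x g * y g ∧ x g * y g < y g ^ 2}
  let Y : Bool → Set (Matrix (Fin 2) (Fin 2) ℤ)ˣ := fun i => if i then {g | x g * y g < - y g ^ 2} else {g | - y g ^ 2 ≤ x g * y g ∧ x g * y g < 0}
  have e1 : ∀ g, x (upU 2 * g) = x g + 2 * y g ∧ y (upU 2 * g) = y g := by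
    intro g; simp [x, y, upU, Matrix.mul_apply, Fin.sum_univ_two]
  have e2 : ∀ g, x ((upU 2)⁻¹ * g) = x g - 2 * y g ∧ y ((upU 2)⁻¹ * g) = y g := by
    intro g
    have : ((upU 2)⁻¹ : (Matrix (Fin 2) (Fin 2) ℤ)ˣ).val = !![1, -2; 0, 1] := rfl
    simp [x, y, -coe_units_inv, this, Matrix.mul_apply, Fin.sum_univ_two]; ring
  have e3 : ∀ g, x (loU 2 * g) = x g ∧ y (loU 2 * g) = y g + 2 * x g := by
    intro g; simp [x, y, loU, Matrix.mul_apply, Fin.sum_univ_two]; ring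
  have e4 : ∀ g, x ((loU 2)⁻¹ * g) = x g ∧ y ((loU 2)⁻¹ * g) = y g - 2 * x g := by
    intro g
    have : ((loU 2)⁻¹ : (Matrix (Fin 2) (Fin 2) ℤ)ˣ).val = !![1, 0; -2, 1] := rfl
    simp [x, y, -coe_units_inv, this, Matrix.mul_apply, Fin.sum_univ_two]; ring
  apply FreeGroup.injective_lift_of_ping_pong genU X Y
  · rintro (_ | _)
    · refine ⟨loU 2, ?_⟩
      simp [X, x, y, loU]
    · refine ⟨1, ?_⟩
      simp [X, x, y]
  · rintro (_ | _) (_ | _) hij <;> simp only [ne_eq, not_true_eq_false, Function.onFun] at hij ⊢ <;> rw [Set.disjoint_left] <;> intro g hg hg' <;> simp [X] at hg hg' <;> linarith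
  · rintro (_ | _) (_ | _) hij <;> simp only [ne_eq, not_true_eq_false, Function.onFun] at hij ⊢ <;> rw [Set.disjoint_left] <;> intro g hg hg' <;> simp [Y] at hg hg' <;> linarith
  · rintro (_ | _) (_ | _) <;> rw [Set.disjoint_left] <;> intro g hg hg' <;> simp [X, Y] at hg hg' <;> nlinarith [sq_nonneg (y g)]
  · rintro (_ | _) _ ⟨g, hg, rfl⟩
    · change loU 2 * g ∈ X false
      have hne : x g ≠ 0 ∨ y g ≠ 0 := col_ne g
      simp only [X, Y, Set.mem_compl_iff, Set.mem_setOf_eq, Bool.false_eq_true, if_false, not_and_or, not_le, not_lt] at hg ⊢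
      rw [(e3 g).1, (e3 g).2]
      generalize x g = p at *
      generalize y g = q at *
      exact arith_A hne hg
    · change upU 2 * g ∈ X true
      simp only [X, Y, Set.mem_compl_iff, Set.mem_setOf_eq, if_true, not_lt] at hg ⊢
      rw [(e1 g).1, (e1 g).2]
      nlinarith
  · rintro (_ | _) _ ⟨g, hg, rfl⟩
    · change (loU 2)⁻¹ * g ∈ Y false
      have hne : x g ≠ 0 ∨ y g ≠ 0 := col_ne g
      simp only [X, Y, Set.mem_compl_iff, Set.mem_setOf_eq, Bool.false_eq_true, if_false, not_and_or, not_le, not_lt] at hg ⊢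
      rw [(e4 g).1, (e4 g).2]
      generalize x g = p at *
      generalize y g = q at *
      exact arith_B hne hg
    · change (upU 2)⁻¹ * g ∈ Y true
      simp only [X, Y, Set.mem_compl_iff, Set.mem_setOf_eq, if_true, not_le] at hg ⊢
      rw [(e2 g).1, (e2 g).2]
      nlinarith

lemma upU_add (m n : ℤ) : upU (m + n) = upU m * upU n := by
  ext i j; fin_cases i <;> fin_cases j <;> simp [upU, Matrix.mul_apply, Fin.sum_univ_two]; ring

lemma loU_add (m n : ℤ) : loU (m + n) = loU m * loU n := by
  ext i j; fin_cases i <;> fin_cases j <;> simp [loU, Matrix.mul_apply, Fin.sum_univ_two]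

lemma upU_zero : upU 0 = 1 := by
  ext i j; fin_cases i <;> fin_cases j <;> simp [upU]

lemma loU_zero : loU 0 = 1 := by
  ext i j; fin_cases i <;> fin_cases j <;> simp [loU]

lemma upU_mem (k : ℤ) : upU (2 * k) ∈ (FreeGroup.lift genU).range := by
  have h2 : upU 2 ∈ (FreeGroup.lift genU).range := ⟨FreeGroup.of true, by simp [genU]⟩
  induction k using Int.induction_on with
  | zero => rw [mul_zero, upU_zero]; exact one_mem _
  | succ k ih => rw [mul_add, upU_add]; exact mul_mem ih h2
  | pred k ih =>
    have : 2 * (-(k : ℤ) - 1) = 2 * (-(k : ℤ)) + (-2) := by ring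
    rw [this, upU_add]
    exact mul_mem ih (inv_mem h2)

lemma loU_mem (k : ℤ) : loU (2 * k) ∈ (FreeGroup.lift genU).range := by
  have h2 : loU 2 ∈ (FreeGroup.lift genU).range := ⟨FreeGroup.of false, by simp [genU]⟩
  induction k using Int.induction_on with
  | zero => rw [mul_zero, loU_zero]; exact one_mem _
  | succ k ih => rw [mul_add, loU_add]; exact mul_mem ih h2
  | pred k ih =>
    have : 2 * (-(k : ℤ) - 1) = 2 * (-(k : ℤ)) + (-2) := by ring
    rw [this, loU_add]
    exact mul_mem ih (inv_mem h2)

lemma mem_genU (N : ℕ) : ∀ g : (Matrix (Fin 2) (Fin 2) ℤ)ˣ, |g.val 0 1| ≤ N → g.val 0 0 % 4 = 1 →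
    g.val 1 1 % 4 = 1 → g.val 0 1 % 2 = 0 → g.val 1 0 % 2 = 0 → g ∈ (FreeGroup.lift genU).range := by
  induction N with
  | zero =>
    intro g h0 hp hs hq hr
    have hq0 : g.val 0 1 = 0 := by simpa using h0
    have hdet : IsUnit g.val.det := (Matrix.isUnit_iff_isUnit_det _).1 g.isUnit
    rw [Matrix.det_fin_two, hq0, zero_mul, sub_zero] at hdet
    have h1 := isUnit_of_mul_isUnit_left hdet
    have h2 := isUnit_of_mul_isUnit_right hdet
    rw [Int.isUnit_iff] at h1 h2
    have h1' : g.val 0 0 = 1 := by omega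
    have h2' : g.val 1 1 = 1 := by omega
    obtain ⟨k, hk⟩ : ∃ k, g.val 1 0 = 2 * k := ⟨g.val 1 0 / 2, by omega⟩
    have : g = loU (2 * k) := by
      ext i j; fin_cases i <;> fin_cases j <;> simp [loU, h1', h2', hq0, hk]
    rw [this]; exact loU_mem k
  | succ N ih =>
    intro g h0 hp hs hq hr
    by_cases hq0 : g.val 0 1 = 0
    · exact ih g (by rw [hq0]; simp) hp hs hq hr
    obtain ⟨k, hk⟩ := round_two (g.val 0 0) hq0
    obtain ⟨q2, hq2⟩ : ∃ t, g.val 0 1 = 2 * t := ⟨g.val 0 1 / 2, by omega⟩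
    obtain ⟨r2, hr2⟩ : ∃ t, g.val 1 0 = 2 * t := ⟨g.val 1 0 / 2, by omega⟩
    set p := g.val 0 0 + 2 * k * g.val 0 1 with hpdef
    have hp4 : p % 4 = 1 := by
      have : p = g.val 0 0 + 4 * (k * q2) := by rw [hpdef, hq2]; ring
      omega
    have hplt : |p| < |g.val 0 1| := by
      rcases abs_cases p with h | h <;> rcases abs_cases (g.val 0 1) with h' | h' <;> omega
    have hp0 : p ≠ 0 := by omega
    obtain ⟨l, hl⟩ := round_two (g.val 0 1) hp0
    set r := g.val 1 0 + 2 * k * g.val 1 1 with hrdef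
    have c00 : (g * loU (2 * k) * upU (2 * l)).val 0 0 = p := by
      simp [loU, upU, Matrix.mul_apply, Fin.sum_univ_two, hpdef]; ring
    have c01 : (g * loU (2 * k) * upU (2 * l)).val 0 1 = g.val 0 1 + 2 * l * p := by
      simp [loU, upU, Matrix.mul_apply, Fin.sum_univ_two, hpdef]; ring
    have c10 : (g * loU (2 * k) * upU (2 * l)).val 1 0 = r := by
      simp [loU, upU, Matrix.mul_apply, Fin.sum_univ_two, hrdef]; ring
    have c11 : (g * loU (2 * k) * upU (2 * l)).val 1 1 = g.val 1 1 + 2 * l * r := by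
      simp [loU, upU, Matrix.mul_apply, Fin.sum_univ_two, hrdef]; ring
    have hr2' : r = 2 * (r2 + k * g.val 1 1) := by rw [hrdef, hr2]; ring
    have key : g * loU (2 * k) * upU (2 * l) ∈ (FreeGroup.lift genU).range := by
      apply ih
      · rw [c01]; push_cast at h0; linarith
      · rw [c00]; exact hp4
      · rw [c11]
        have : g.val 1 1 + 2 * l * r = g.val 1 1 + 4 * (l * (r2 + k * g.val 1 1)) := by rw [hr2']; ring
        omega
      · rw [c01]
        have : g.val 0 1 + 2 * l * p = g.val 0 1 + 2 * (l * p) := by ring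
        omega
      · rw [c10]; omega
    have := mul_mem (mul_mem key (inv_mem (upU_mem l))) (inv_mem (loU_mem k))
    simpa [mul_assoc] using this

lemma genU_finiteIndex : (FreeGroup.lift genU).range.FiniteIndex := by
  let f : (Matrix (Fin 2) (Fin 2) ℤ)ˣ →* (Matrix (Fin 2) (Fin 2) (ZMod 4))ˣ := 
    Units.map (Int.castRingHom (ZMod 4)).mapMatrix.toMonoidHom
  have hk : f.ker ≤ (FreeGroup.lift genU).range := by
    intro g hg
    have hg' : ∀ i j, ((g.val i j : ℤ) : ZMod 4) = (1 : Matrix (Fin 2) (Fin 2) (ZMod 4)) i j := by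
      intro i j
      have := congrArg Units.val ((MonoidHom.mem_ker).1 hg)
      exact congrFun (congrFun this i) j
    have h00 : ((g.val 0 0 : ℤ) : ZMod 4) = (1 : ℤ) := by simpa using hg' 0 0
    have h01 : ((g.val 0 1 : ℤ) : ZMod 4) = (0 : ℤ) := by simpa using hg' 0 1
    have h10 : ((g.val 1 0 : ℤ) : ZMod 4) = (0 : ℤ) := by simpa using hg' 1 0
    have h11 : ((g.val 1 1 : ℤ) : ZMod 4) = (1 : ℤ) := by simpa using hg' 1 1
    rw [ZMod.intCast_eq_intCast_iff'] at h00 h01 h10 h11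
    push_cast at h00 h01 h10 h11
    refine mem_genU (g.val 0 1).natAbs g (by simp) ?_ ?_ ?_ ?_ <;> omega
  have : f.ker.FiniteIndex := Subgroup.finiteIndex_ker f
  exact Subgroup.finiteIndex_of_le hk

lemma vps_m2 : ∃ O : Subring (Matrix (Fin 2) (Fin 2) ℚ), IsOrderIn O ∧ VPs (unitGroup O) := by
  let ψ : Matrix (Fin 2) (Fin 2) ℤ →+* Matrix (Fin 2) (Fin 2) ℚ := (Int.castRingHom ℚ).mapMatrix
  have hψ : Function.Injective ψ := by
    intro x y h
    ext i j
    have := congrFun (congrFun h i) j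
    exact Int.cast_injective (α := ℚ) this
  refine ⟨ψ.range, ⟨?_, ?_⟩, ?_⟩
  · have h : (⊤ : AddSubgroup (Matrix (Fin 2) (Fin 2) ℤ)).FG := by
      rw [← AddGroup.fg_def, ← Module.Finite.iff_addGroup_fg]; infer_instance
    have := addSubgroup_fg_map h ψ.toAddMonoidHom
    have e : ψ.range.toAddSubgroup = (⊤ : AddSubgroup (Matrix (Fin 2) (Fin 2) ℤ)).map ψ.toAddMonoidHom := by
      ext x
      constructor
      · rintro ⟨y, rfl⟩; exact ⟨y, trivial, rfl⟩
      · rintro ⟨y, -, rfl⟩; exact ⟨y, rfl⟩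
    rw [e]
    exact this
  · rw [eq_top_iff]
    intro x _
    rw [Matrix.matrix_eq_sum_single x]
    refine Submodule.sum_mem _ fun i _ => Submodule.sum_mem _ fun j _ => ?_
    have : Matrix.single i j (x i j) = x i j • ψ (Matrix.single i j 1) := by
      ext k l
      simp [ψ, Matrix.single_apply]
    rw [this]
    exact Submodule.smul_mem _ _ (Submodule.subset_span ⟨_, rfl⟩)
  · have h0 : VPs (⊤ : Subgroup (Matrix (Fin 2) (Fin 2) ℤ)ˣ) := by
      refine ⟨Unit, inferInstance, fun _ => Bool, 
        (FreeGroup.lift genU).comp (Pi.evalMonoidHom (fun _ : Unit => FreeGroup Bool) ()), ?_, le_top, ?_⟩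
      · intro a b h
        funext i
        exact free_genU h
      · rw [Subgroup.relIndex_top_right, MonoidHom.range_comp, MonoidHom.range_eq_top.2, ← MonoidHom.range_eq_map]
        · exact genU_finiteIndex.index_ne_zero
        · intro a; exact ⟨fun _ => a, rfl⟩
    have h1 := h0.map (Units.map ψ.toMonoidHom) (Units.map_injective hψ)
    convert h1 using 1
    ext u
    rw [mem_unitGroup]
    constructor
    · rintro ⟨⟨x, hx⟩, ⟨y, hy⟩⟩
      refine ⟨⟨x, y, ?_, ?_⟩, trivial, Units.ext hx⟩
      · apply hψ; rw [map_mul, hx, hy, map_one]; exact u.val_inv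
      · apply hψ; rw [map_mul, hx, hy, map_one]; exact u.inv_val
    · rintro ⟨v, -, rfl⟩
      exact ⟨⟨v.val, rfl⟩, ⟨v.inv, rfl⟩⟩
end M2

/-- Let `A₁, …, Aₙ` be finite-dimensional simple `ℚ`-algebras and
`S` an order in `A = A₁ × ⋯ × Aₙ`. Then `Sˣ` is virtually a direct product of
finitely many free groups iff each `Aᵢ` is either commutative (a number field),
a totally definite quaternion algebra, or isomorphic to `M₂(ℚ)`. -/
theorem units_of_order_virtually_product_of_free_iff
    (n : ℕ) (A : Fin n → Type) [∀ i, Ring (A i)] [∀ i, Algebra ℚ (A i)]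
    [∀ i, FiniteDimensional ℚ (A i)] (hsimple : ∀ i, IsSimpleRing (A i))
    (S : Subring (∀ i, A i)) (hS : IsOrderIn S) :
    IsVirtuallyDirectProductOfFreeGroups (↥S)ˣ ↔
      ∀ i, (∀ x y : A i, x * y = y * x) ∨ IsTotallyDefiniteQuaternionAlgebra (A i) ∨
        Nonempty (A i ≃+* Matrix (Fin 2) (Fin 2) ℚ) := by
  refine ⟨fun hV i => forward_dir hsimple hS hV i, fun h => backward_assembly hS (fun i O hO => ?_)⟩
  rcases h i with h | ⟨K, _, _, _, hreal, a, b, -, -, hab, ⟨e⟩⟩ | ⟨⟨e⟩⟩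
  · exact vps_comm_simple (hsimple i) h hO
  · exact vps_unitGroup e.symm (vps_tdq hreal hab) hO
  · exact vps_unitGroup e.symm vps_m2 hO
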